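/- There is a universal constant C > 0 with the following property. Let u : ℝ × ℝ → ℂ be a classical solution of the defocusing cubic NLS i∂_t u + ∂_x² u = 2|u|² u with initial data u₀ = u(0,·). Then the global space-time Strichartz bound holds: ‖u‖_{L⁶(ℝ×ℝ)}² ≤ C ‖u₀‖_{L²(ℝ)}². -/

import Mathlib

open MeasureTheory Complex

noncomputable section

/-- Time partial derivative of `u : ℝ × ℝ → ℂ`. -/
def pt (u : ℝ × ℝ → ℂ) (t x : ℝ) : ℂ := deriv (fun s => u (s, x)) t

/-- Space partial derivative of `u : ℝ × ℝ → ℂ`. -/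
def px (u : ℝ × ℝ → ℂ) (t x : ℝ) : ℂ := deriv (fun y => u (t, y)) x

/-- Second space partial derivative. -/
def pxx (u : ℝ × ℝ → ℂ) (t x : ℝ) : ℂ := deriv (fun y => px u t y) x

/-- `u` together with all its partial derivatives decays rapidly in `x`,
locally uniformly in `t`. -/
def RapidDecay (u : ℝ × ℝ → ℂ) : Prop :=
  ∀ (n N : ℕ) (R : ℝ), ∃ C : ℝ, ∀ t x : ℝ, |t| ≤ R →
    ‖iteratedFDeriv ℝ n u (t, x)‖ * (1 + |x|) ^ N ≤ C

/-- A classical solution of the cubic NLS `i ∂ₜ u + ∂ₓ² u = κ |u|² u`: smooth, rapidly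
decaying in `x` locally uniformly in `t`, solving the equation pointwise. -/
def IsClassicalSolution (κ : ℝ) (u : ℝ × ℝ → ℂ) : Prop :=
  ContDiff ℝ (⊤ : ℕ∞) u ∧ RapidDecay u ∧
    ∀ t x : ℝ, Complex.I * pt u t x + pxx u t x
      = (κ : ℂ) * (‖u (t, x)‖ : ℂ) ^ 2 * u (t, x)

noncomputable section PartPl
open scoped FourierTransform SchwartzMap
lemma fourier_ae_eq {g : ℝ → ℂ} (h1 : Integrable g) (h2 : MemLp g 2) :
    (𝓕 (h2.toLp g) : Lp ℂ 2 (volume : Measure ℝ)) =ᵐ[volume] (𝓕 g : ℝ → ℂ) := by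
  set F : Lp ℂ 2 (volume : Measure ℝ) := 𝓕 (h2.toLp g) with hF
  have hFL : LocallyIntegrable (F : ℝ → ℂ) volume :=
    (Lp.memLp F).locallyIntegrable (by norm_num)
  have hgc : Continuous (𝓕 g : ℝ → ℂ) := VectorFourier.fourierIntegral_continuous
    Real.continuous_fourierChar (by exact continuous_inner) h1
  have hgL : LocallyIntegrable (𝓕 g : ℝ → ℂ) volume := hgc.locallyIntegrable
  apply ae_eq_of_integral_contDiff_smul_eq hFL hgL
  intro φ hφ hφc
  -- the Schwartz function
  have hφ' : ContDiff ℝ (⊤ : ℕ∞) (fun x => (φ x : ℂ)) := Complex.ofRealCLM.contDiff.comp hφ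
  have hφc' : HasCompactSupport (fun x => (φ x : ℂ)) := hφc.comp_left (g := fun r : ℝ => (r : ℂ)) (by simp)
  let ψ : 𝓢(ℝ, ℂ) := hφc'.toSchwartzMap hφ'
  have key : (𝓕 ((h2.toLp g : Lp ℂ 2 (volume : Measure ℝ)) : 𝓢'(ℝ, ℂ))) ψ = (F : 𝓢'(ℝ, ℂ)) ψ := by
    rw [Lp.fourier_toTemperedDistribution_eq]
  rw [TemperedDistribution.fourier_apply, Lp.toTemperedDistribution_apply,
    Lp.toTemperedDistribution_apply] at key
  have e1 : ∫ x, (𝓕 ψ) x • (h2.toLp g : ℝ → ℂ) x = ∫ x, (𝓕 ψ) x • g x := by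
    apply integral_congr_ae
    filter_upwards [h2.coeFn_toLp] with x hx
    rw [hx]
  rw [e1] at key
  have e2 := VectorFourier.integral_fourierIntegral_smul_eq_flip (L := innerₗ ℝ) (μ := volume) (ν := volume) 
    (f := (ψ : ℝ → ℂ)) (g := g) Real.continuous_fourierChar (by exact continuous_inner) ψ.integrable h1
  have e3 : ∫ x, (𝓕 ψ) x • g x = ∫ x, ψ x • (𝓕 g) x := by
    simp only [flip_innerₗ] at e2
    exact e2
  rw [e3] at key
  exact key.symm

lemma plancherel_memLp {g : ℝ → ℂ} (h1 : Integrable g) (h2 : MemLp g 2) :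
    MemLp (𝓕 g : ℝ → ℂ) 2 :=
  (memLp_congr_ae (fourier_ae_eq h1 h2)).1 (Lp.memLp _)

lemma plancherel_inner {g h : ℝ → ℂ} (h1 : Integrable g) (h2 : MemLp g 2)
    (k1 : Integrable h) (k2 : MemLp h 2) :
    ∫ η, (𝓕 h) η * starRingEnd ℂ ((𝓕 g) η) = ∫ x, h x * starRingEnd ℂ (g x) := by
  have := Lp.inner_fourier_eq (h2.toLp g) (k2.toLp h)
  rw [L2.inner_def, L2.inner_def] at this
  have e1 : ∫ a, inner ℂ ((h2.toLp g : ℝ → ℂ) a) ((k2.toLp h : ℝ → ℂ) a)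
      = ∫ x, h x * starRingEnd ℂ (g x) := by
    apply integral_congr_ae
    filter_upwards [h2.coeFn_toLp, k2.coeFn_toLp] with x hx hy
    simp [hx, hy]
  rw [← e1, ← this]
  apply integral_congr_ae
  filter_upwards [fourier_ae_eq h1 h2, fourier_ae_eq k1 k2] with x hx hy
  simp [hx, hy]

/-- Fourier transform in the normalisation used below. -/
def FT (g : ℝ → ℂ) (s : ℝ) : ℂ := ∫ r : ℝ, cexp (2 * I * s * r) * g r

lemma FT_eq (g : ℝ → ℂ) (s : ℝ) : FT g s = (𝓕 g) (-s / Real.pi) := by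
  rw [Real.fourier_real_eq_integral_exp_smul]
  unfold FT
  apply integral_congr_ae
  refine Filter.Eventually.of_forall fun r => ?_
  simp only [smul_eq_mul]
  congr 2
  have : (Real.pi : ℂ) ≠ 0 := by exact_mod_cast Real.pi_ne_zero
  push_cast
  field_simp

lemma FT_scale (F : ℝ → ℂ) : ∫ s : ℝ, F (-s / Real.pi) = Real.pi * ∫ η, F η := by
  have := Measure.integral_comp_mul_left F (-Real.pi⁻¹)
  simp only [inv_neg, inv_inv, abs_neg, abs_of_pos Real.pi_pos] at this
  rw [← Complex.real_smul, ← this]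
  congr 1; ext s; congr 1; field_simp

lemma FT_inner {g h : ℝ → ℂ} (h1 : Integrable g) (h2 : MemLp g 2)
    (k1 : Integrable h) (k2 : MemLp h 2) :
    ∫ s, FT h s * starRingEnd ℂ (FT g s) = Real.pi * ∫ x, h x * starRingEnd ℂ (g x) := by
  simp only [FT_eq]
  rw [FT_scale (fun η => (𝓕 h : ℝ → ℂ) η * starRingEnd ℂ ((𝓕 g : ℝ → ℂ) η)), plancherel_inner h1 h2 k1 k2]

lemma FT_memLp {g : ℝ → ℂ} (h1 : Integrable g) (h2 : MemLp g 2) : MemLp (FT g) 2 := by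
  have e : FT g = fun s => (𝓕 g) (-s / Real.pi) := by ext s; exact FT_eq g s
  have hm := plancherel_memLp h1 h2
  have hgc : Continuous (𝓕 g : ℝ → ℂ) := VectorFourier.fourierIntegral_continuous
    Real.continuous_fourierChar (by exact continuous_inner) h1
  have hc : Continuous (FT g) := by
    rw [e]; exact hgc.comp (by fun_prop)
  rw [memLp_two_iff_integrable_sq_norm hc.aestronglyMeasurable]
  rw [memLp_two_iff_integrable_sq_norm hgc.aestronglyMeasurable] at hm
  have := (integrable_comp_mul_left_iff (fun x : ℝ => ‖(𝓕 g : ℝ → ℂ) x‖ ^ 2)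
    (R := -Real.pi⁻¹) (by simp [Real.pi_ne_zero])).2 hm
  refine this.congr (Filter.Eventually.of_forall fun s => ?_)
  simp only
  rw [FT_eq]; congr 3; field_simp

lemma FT_integrable_sq {g : ℝ → ℂ} (h1 : Integrable g) (h2 : MemLp g 2) :
    Integrable (fun s => ‖FT g s‖ ^ 2) :=
  (memLp_two_iff_integrable_sq_norm (FT_memLp h1 h2).1).1 (FT_memLp h1 h2)

lemma FT_sq {g : ℝ → ℂ} (h1 : Integrable g) (h2 : MemLp g 2) :
    ∫ s, ‖FT g s‖ ^ 2 = Real.pi * ∫ x, ‖g x‖ ^ 2 := by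
  have := FT_inner h1 h2 h1 h2
  simp only [Complex.mul_conj, Complex.normSq_eq_norm_sq] at this
  rw [integral_complex_ofReal, integral_complex_ofReal] at this
  exact_mod_cast this

end PartPl

noncomputable section PartU
open scoped ComplexConjugate

/-- Working package of facts about a classical solution. -/
structure Good (u ux uxx ut : ℝ → ℝ → ℂ) : Prop where
  cu : Continuous (fun z : ℝ × ℝ => u z.1 z.2)
  cux : Continuous (fun z : ℝ × ℝ => ux z.1 z.2)
  cuxx : Continuous (fun z : ℝ × ℝ => uxx z.1 z.2)
  cut : Continuous (fun z : ℝ × ℝ => ut z.1 z.2)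
  dx : ∀ t x, HasDerivAt (u t) (ux t x) x
  dxx : ∀ t x, HasDerivAt (ux t) (uxx t x) x
  dt : ∀ t x, HasDerivAt (fun s => u s x) (ut t x) t
  eq : ∀ t x, ut t x = I * uxx t x - 2 * I * (u t x * conj (u t x)) * u t x
  bd : ∀ R : ℝ, ∃ C : ℝ, 0 ≤ C ∧ ∀ t x, |t| ≤ R → ‖u t x‖ ≤ C * (1 + x ^ 2)⁻¹ ∧
    ‖ux t x‖ ≤ C * (1 + x ^ 2)⁻¹ ∧ ‖uxx t x‖ ≤ C * (1 + x ^ 2)⁻¹ ∧ ‖ut t x‖ ≤ C * (1 + x ^ 2)⁻¹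
  tay : ∀ R : ℝ, ∃ C : ℝ, 0 ≤ C ∧ ∀ t t' x, |t| ≤ R → |t'| ≤ R →
    ‖u t' x - u t x - (t' - t : ℝ) * ut t x‖ ≤ C * (t' - t) ^ 2

lemma abs_weight (x : ℝ) : 1 + x ^ 2 ≤ (1 + |x|) ^ 2 := by
  nlinarith [abs_nonneg x, sq_abs x]

lemma good_of_sol {u : ℝ × ℝ → ℂ} (h : IsClassicalSolution 2 u) :
    Good (fun t x => u (t, x)) (px u) (pxx u) (pt u) := by
  obtain ⟨hs, hd, heq⟩ := h
  have hs2 : ContDiff ℝ 2 u := contDiff_infty.1 hs 2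
  have hdiff : Differentiable ℝ u := hs2.differentiable (by norm_num)
  have hs1 : ContDiff ℝ 1 (fderiv ℝ u) := hs2.fderiv_right (by norm_num)
  have hdiff1 : Differentiable ℝ (fderiv ℝ u) := hs1.differentiable (by norm_num)
  have hs0 : Continuous (fderiv ℝ (fderiv ℝ u)) := hs1.continuous_fderiv (by norm_num)
  have lx : ∀ t x : ℝ, HasDerivAt (fun y : ℝ => (t, y)) ((0 : ℝ), (1 : ℝ)) x := fun t x =>
    (hasDerivAt_const x t).prodMk (hasDerivAt_id x)
  have lt : ∀ t x : ℝ, HasDerivAt (fun s : ℝ => (s, x)) ((1 : ℝ), (0 : ℝ)) t := fun t x =>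
    (hasDerivAt_id t).prodMk (hasDerivAt_const t x)
  have Dx : ∀ t x, HasDerivAt (fun y => u (t, y)) (fderiv ℝ u (t, x) (0, 1)) x := fun t x =>
    (hdiff (t, x)).hasFDerivAt.comp_hasDerivAt x (lx t x)
  have Dt : ∀ t x, HasDerivAt (fun s => u (s, x)) (fderiv ℝ u (t, x) (1, 0)) t := fun t x =>
    (hdiff (t, x)).hasFDerivAt.comp_hasDerivAt t (lt t x)
  have Dx1 : ∀ t x, ∀ v : ℝ × ℝ, HasDerivAt (fun y => fderiv ℝ u (t, y) v)
      (fderiv ℝ (fderiv ℝ u) (t, x) (0, 1) v) x := fun t x v =>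
    by
    have := (hdiff1 (t, x)).hasFDerivAt.comp_hasDerivAt x (lx t x)
    simpa using this.clm_apply (hasDerivAt_const x v)
  have Dt1 : ∀ t x, ∀ v : ℝ × ℝ, HasDerivAt (fun s => fderiv ℝ u (s, x) v)
      (fderiv ℝ (fderiv ℝ u) (t, x) (1, 0) v) t := fun t x v =>
    by
    have := (hdiff1 (t, x)).hasFDerivAt.comp_hasDerivAt t (lt t x)
    simpa using this.clm_apply (hasDerivAt_const t v)
  have epx : ∀ t x, px u t x = fderiv ℝ u (t, x) (0, 1) := fun t x => (Dx t x).deriv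
  have ept : ∀ t x, pt u t x = fderiv ℝ u (t, x) (1, 0) := fun t x => (Dt t x).deriv
  have epx' : ∀ t, px u t = fun x => fderiv ℝ u (t, x) (0, 1) := fun t => funext (epx t)
  have epxx : ∀ t x, pxx u t x = fderiv ℝ (fderiv ℝ u) (t, x) (0, 1) (0, 1) := by
    intro t x
    unfold pxx
    have := (Dx1 t x (0, 1)).deriv
    rw [← this]; congr 1; exact epx' t
  have n10 : ‖((1 : ℝ), (0 : ℝ))‖ = 1 := by simp [Prod.norm_def]
  have n01 : ‖((0 : ℝ), (1 : ℝ))‖ = 1 := by simp [Prod.norm_def]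
  have nd1 : ∀ z, ∀ v : ℝ × ℝ, ‖v‖ = 1 → ‖fderiv ℝ u z v‖ ≤ ‖iteratedFDeriv ℝ 1 u z‖ := by
    intro z v hv
    have := (fderiv ℝ u z).le_opNorm v
    rw [hv, mul_one] at this
    rwa [norm_iteratedFDeriv_one]
  have nd2 : ∀ z, ∀ v w : ℝ × ℝ, ‖v‖ = 1 → ‖w‖ = 1 →
      ‖fderiv ℝ (fderiv ℝ u) z v w‖ ≤ ‖iteratedFDeriv ℝ 2 u z‖ := by
    intro z v w hv hw
    have := (iteratedFDeriv ℝ 2 u z).le_opNorm ![v, w]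
    rw [iteratedFDeriv_two_apply] at this
    simpa [hv, hw] using this
  have key : ∀ n R, ∃ C : ℝ, 0 ≤ C ∧ ∀ t x, |t| ≤ R →
      ‖iteratedFDeriv ℝ n u (t, x)‖ ≤ C * (1 + x ^ 2)⁻¹ := by
    intro n R
    obtain ⟨C, hC⟩ := hd n 2 R
    refine ⟨max C 0, le_max_right _ _, fun t x ht => ?_⟩
    have h1 := hC t x ht
    have h2 := abs_weight x
    have h3 : 0 < 1 + x ^ 2 := by positivity
    rw [← div_eq_mul_inv, le_div_iff₀ h3]
    calc _ ≤ ‖iteratedFDeriv ℝ n u (t, x)‖ * (1 + |x|) ^ 2 := by gcongr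
      _ ≤ C := h1
      _ ≤ _ := le_max_left _ _
  refine ⟨by simpa using hdiff.continuous, ?_, ?_, ?_, ?_, ?_, ?_, ?_, ?_, ?_⟩
  · simp only [epx]
    exact (hs1.continuous.clm_apply continuous_const)
  · simp only [epxx]
    exact ((hs0.clm_apply continuous_const).clm_apply continuous_const)
  · simp only [ept]
    exact (hs1.continuous.clm_apply continuous_const)
  · intro t x; rw [epx]; exact Dx t x
  · intro t x; rw [epxx, epx']; exact Dx1 t x _
  · intro t x; rw [ept]; exact Dt t x
  · intro t x
    have := heq t x
    rw [Complex.mul_conj, Complex.normSq_eq_norm_sq]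
    push_cast at this ⊢
    linear_combination (-I) * this + (pt u t x) * I_sq
  · intro R
    obtain ⟨C0, p0, h0⟩ := key 0 R
    obtain ⟨C1, p1, h1⟩ := key 1 R
    obtain ⟨C2, p2, h2⟩ := key 2 R
    refine ⟨C0 + C1 + C2, by positivity, fun t x ht => ?_⟩
    have q : 0 ≤ (1 + x ^ 2)⁻¹ := by positivity
    have a0 := h0 t x ht
    have a1 := h1 t x ht
    have a2 := h2 t x ht
    rw [norm_iteratedFDeriv_zero] at a0
    have b1 := nd1 (t, x) _ n01
    have b2 := nd1 (t, x) _ n10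
    have b3 := nd2 (t, x) _ _ n01 n01
    rw [epx, epxx, ept]
    have := mul_nonneg p0 q
    have := mul_nonneg p1 q
    have := mul_nonneg p2 q
    refine ⟨?_, ?_, ?_, ?_⟩ <;> linarith
  · intro R
    obtain ⟨C2, p2, h2⟩ := key 2 R
    refine ⟨C2, p2, fun t t' x ht ht' => ?_⟩
    have hb : ∀ s, |s| ≤ R → ‖fderiv ℝ (fderiv ℝ u) (s, x) (1, 0) (1, 0)‖ ≤ C2 := by
      intro s hs
      refine (nd2 _ _ _ n10 n10).trans ((h2 s x hs).trans ?_)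
      have : (1 + x ^ 2)⁻¹ ≤ 1 := inv_le_one_of_one_le₀ (by nlinarith [sq_nonneg x])
      nlinarith
    have hseg : ∀ s ∈ Set.uIcc t t', |s| ≤ R := by
      intro s hs
      rw [abs_le] at *
      rcases Set.mem_uIcc.1 hs with h | h <;> constructor <;> linarith [h.1, h.2, ht.1, ht'.1, ht.2, ht'.2]
    have l1 : ∀ s ∈ Set.uIcc t t', ‖fderiv ℝ u (s, x) (1, 0) - fderiv ℝ u (t, x) (1, 0)‖
        ≤ C2 * |t' - t| := by
      intro s hs
      have := (convex_uIcc t t').norm_image_sub_le_of_norm_hasDerivWithin_le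
        (f := fun s => fderiv ℝ u (s, x) (1, 0)) (C := C2)
        (f' := fun s => fderiv ℝ (fderiv ℝ u) (s, x) (1, 0) (1, 0))
        (fun s _ => (Dt1 s x _).hasDerivWithinAt) (fun s hs => hb s (hseg s hs))
        Set.left_mem_uIcc hs
      refine this.trans ?_
      gcongr
      rw [Real.norm_eq_abs]
      exact Set.abs_sub_left_of_mem_uIcc hs
    have := (convex_uIcc t t').norm_image_sub_le_of_norm_hasDerivWithin_le
        (f := fun s => u (s, x) - (s : ℂ) * fderiv ℝ u (t, x) (1, 0)) (C := C2 * |t' - t|)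
        (f' := fun s => fderiv ℝ u (s, x) (1, 0) - 1 * fderiv ℝ u (t, x) (1, 0))
        (fun s _ => ((Dt s x).sub ((HasDerivAt.ofReal_comp (hasDerivAt_id s)).mul_const _)).hasDerivWithinAt)
        (fun s hs => by simpa using l1 s hs)
        Set.left_mem_uIcc Set.right_mem_uIcc
    rw [ept]
    calc _ = ‖u (t', x) - (t' : ℂ) * fderiv ℝ u (t, x) (1, 0) - (u (t, x) - (t : ℂ) * fderiv ℝ u (t, x) (1, 0))‖ := by
            push_cast; congr 1; ring
      _ ≤ _ := this
      _ = _ := by rw [Real.norm_eq_abs, mul_assoc, abs_mul_abs_self]; ring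

end PartU

noncomputable section PartCo
open scoped ComplexConjugate
open Filter Topology

/-- jointly continuous and `O((1+x²)⁻¹)` locally uniformly in time -/
def Dec {E : Type*} [NormedAddCommGroup E] (F : ℝ → ℝ → E) : Prop :=
  Continuous (fun z : ℝ × ℝ => F z.1 z.2) ∧
    ∀ R : ℝ, ∃ C : ℝ, 0 ≤ C ∧ ∀ t x, |t| ≤ R → ‖F t x‖ ≤ C * (1 + x ^ 2)⁻¹

/-- jointly continuous and bounded locally uniformly in time -/
def Bdc {E : Type*} [NormedAddCommGroup E] (F : ℝ → ℝ → E) : Prop :=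
  Continuous (fun z : ℝ × ℝ => F z.1 z.2) ∧
    ∀ R : ℝ, ∃ C : ℝ, 0 ≤ C ∧ ∀ t x, |t| ≤ R → ‖F t x‖ ≤ C

lemma wt_le_one (x : ℝ) : (1 + x ^ 2)⁻¹ ≤ 1 := inv_le_one_of_one_le₀ (by nlinarith [sq_nonneg x])
lemma wt_nonneg (x : ℝ) : 0 ≤ (1 + x ^ 2)⁻¹ := by positivity

section
variable {E : Type*} [NormedAddCommGroup E] {F G : ℝ → ℝ → E}

lemma Dec.bdc (h : Dec F) : Bdc F := by
  refine ⟨h.1, fun R => ?_⟩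
  obtain ⟨C, hC, hb⟩ := h.2 R
  exact ⟨C, hC, fun t x ht => (hb t x ht).trans (by nlinarith [wt_le_one x, wt_nonneg x])⟩

lemma Bdc.of_const (c : E) : Bdc (fun _ _ => c) := ⟨by fun_prop, fun R => ⟨‖c‖, norm_nonneg _, fun _ _ _ => le_rfl⟩⟩

lemma Dec.add (h : Dec F) (k : Dec G) : Dec (fun t x => F t x + G t x) := by
  refine ⟨h.1.add k.1, fun R => ?_⟩
  obtain ⟨C, hC, hb⟩ := h.2 R
  obtain ⟨D, hD, kb⟩ := k.2 R
  refine ⟨C + D, by positivity, fun t x ht => (norm_add_le _ _).trans ?_⟩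
  rw [add_mul]; exact add_le_add (hb t x ht) (kb t x ht)

lemma Dec.neg (h : Dec F) : Dec (fun t x => -F t x) := by
  refine ⟨h.1.neg, fun R => ?_⟩
  obtain ⟨C, hC, hb⟩ := h.2 R
  exact ⟨C, hC, fun t x ht => by rw [norm_neg]; exact hb t x ht⟩

lemma Dec.sub (h : Dec F) (k : Dec G) : Dec (fun t x => F t x - G t x) := by
  simpa [sub_eq_add_neg] using h.add k.neg

lemma Bdc.add (h : Bdc F) (k : Bdc G) : Bdc (fun t x => F t x + G t x) := by
  refine ⟨h.1.add k.1, fun R => ?_⟩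
  obtain ⟨C, hC, hb⟩ := h.2 R
  obtain ⟨D, hD, kb⟩ := k.2 R
  exact ⟨C + D, by positivity, fun t x ht => (norm_add_le _ _).trans (add_le_add (hb t x ht) (kb t x ht))⟩

lemma Bdc.neg (h : Bdc F) : Bdc (fun t x => -F t x) := by
  refine ⟨h.1.neg, fun R => ?_⟩
  obtain ⟨C, hC, hb⟩ := h.2 R
  exact ⟨C, hC, fun t x ht => by rw [norm_neg]; exact hb t x ht⟩

lemma Bdc.sub (h : Bdc F) (k : Bdc G) : Bdc (fun t x => F t x - G t x) := by
  simpa [sub_eq_add_neg] using h.add k.neg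

lemma Dec.norm (h : Dec F) : Dec (fun t x => ‖F t x‖) :=
  ⟨h.1.norm, fun R => by
    obtain ⟨C, hC, hb⟩ := h.2 R
    exact ⟨C, hC, fun t x ht => by rw [norm_norm]; exact hb t x ht⟩⟩

lemma Dec.cx (h : Dec F) (t : ℝ) : Continuous (F t) := h.1.comp (by fun_prop : Continuous fun x : ℝ => (t, x))
lemma Bdc.cx (h : Bdc F) (t : ℝ) : Continuous (F t) := h.1.comp (by fun_prop : Continuous fun x : ℝ => (t, x))

lemma Dec.integrable (h : Dec F) (t : ℝ) : Integrable (F t) := by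
  obtain ⟨C, hC, hb⟩ := h.2 |t|
  exact (integrable_inv_one_add_sq.const_mul C).mono' (h.cx t).aestronglyMeasurable
    (Eventually.of_forall fun x => hb t x le_rfl)

lemma wt_tendsto_atBot : Tendsto (fun x : ℝ => (1 + x ^ 2)⁻¹) atBot (𝓝 0) := by
  apply Tendsto.inv_tendsto_atTop
  apply tendsto_atTop_add_const_left
  have := (tendsto_pow_atTop (α := ℝ) (n := 2) (by norm_num)).comp tendsto_neg_atBot_atTop
  simpa [Function.comp_def] using this

lemma wt_tendsto_atTop : Tendsto (fun x : ℝ => (1 + x ^ 2)⁻¹) atTop (𝓝 0) := by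
  apply Tendsto.inv_tendsto_atTop
  apply tendsto_atTop_add_const_left
  exact tendsto_pow_atTop (by norm_num)

lemma Dec.tendsto_atBot (h : Dec F) (t : ℝ) : Tendsto (F t) atBot (𝓝 0) := by
  obtain ⟨C, hC, hb⟩ := h.2 |t|
  apply squeeze_zero_norm (fun x => hb t x le_rfl)
  simpa using wt_tendsto_atBot.const_mul C

lemma Dec.tendsto_atTop (h : Dec F) (t : ℝ) : Tendsto (F t) atTop (𝓝 0) := by
  obtain ⟨C, hC, hb⟩ := h.2 |t|
  apply squeeze_zero_norm (fun x => hb t x le_rfl)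
  simpa using wt_tendsto_atTop.const_mul C
end

section
variable {F G : ℝ → ℝ → ℂ} {f g : ℝ → ℝ → ℝ}
lemma Dec.mulB {A : Type*} [NormedRing A] {F G : ℝ → ℝ → A} (h : Dec F) (k : Bdc G) :
    Dec (fun t x => F t x * G t x) := by
  refine ⟨h.1.mul k.1, fun R => ?_⟩
  obtain ⟨C, hC, hb⟩ := h.2 R
  obtain ⟨D, hD, kb⟩ := k.2 R
  refine ⟨C * D, by positivity, fun t x ht => (norm_mul_le _ _).trans ?_⟩
  calc _ ≤ (C * (1 + x ^ 2)⁻¹) * D := by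
        have := hb t x ht; have := kb t x ht; have := wt_nonneg x; gcongr
    _ = _ := by ring
lemma Bdc.mulD {A : Type*} [NormedRing A] {F G : ℝ → ℝ → A} (h : Bdc F) (k : Dec G) :
    Dec (fun t x => F t x * G t x) := by
  refine ⟨h.1.mul k.1, fun R => ?_⟩
  obtain ⟨C, hC, hb⟩ := h.2 R
  obtain ⟨D, hD, kb⟩ := k.2 R
  refine ⟨C * D, by positivity, fun t x ht => (norm_mul_le _ _).trans ?_⟩
  calc _ ≤ C * (D * (1 + x ^ 2)⁻¹) := by
        have := hb t x ht; have := kb t x ht; have := wt_nonneg x; gcongr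
    _ = _ := by ring
lemma Bdc.mul {A : Type*} [NormedRing A] {F G : ℝ → ℝ → A} (h : Bdc F) (k : Bdc G) :
    Bdc (fun t x => F t x * G t x) := by
  refine ⟨h.1.mul k.1, fun R => ?_⟩
  obtain ⟨C, hC, hb⟩ := h.2 R
  obtain ⟨D, hD, kb⟩ := k.2 R
  refine ⟨C * D, by positivity, fun t x ht => (norm_mul_le _ _).trans ?_⟩
  have := hb t x ht; have := kb t x ht; gcongr
lemma Dec.mul {A : Type*} [NormedRing A] {F G : ℝ → ℝ → A} (h : Dec F) (k : Dec G) :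
    Dec (fun t x => F t x * G t x) := h.mulB k.bdc
lemma Dec.cmul {A : Type*} [NormedRing A] {F : ℝ → ℝ → A} (c : A) (h : Dec F) :
    Dec (fun t x => c * F t x) := (Bdc.of_const c).mulD h
lemma Dec.conj (h : Dec F) : Dec (fun t x => conj (F t x)) :=
  ⟨continuous_conj.comp h.1, fun R => by simpa using h.2 R⟩
lemma Bdc.conj (h : Bdc F) : Bdc (fun t x => conj (F t x)) :=
  ⟨continuous_conj.comp h.1, fun R => by simpa using h.2 R⟩
lemma Dec.re (h : Dec F) : Dec (fun t x => (F t x).re) :=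
  ⟨continuous_re.comp h.1, fun R => by
    obtain ⟨C, hC, hb⟩ := h.2 R
    exact ⟨C, hC, fun t x ht => (abs_re_le_norm _).trans (hb t x ht)⟩⟩
lemma Dec.im (h : Dec F) : Dec (fun t x => (F t x).im) :=
  ⟨continuous_im.comp h.1, fun R => by
    obtain ⟨C, hC, hb⟩ := h.2 R
    exact ⟨C, hC, fun t x ht => (abs_im_le_norm _).trans (hb t x ht)⟩⟩
end

lemma Dec.mono {E E' : Type*} [NormedAddCommGroup E] [NormedAddCommGroup E']
    {F : ℝ → ℝ → E} {G : ℝ → ℝ → E'} (h : Dec F)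
    (hc : Continuous (fun z : ℝ × ℝ => G z.1 z.2)) (c : ℝ) (hle : ∀ t x, ‖G t x‖ ≤ c * ‖F t x‖) :
    Dec G := by
  refine ⟨hc, fun R => ?_⟩
  obtain ⟨C, hC, hb⟩ := h.2 R
  refine ⟨|c| * C, by positivity, fun t x ht => (hle t x).trans ?_⟩
  calc c * ‖F t x‖ ≤ |c| * (C * (1 + x ^ 2)⁻¹) :=
        mul_le_mul (le_abs_self c) (hb t x ht) (norm_nonneg _) (abs_nonneg _)
    _ = _ := by ring

section
variable {E : Type*} [NormedAddCommGroup E] [NormedSpace ℝ E] {F F' : ℝ → ℝ → E}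

lemma Dec.continuous_integral (h : Dec F) : Continuous (fun t => ∫ x, F t x) := by
  rw [continuous_iff_continuousAt]
  intro t0
  obtain ⟨C, hC, hb⟩ := h.2 (|t0| + 1)
  apply continuousAt_of_dominated (bound := fun x => C * (1 + x ^ 2)⁻¹)
  · exact Eventually.of_forall fun t => (h.cx t).aestronglyMeasurable
  · have : ∀ᶠ t in 𝓝 t0, |t| < |t0| + 1 :=
      (continuous_abs.tendsto t0).eventually (gt_mem_nhds (by linarith))
    filter_upwards [this] with t ht
    exact Eventually.of_forall fun x => hb t x ht.le
  · exact integrable_inv_one_add_sq.const_mul C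
  · exact Eventually.of_forall fun x =>
      (h.1.comp (by fun_prop : Continuous fun t : ℝ => (t, x))).continuousAt

lemma Dec.hasDerivAt_integral (h : Dec F) (h' : Dec F')
    (hd : ∀ t x, HasDerivAt (fun s => F s x) (F' t x) t) (S : Set ℝ) (t0 : ℝ) :
    HasDerivAt (fun t => ∫ x in S, F t x) (∫ x in S, F' t0 x) t0 := by
  obtain ⟨C, hC, hb⟩ := h'.2 (|t0| + 1)
  refine (hasDerivAt_integral_of_dominated_loc_of_deriv_le (μ := volume.restrict S) (F := F) (F' := F')
    (x₀ := t0) (bound := fun x => C * (1 + x ^ 2)⁻¹) (s := Metric.ball t0 1)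
    (Metric.ball_mem_nhds t0 one_pos) ?_ ?_ ?_ ?_ ?_ ?_).2
  · exact Eventually.of_forall fun t => (h.cx t).aestronglyMeasurable
  · exact (h.integrable t0).integrableOn
  · exact (h'.cx t0).aestronglyMeasurable
  · refine Eventually.of_forall fun x t ht => hb t x ?_
    rw [Metric.mem_ball, Real.dist_eq] at ht
    have := abs_sub_abs_le_abs_sub t t0
    linarith
  · exact (integrable_inv_one_add_sq.const_mul C).integrableOn
  · exact Eventually.of_forall fun x t _ => hd t x
end

/-- a real conservation law `∂ₜ ρ + ∂ₓ j = 0` with decay -/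
structure Cons (ρ j ρt : ℝ → ℝ → ℝ) : Prop where
  r : Dec ρ
  fl : Dec j
  rt : Dec ρt
  dt : ∀ t x, HasDerivAt (fun s => ρ s x) (ρt t x) t
  dx : ∀ t x, HasDerivAt (j t) (-ρt t x) x

lemma Cons.mass {ρ j ρt : ℝ → ℝ → ℝ} (h : Cons ρ j ρt) (t : ℝ) : ∫ x, ρ t x = ∫ x, ρ 0 x := by
  have hd : ∀ t, HasDerivAt (fun t => ∫ x, ρ t x) 0 t := by
    intro t
    have := h.r.hasDerivAt_integral h.rt h.dt Set.univ t
    simp only [Measure.restrict_univ] at this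
    refine this.congr_deriv ?_
    have h0 := integral_eq_zero_of_hasDerivAt_of_integrable (h.dx t)
      (h.rt.neg.integrable t) (h.fl.integrable t)
    rw [integral_neg] at h0
    linarith
  exact is_const_of_deriv_eq_zero (fun t => (hd t).differentiableAt) (fun t => (hd t).deriv) t 0

/-- interaction functional -/
def Inta (ρ1 ρ2 : ℝ → ℝ → ℝ) (t : ℝ) : ℝ := ∫ y, ρ2 t y * ∫ x in Set.Iic y, ρ1 t x

lemma Cons.prim_x {ρ : ℝ → ℝ → ℝ} (h : Dec ρ) (t y : ℝ) :
    HasDerivAt (fun y => ∫ x in Set.Iic y, ρ t x) (ρ t y) y := by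
  have e : (fun y => ∫ x in Set.Iic y, ρ t x) =
      fun y => (∫ x in Set.Iic 0, ρ t x) + ∫ x in (0 : ℝ)..y, ρ t x := by
    ext z
    have := intervalIntegral.integral_Iic_sub_Iic (μ := volume) (f := ρ t) (a := 0) (b := z)
      (h.integrable t).integrableOn (h.integrable t).integrableOn
    linarith
  rw [e]
  exact (intervalIntegral.integral_hasDerivAt_right ((h.integrable t).intervalIntegrable)
    (h.cx t).stronglyMeasurable.stronglyMeasurableAtFilter (h.cx t).continuousAt).const_add _

lemma Cons.prim_bd {ρ : ℝ → ℝ → ℝ} (h : Dec ρ) (R : ℝ) :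
    ∃ C, 0 ≤ C ∧ ∀ t y, |t| ≤ R → |∫ x in Set.Iic y, ρ t x| ≤ C := by
  obtain ⟨C, hC, hb⟩ := h.2 R
  refine ⟨∫ x, C * (1 + x ^ 2)⁻¹, integral_nonneg fun x => by positivity, fun t y ht => ?_⟩
  calc |∫ x in Set.Iic y, ρ t x| ≤ ∫ x in Set.Iic y, |ρ t x| := abs_integral_le_integral_abs
    _ ≤ ∫ x, |ρ t x| := setIntegral_le_integral (h.integrable t).abs
        (Eventually.of_forall fun x => abs_nonneg _)
    _ ≤ _ := integral_mono (h.integrable t).abs (integrable_inv_one_add_sq.const_mul C)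
        (fun x => hb t x ht)

lemma Cons.inter_deriv {ρ1 j1 r1 ρ2 j2 r2 : ℝ → ℝ → ℝ} (h1 : Cons ρ1 j1 r1) (h2 : Cons ρ2 j2 r2)
    (t0 : ℝ) : HasDerivAt (Inta ρ1 ρ2) (∫ x, (ρ1 t0 x * j2 t0 x - j1 t0 x * ρ2 t0 x)) t0 := by
  set Q : ℝ → ℝ → ℝ := fun t y => ∫ x in Set.Iic y, ρ1 t x with hQ
  have Qx : ∀ t y, HasDerivAt (Q t) (ρ1 t y) y := fun t y => Cons.prim_x h1.r t y
  have Qc : ∀ t, Continuous (Q t) := fun t =>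
    continuous_iff_continuousAt.2 fun y => (Qx t y).continuousAt
  have Qt : ∀ t y, HasDerivAt (fun s => Q s y) (-j1 t y) t := by
    intro t y
    have := h1.r.hasDerivAt_integral h1.rt h1.dt (Set.Iic y) t
    refine this.congr_deriv ?_
    have := integral_Iic_of_hasDerivAt_of_tendsto' (a := y) (fun x _ => h1.dx t x)
      (h1.rt.neg.integrable t).integrableOn (h1.fl.tendsto_atBot t)
    rw [integral_neg] at this
    linarith
  obtain ⟨C, hC, hCb⟩ := Cons.prim_bd h1.r (|t0| + 1)
  obtain ⟨D, hD, hDb⟩ := h2.rt.2 (|t0| + 1)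
  obtain ⟨K, hK, hKb⟩ := h2.r.2 (|t0| + 1)
  obtain ⟨L, hL, hLb⟩ := h1.fl.bdc.2 (|t0| + 1)
  have main : HasDerivAt (Inta ρ1 ρ2) (∫ y, (r2 t0 y * Q t0 y + ρ2 t0 y * (-j1 t0 y))) t0 := by
    refine (hasDerivAt_integral_of_dominated_loc_of_deriv_le (μ := volume)
      (F := fun t y => ρ2 t y * Q t y) (F' := fun t y => r2 t y * Q t y + ρ2 t y * (-j1 t y))
      (x₀ := t0) (bound := fun x => (D * C + K * L) * (1 + x ^ 2)⁻¹) (s := Metric.ball t0 1)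
      (Metric.ball_mem_nhds t0 one_pos) ?_ ?_ ?_ ?_ ?_ ?_).2
    · exact Eventually.of_forall fun t => ((h2.r.cx t).mul (Qc t)).aestronglyMeasurable
    · refine (h2.r.integrable t0).mul_bdd (c := C) (Qc t0).aestronglyMeasurable
        (Eventually.of_forall fun y => hCb t0 y (by linarith))
    · exact (((h2.rt.cx t0).mul (Qc t0)).add ((h2.r.cx t0).mul (h1.fl.cx t0).neg)).aestronglyMeasurable
    · refine Eventually.of_forall fun x t ht => ?_
      rw [Metric.mem_ball, Real.dist_eq] at ht
      have ht' : |t| ≤ |t0| + 1 := by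
        have := abs_sub_abs_le_abs_sub t t0
        linarith
      have a1 := hCb t x ht'
      have a2 := hDb t x ht'
      have a3 := hKb t x ht'
      have a4 := hLb t x ht'
      have w := wt_nonneg x
      calc _ ≤ ‖r2 t x‖ * |Q t x| + ‖ρ2 t x‖ * ‖j1 t x‖ := by
            refine (norm_add_le _ _).trans ?_
            simp [norm_mul]
        _ ≤ (D * (1 + x ^ 2)⁻¹) * C + (K * (1 + x ^ 2)⁻¹) * L := by gcongr
        _ = _ := by ring
    · exact (integrable_inv_one_add_sq.const_mul _)
    · exact Eventually.of_forall fun x t _ => (h2.dt t x).mul (Qt t x)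
  refine main.congr_deriv ?_
  have ib : ∀ y, HasDerivAt (fun y => j2 t0 y * Q t0 y) (-r2 t0 y * Q t0 y + j2 t0 y * ρ1 t0 y) y :=
    fun y => (h2.dx t0 y).mul (Qx t0 y)
  have i1 : Integrable (fun y => j2 t0 y * Q t0 y) :=
    (h2.fl.integrable t0).mul_bdd (c := C) (Qc t0).aestronglyMeasurable
        (Eventually.of_forall fun y => hCb t0 y (by linarith))
  have i2 : Integrable (fun y => r2 t0 y * Q t0 y) :=
    (h2.rt.integrable t0).mul_bdd (c := C) (Qc t0).aestronglyMeasurable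
        (Eventually.of_forall fun y => hCb t0 y (by linarith))
  have i3 : Integrable (fun y => j2 t0 y * ρ1 t0 y) := (h2.fl.mul h1.r).integrable t0
  have i4 : Integrable (fun y => ρ2 t0 y * -j1 t0 y) := (h2.r.mul h1.fl.neg).integrable t0
  have z := integral_eq_zero_of_hasDerivAt_of_integrable ib
    ((i2.neg.add i3).congr (Eventually.of_forall fun y => by simp)) i1
  have z1 : ∫ y, (-r2 t0 y * Q t0 y + j2 t0 y * ρ1 t0 y) =
      -(∫ y, r2 t0 y * Q t0 y) + ∫ y, j2 t0 y * ρ1 t0 y := by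
    have := integral_add i2.neg i3
    simp only [Pi.neg_apply, integral_neg] at this
    rw [← this]; congr 1; ext y; ring
  have z2 := integral_add i2 i4
  rw [z2]
  have z3 : ∫ x, (ρ1 t0 x * j2 t0 x - j1 t0 x * ρ2 t0 x) =
      (∫ y, j2 t0 y * ρ1 t0 y) + ∫ y, ρ2 t0 y * -j1 t0 y := by
    rw [← integral_add i3 i4]; congr 1; ext x; ring
  rw [z3]; linarith

lemma Cons.inter_ftc {ρ1 j1 r1 ρ2 j2 r2 : ℝ → ℝ → ℝ} (h1 : Cons ρ1 j1 r1) (h2 : Cons ρ2 j2 r2)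
    (a b : ℝ) : Inta ρ1 ρ2 b - Inta ρ1 ρ2 a =
      ∫ t in a..b, ∫ x, (ρ1 t x * j2 t x - j1 t x * ρ2 t x) := by
  rw [intervalIntegral.integral_eq_sub_of_hasDerivAt (fun t _ => Cons.inter_deriv h1 h2 t)]
  exact (Dec.continuous_integral ((h1.r.mul h2.fl).sub (h1.fl.mul h2.r))).intervalIntegrable _ _

end PartCo

noncomputable section PartKe
open scoped ComplexConjugate
open Filter Topology Set

/-- one-sided exponential average -/
def EE (l : ℝ) (g : ℝ → ℝ) (x : ℝ) : ℝ := ∫ r in Ioi (0 : ℝ), Real.exp (-l * r) * g (x - r)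

/-- complex one-sided exponential average -/
def CE (l : ℂ) (g : ℝ → ℂ) (x : ℝ) : ℂ := ∫ r in Ioi (0 : ℝ), cexp (l * r) * g (x - r)

lemma exp_int {l : ℝ} (hl : 0 < l) : IntegrableOn (fun r => Real.exp (-l * r)) (Ioi 0) := by
  simpa using integrableOn_exp_mul_Ioi (a := -l) (by linarith) 0

lemma exp_int_val {l : ℝ} (hl : 0 < l) : ∫ r in Ioi (0 : ℝ), Real.exp (-l * r) = 1 / l := by
  have := integral_exp_mul_Ioi (a := -l) (by linarith) 0
  rw [this]; simp

lemma EE_int {l : ℝ} (hl : 0 < l) {g : ℝ → ℝ} (hc : Continuous g) {K : ℝ} (hb : ∀ x, |g x| ≤ K) (x : ℝ) :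
    IntegrableOn (fun r => Real.exp (-l * r) * g (x - r)) (Ioi 0) := by
  refine (exp_int hl).mul_bdd (c := K) ?_ ?_
  · exact (hc.comp (by fun_prop)).aestronglyMeasurable
  · exact Eventually.of_forall fun r => hb _

lemma norm_cexp_mul (l : ℂ) (r : ℝ) : ‖cexp (l * r)‖ = Real.exp (l.re * r) := by
  rw [Complex.norm_exp]; simp

lemma CE_int {l : ℂ} (hl : l.re < 0) {g : ℝ → ℂ} (hc : Continuous g) {K : ℝ} (hb : ∀ x, ‖g x‖ ≤ K) (x : ℝ) :
    IntegrableOn (fun r : ℝ => cexp (l * r) * g (x - r)) (Ioi 0) := by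
  have h := exp_int (l := -l.re) (by linarith)
  refine (h.mul_const K).mono' ?_ ?_
  · exact Continuous.aestronglyMeasurable (by fun_prop)
  · refine Eventually.of_forall fun r => ?_
    rw [norm_mul, norm_cexp_mul, neg_neg]
    have := hb (x - r)
    gcongr

lemma CE_norm_le {l : ℂ} {g : ℝ → ℂ} (x : ℝ) :
    ‖CE l g x‖ ≤ EE (-l.re) (fun y => ‖g y‖) x := by
  refine (norm_integral_le_integral_norm _).trans (le_of_eq ?_)
  unfold EE
  congr 1; ext r
  rw [norm_mul, norm_cexp_mul, neg_neg]

lemma EE_mono {l : ℝ} (hl : 0 < l) {g h : ℝ → ℝ} (hc : Continuous g) {K : ℝ} (hb : ∀ x, |g x| ≤ K)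
    (kc : Continuous h) {L : ℝ} (kb : ∀ x, |h x| ≤ L) (x : ℝ) (hle : ∀ r, 0 < r → g (x - r) ≤ h (x - r)) :
    EE l g x ≤ EE l h x := by
  refine setIntegral_mono_on (EE_int hl hc hb x) (EE_int hl kc kb x) measurableSet_Ioi fun r hr => ?_
  have := hle r hr
  gcongr

lemma EE_nonneg {l : ℝ} {g : ℝ → ℝ} (hg : ∀ x, 0 ≤ g x) (x : ℝ) : 0 ≤ EE l g x :=
  setIntegral_nonneg measurableSet_Ioi fun r _ => mul_nonneg (Real.exp_pos _).le (hg _)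

lemma EE_const_mul (l c : ℝ) (g : ℝ → ℝ) (x : ℝ) : EE l (fun y => c * g y) x = c * EE l g x := by
  unfold EE
  rw [← integral_const_mul]; congr 1; ext r; ring

lemma EE_const {l : ℝ} (hl : 0 < l) (c x : ℝ) : EE l (fun _ => c) x = c / l := by
  unfold EE
  rw [integral_mul_const, exp_int_val hl]; ring

lemma EE_le_const {l : ℝ} (hl : 0 < l) {g : ℝ → ℝ} (hc : Continuous g) {K : ℝ} (hb : ∀ x, |g x| ≤ K) (x : ℝ) :
    EE l g x ≤ K / l := by
  rw [← EE_const hl K x]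
  exact EE_mono hl hc hb continuous_const (fun _ => le_refl |K|) x
    fun r _ => (le_abs_self _).trans (hb _)

lemma EE_le_int {l : ℝ} (hl : 0 < l) {g : ℝ → ℝ} (hg : ∀ x, 0 ≤ g x) (hi : Integrable g) (x : ℝ) :
    EE l g x ≤ ∫ y, g y := by
  have h1 : Integrable (fun r => g (x - r)) := hi.comp_sub_left x
  have h2 : ∫ r, g (x - r) = ∫ y, g y := integral_sub_left_eq_self g volume x
  rw [← h2]
  calc EE l g x ≤ ∫ r in Ioi (0 : ℝ), g (x - r) := by
        refine integral_mono_of_nonneg (Eventually.of_forall fun r => mul_nonneg (Real.exp_pos _).le (hg _))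
          h1.integrableOn ?_
        refine (ae_restrict_mem measurableSet_Ioi).mono fun r (hr : 0 < r) => ?_
        have : Real.exp (-l * r) ≤ 1 := Real.exp_le_one_iff.2 (by nlinarith)
        nlinarith [hg (x - r)]
    _ ≤ _ := setIntegral_le_integral h1 (Eventually.of_forall fun r => hg _)

lemma EE_anti {l m : ℝ} (hm : 0 < m) (hml : m ≤ l) {g : ℝ → ℝ} (hg : ∀ x, 0 ≤ g x) (hc : Continuous g)
    {K : ℝ} (hb : ∀ x, |g x| ≤ K) (x : ℝ) : EE l g x ≤ EE m g x := by
  refine setIntegral_mono_on (EE_int (hm.trans_le hml) hc hb x) (EE_int hm hc hb x) measurableSet_Ioi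
    fun r (hr : 0 < r) => ?_
  have := hg (x - r)
  gcongr

/-- if `g (x-r) ≤ exp (m r) c` then the average is at most `c/(l-m)` -/
lemma EE_le_exp {l m c : ℝ} (hml : m < l) (hl : 0 < l) {g : ℝ → ℝ} (hg : ∀ x, 0 ≤ g x) (hc : Continuous g)
    {K : ℝ} (hb : ∀ x, |g x| ≤ K) (x : ℝ) (h : ∀ r, 0 < r → g (x - r) ≤ Real.exp (m * r) * c) :
    EE l g x ≤ c / (l - m) := by
  have h1 : 0 < l - m := by linarith
  rw [← EE_const h1 c x]
  refine setIntegral_mono_on (EE_int hl hc hb x) ((exp_int h1).mul_const c) measurableSet_Ioi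
    fun r (hr : 0 < r) => ?_
  calc _ ≤ Real.exp (-l * r) * (Real.exp (m * r) * c) := by gcongr; exact h r hr
    _ = _ := by rw [← mul_assoc, ← Real.exp_add]; ring_nf

lemma EE_eq_Iic (l : ℝ) (g : ℝ → ℝ) (x : ℝ) :
    EE l g x = Real.exp (-l * x) * ∫ y in Iic x, Real.exp (l * y) * g y := by
  unfold EE
  rw [← integral_const_mul, integral_Iic_eq_integral_Iio]
  have h := integral_sub_left_eq_self (fun y => (Iio x).indicator (fun y =>
    Real.exp (-l * x) * (Real.exp (l * y) * g y)) y) volume x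
  rw [integral_indicator measurableSet_Iio] at h
  rw [← h, ← integral_indicator measurableSet_Ioi]
  congr 1; ext r
  by_cases hr : 0 < r
  · rw [indicator_of_mem (by exact hr), indicator_of_mem (by simpa using hr), ← mul_assoc, ← Real.exp_add]
    ring_nf
  · rw [indicator_of_notMem (by exact hr), indicator_of_notMem (by simpa using hr)]

lemma CE_eq_Iic (l : ℂ) (g : ℝ → ℂ) (x : ℝ) :
    CE l g x = cexp (l * x) * ∫ y in Iic x, cexp (-l * y) * g y := by
  unfold CE
  rw [← integral_const_mul, integral_Iic_eq_integral_Iio]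
  have h := integral_sub_left_eq_self (fun y => (Iio x).indicator (fun y : ℝ =>
    cexp (l * x) * (cexp (-l * y) * g y)) y) volume x
  rw [integral_indicator measurableSet_Iio] at h
  rw [← h, ← integral_indicator measurableSet_Ioi]
  congr 1; ext r
  by_cases hr : 0 < r
  · rw [indicator_of_mem (by exact hr), indicator_of_mem (by simpa using hr), ← mul_assoc, ← Complex.exp_add]
    congr 2
    · push_cast; ring
  · rw [indicator_of_notMem (by exact hr), indicator_of_notMem (by simpa using hr)]

lemma EE_shift {l : ℝ} (hl : 0 < l) {g : ℝ → ℝ} (hg : ∀ x, 0 ≤ g x) (hc : Continuous g)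
    {K : ℝ} (hb : ∀ x, |g x| ≤ K) (x r : ℝ) (hr : 0 ≤ r) : EE l g (x - r) ≤ Real.exp (l * r) * EE l g x := by
  rw [EE_eq_Iic, EE_eq_Iic, ← mul_assoc, ← Real.exp_add]
  have e : l * r + -l * x = -l * (x - r) := by ring
  rw [e]
  refine mul_le_mul_of_nonneg_left ?_ (Real.exp_pos _).le
  refine setIntegral_mono_set ?_ (Eventually.of_forall fun y => mul_nonneg (Real.exp_pos _).le (hg _)) ?_
  · have h1 : IntegrableOn (fun y => Real.exp (l * y)) (Iic x) := integrableOn_exp_mul_Iic hl x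
    exact h1.mul_bdd (c := K) hc.aestronglyMeasurable (Eventually.of_forall fun y => hb y)
  · exact (Iic_subset_Iic.2 (by linarith)).eventuallyLE

lemma cIic_int {l : ℂ} (hl : l.re < 0) {g : ℝ → ℂ} (hc : Continuous g) {K : ℝ} (hb : ∀ x, ‖g x‖ ≤ K) (x : ℝ) :
    IntegrableOn (fun y : ℝ => cexp (-l * y) * g y) (Iic x) := by
  have h := integrableOn_exp_mul_Iic (a := -l.re) (by linarith) x
  refine (h.mul_const K).mono' ?_ ?_
  · exact Continuous.aestronglyMeasurable (by fun_prop)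
  · refine Eventually.of_forall fun r => ?_
    rw [norm_mul, norm_cexp_mul, neg_re]
    have := hb r
    gcongr

lemma hasDerivAt_Iic {E : Type*} [NormedAddCommGroup E] [NormedSpace ℝ E] [CompleteSpace E] {h : ℝ → E}
    (hc : Continuous h) (hi : ∀ x, IntegrableOn h (Iic x)) (x : ℝ) :
    HasDerivAt (fun x => ∫ y in Iic x, h y) (h x) x := by
  have e : (fun x => ∫ y in Iic x, h y) = fun x => (∫ y in Iic 0, h y) + ∫ y in (0 : ℝ)..x, h y := by
    ext z
    have := intervalIntegral.integral_Iic_sub_Iic (μ := volume) (f := h) (a := 0) (b := z)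
      (hi _) (hi _)
    rw [← this]; abel
  rw [e]
  exact (intervalIntegral.integral_hasDerivAt_right (hc.intervalIntegrable _ _)
    hc.stronglyMeasurable.stronglyMeasurableAtFilter hc.continuousAt).const_add _

lemma CE_hasDerivAt {l : ℂ} (hl : l.re < 0) {g : ℝ → ℂ} (hc : Continuous g) {K : ℝ} (hb : ∀ x, ‖g x‖ ≤ K)
    (x : ℝ) : HasDerivAt (CE l g) (l * CE l g x + g x) x := by
  have e : CE l g = fun x : ℝ => cexp (l * x) * ∫ y in Iic x, cexp (-l * y) * g y := by
    ext x; exact CE_eq_Iic l g x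
  have h1 := hasDerivAt_Iic (h := fun y : ℝ => cexp (-l * y) * g y) (by fun_prop) (cIic_int hl hc hb) x
  have h2 : HasDerivAt (fun x : ℝ => cexp (l * x)) (cexp (l * x) * (l * 1)) x :=
    ((HasDerivAt.ofReal_comp (hasDerivAt_id x)).const_mul l).cexp
  have h3 := h2.mul h1
  rw [e]
  refine h3.congr_deriv ?_
  have : cexp (l * x) * cexp (-l * x) = 1 := by rw [← Complex.exp_add]; simp
  linear_combination (g x) * this

/-- Duhamel representation of bounded solutions -/
lemma CE_duhamel {l : ℂ} (hl : l.re < 0) {d F : ℝ → ℂ} (hc : Continuous F) {K : ℝ} (hb : ∀ x, ‖F x‖ ≤ K)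
    {D : ℝ} (hD : ∀ x, ‖d x‖ ≤ D) (hd : ∀ x, HasDerivAt d (l * d x + F x) x) (x : ℝ) : d x = CE l F x := by
  set G : ℝ → ℂ := fun x => d x - CE l F x with hG
  have hG' : ∀ x, HasDerivAt G (l * G x) x := by
    intro x
    refine ((hd x).sub (CE_hasDerivAt hl hc hb x)).congr_deriv ?_
    simp only [hG]; ring
  -- G bounded
  have hGb : ∀ x, ‖G x‖ ≤ D + K / (-l.re) := by
    intro x
    refine (norm_sub_le _ _).trans (add_le_add (hD x) ((CE_norm_le x).trans ?_))
    refine EE_le_const (by linarith) hc.norm (fun x => ?_) x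
    rw [abs_of_nonneg (norm_nonneg _)]; exact hb x
  have hconst : ∀ x y : ℝ, cexp (-l * x) * G x = cexp (-l * y) * G y := by
    have hd : ∀ x : ℝ, HasDerivAt (fun x : ℝ => cexp (-l * x) * G x) 0 x := by
      intro x
      have h2 : HasDerivAt (fun x : ℝ => cexp (-l * x)) (cexp (-l * x) * (-l * 1)) x :=
        ((HasDerivAt.ofReal_comp (hasDerivAt_id x)).const_mul (-l)).cexp
      refine (h2.mul (hG' x)).congr_deriv ?_
      ring
    exact is_const_of_deriv_eq_zero (fun x => (hd x).differentiableAt) (fun x => (hd x).deriv)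
  have hz : G x = 0 := by
    have hle : ∀ y : ℝ, ‖cexp (-l * x) * G x‖ ≤ Real.exp ((-l).re * y) * (D + K / (-l.re)) := by
      intro y
      rw [hconst x y, norm_mul, norm_cexp_mul]
      have := hGb y
      gcongr
    have hlim : Tendsto (fun y : ℝ => Real.exp ((-l).re * y) * (D + K / (-l.re))) atBot (𝓝 0) := by
      have : Tendsto (fun y : ℝ => (-l).re * y) atBot atBot := by
        apply Tendsto.const_mul_atBot _ tendsto_id
        rw [neg_re]; linarith
      simpa using (Real.tendsto_exp_atBot.comp this).mul_const (D + K / (-l.re))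
    have h0 : ‖cexp (-l * x) * G x‖ ≤ 0 := ge_of_tendsto' hlim hle
    have h1 := norm_le_zero_iff.1 h0
    exact (mul_eq_zero.1 h1).resolve_left (Complex.exp_ne_zero _)
  exact sub_eq_zero.1 hz

/-- Stability -/
lemma CE_stab {k : ℝ} (hk : 0 < k) {l : ℂ} (hl : l.re = -(2 * k)) {d F c : ℝ → ℂ} (hF : Continuous F) {K : ℝ}
    (hb : ∀ x, ‖F x‖ ≤ K) {D : ℝ} (hD : ∀ x, ‖d x‖ ≤ D) (hc : Continuous c) {L : ℝ} (hL : ∀ x, ‖c x‖ ≤ L)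
    (hsm : ∀ x, EE (2 * k) (fun y => ‖c y‖) x ≤ 1 / 2)
    (hd : ∀ x, HasDerivAt d (l * d x + (F x - c x * d x)) x) (x : ℝ) : ‖d x‖ ≤ K / k := by
  have dc : Continuous d := continuous_iff_continuousAt.2 fun x => (hd x).continuousAt
  have hL0 : 0 ≤ L := (norm_nonneg _).trans (hL 0)
  have hD0 : 0 ≤ D := (norm_nonneg _).trans (hD 0)
  have hGb : ∀ x, ‖F x - c x * d x‖ ≤ K + L * D := fun x => by
    refine (norm_sub_le _ _).trans (add_le_add (hb x) ?_)
    rw [norm_mul]; exact mul_le_mul (hL x) (hD x) (norm_nonneg _) hL0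
  have rep := CE_duhamel (by rw [hl]; linarith) (hF.sub (hc.mul dc)) hGb hD hd
  have bdd : BddAbove (range fun x => ‖d x‖) := ⟨D, by rintro _ ⟨x, rfl⟩; exact hD x⟩
  set S := ⨆ x, ‖d x‖ with hS
  have hle : ∀ x, ‖d x‖ ≤ S := fun x => le_ciSup bdd x
  have hS0 : 0 ≤ S := (norm_nonneg _).trans (hle 0)
  have h2k : 0 < 2 * k := by linarith
  have step : ∀ x, ‖d x‖ ≤ K / (2 * k) + S * (1 / 2) := by
    intro x
    rw [rep x]
    refine (CE_norm_le x).trans ?_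
    rw [hl, neg_neg]
    have hm : EE (2 * k) (fun y => ‖F y - c y * d y‖) x ≤ EE (2 * k) (fun y => K + S * ‖c y‖) x := by
      refine EE_mono h2k (by fun_prop) (K := K + L * D) (fun y => by rw [abs_of_nonneg (norm_nonneg _)]; exact hGb y)
        (by fun_prop) (L := |K| + S * L) (fun y => ?_) x (fun r _ => ?_)
      · refine (abs_add_le _ _).trans (add_le_add le_rfl ?_)
        rw [abs_of_nonneg (by positivity)]
        exact mul_le_mul_of_nonneg_left (hL y) hS0
      · refine (norm_sub_le _ _).trans (add_le_add (hb _) ?_)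
        rw [norm_mul, mul_comm]
        exact mul_le_mul_of_nonneg_right (hle _) (norm_nonneg _)
    refine hm.trans (le_of_eq_of_le ?_ (add_le_add le_rfl (mul_le_mul_of_nonneg_left (hsm x) hS0)))
    rw [← EE_const_mul, ← EE_const h2k K x]
    unfold EE
    rw [← integral_add]
    · congr 1; ext r; ring
    · exact (exp_int h2k).mul_const K
    · refine EE_int h2k (g := fun y => S * ‖c y‖) (by fun_prop) (K := S * L) (fun y => ?_) x
      rw [abs_of_nonneg (by positivity)]
      exact mul_le_mul_of_nonneg_left (hL y) hS0
  have : S ≤ K / (2 * k) + S * (1 / 2) := ciSup_le step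
  have h3 : S ≤ K / k := by
    have : K / k = 2 * (K / (2 * k)) := by field_simp
    linarith
  exact (hle x).trans h3

/-- Cauchy-Schwarz -/
lemma EE_cs {l a b : ℝ} (ha : 0 < a) (hb : 0 < b) (hab : a + b = 2 * l) {g h : ℝ → ℝ}
    (hg : Continuous g) (hh : Continuous h) {K L : ℝ} (gK : ∀ x, |g x| ≤ K) (hL : ∀ x, |h x| ≤ L) (x : ℝ) :
    (EE l (fun y => g y * h y) x) ^ 2 ≤ EE a (fun y => g y ^ 2) x * EE b (fun y => h y ^ 2) x := by
  have bs : ∀ {a : ℝ} {g : ℝ → ℝ} {K : ℝ}, 0 < a → Continuous g → (∀ x, |g x| ≤ K) →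
      IntegrableOn (fun r => Real.exp (-a * r) * g (x - r) ^ 2) (Ioi 0) := by
    intro a g K ha hg gK
    refine EE_int ha (g := fun y => g y ^ 2) (by fun_prop) (K := K ^ 2) (fun y => ?_) x
    rw [abs_pow]; exact pow_le_pow_left₀ (abs_nonneg _) (gK y) 2
  have i1 := bs ha hg gK
  have i2 := bs hb hh hL
  have hl : 0 < l := by linarith
  have K0 : 0 ≤ K := (abs_nonneg _).trans (gK 0)
  have i3 : IntegrableOn (fun r => Real.exp (-l * r) * (g (x - r) * h (x - r))) (Ioi 0) :=
    EE_int hl (g := fun y => g y * h y) (by fun_prop) (K := K * L) (fun y => by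
      rw [abs_mul]; exact mul_le_mul (gK y) (hL y) (abs_nonneg _) K0) x
  have quad : ∀ q : ℝ, 0 ≤ EE b (fun y => h y ^ 2) x * (q * q) +
      (2 * EE l (fun y => g y * h y) x) * q + EE a (fun y => g y ^ 2) x := by
    intro q
    have h0 : 0 ≤ ∫ r in Ioi (0 : ℝ), (Real.exp (-a / 2 * r) * g (x - r) + q * (Real.exp (-b / 2 * r) * h (x - r))) ^ 2 :=
      integral_nonneg fun r => sq_nonneg _
    have e : ∫ r in Ioi (0 : ℝ), (Real.exp (-a / 2 * r) * g (x - r) + q * (Real.exp (-b / 2 * r) * h (x - r))) ^ 2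
        = ∫ r in Ioi (0 : ℝ), (((q * q) * (Real.exp (-b * r) * h (x - r) ^ 2) +
          (2 * q) * (Real.exp (-l * r) * (g (x - r) * h (x - r)))) + Real.exp (-a * r) * g (x - r) ^ 2) := by
      congr 1; ext r
      have e1 : Real.exp (-a * r) = Real.exp (-a / 2 * r) * Real.exp (-a / 2 * r) := by
        rw [← Real.exp_add]; ring_nf
      have e2 : Real.exp (-b * r) = Real.exp (-b / 2 * r) * Real.exp (-b / 2 * r) := by
        rw [← Real.exp_add]; ring_nf
      have e3 : Real.exp (-l * r) = Real.exp (-a / 2 * r) * Real.exp (-b / 2 * r) := by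
        rw [← Real.exp_add]; congr 1
        have : l = (a + b) / 2 := by linarith
        rw [this]; ring
      rw [e1, e2, e3]; ring
    have i23 : IntegrableOn (fun r => (q * q) * (Real.exp (-b * r) * h (x - r) ^ 2) +
          (2 * q) * (Real.exp (-l * r) * (g (x - r) * h (x - r)))) (Ioi 0) :=
      (i2.const_mul _).add (i3.const_mul _)
    rw [e, integral_add i23 i1,
      integral_add (i2.const_mul _) (i3.const_mul _), integral_const_mul, integral_const_mul] at h0
    unfold EE
    linarith
  have := discrim_le_zero quad
  unfold discrim at this
  nlinarith

end PartKe

noncomputable section PartW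
open scoped ComplexConjugate
open Filter Topology Set

def lam (κ s : ℝ) : ℂ := 2 * I * s - 2 * κ

lemma lam_re (κ s : ℝ) : (lam κ s).re = -(2 * κ) := by simp [lam]

/-- Picard iterates of the Riccati equation -/
def wn (u : ℝ → ℝ → ℂ) (κ : ℝ) : ℕ → ℝ → ℝ → ℝ → ℂ
  | 0 => fun _ _ _ => 0
  | n + 1 => fun s t x => CE (lam κ s) (fun y => u t y - conj (u t y) * (wn u κ n s t y) ^ 2) x

/-- continuity in `(s,t,x)` -/
def C3 (G : ℝ → ℝ → ℝ → ℂ) : Prop := Continuous (fun z : ℝ × ℝ × ℝ => G z.1 z.2.1 z.2.2)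

lemma CE_cont3 {κ : ℝ} (hκ : 0 < κ) {G : ℝ → ℝ → ℝ → ℂ} (hG : C3 G)
    (hb : ∀ R : ℝ, ∃ C : ℝ, ∀ s t x, |t| ≤ R → ‖G s t x‖ ≤ C) :
    C3 (fun s t x => CE (lam κ s) (G s t) x) := by
  unfold C3 CE
  rw [continuous_iff_continuousAt]
  intro z0
  obtain ⟨C, hC⟩ := hb (|z0.2.1| + 1)
  have key : ∀ z : ℝ × ℝ × ℝ, Continuous (fun r : ℝ => cexp (lam κ z.1 * r) * G z.1 z.2.1 (z.2.2 - r)) := by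
    intro z
    have : Continuous (fun r : ℝ => G z.1 z.2.1 (z.2.2 - r)) :=
      hG.comp (by fun_prop : Continuous fun r : ℝ => (z.1, z.2.1, z.2.2 - r))
    exact (by fun_prop : Continuous fun r : ℝ => cexp (lam κ z.1 * r)).mul this
  apply continuousAt_of_dominated (bound := fun r => Real.exp (-(2 * κ) * r) * C)
  · exact Eventually.of_forall fun z => (key z).aestronglyMeasurable
  · have : ∀ᶠ z : ℝ × ℝ × ℝ in 𝓝 z0, |z.2.1| < |z0.2.1| + 1 :=
      ((by fun_prop : Continuous fun z : ℝ × ℝ × ℝ => |z.2.1|).tendsto z0).eventually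
        (gt_mem_nhds (by linarith))
    filter_upwards [this] with z hz
    refine Eventually.of_forall fun r => ?_
    rw [norm_mul, norm_cexp_mul, lam_re]
    have := hC z.1 z.2.1 (z.2.2 - r) hz.le
    gcongr
  · exact (exp_int (l := 2 * κ) (by linarith)).mul_const C
  · refine Eventually.of_forall fun r => ?_
    have h1 : Continuous (fun z : ℝ × ℝ × ℝ => G z.1 z.2.1 (z.2.2 - r)) :=
      hG.comp (by fun_prop : Continuous fun z : ℝ × ℝ × ℝ => (z.1, z.2.1, z.2.2 - r))
    have h2 : Continuous (fun z : ℝ × ℝ × ℝ => lam κ z.1) := by unfold lam; fun_prop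
    exact (((h2.mul continuous_const).cexp).mul h1).continuousAt

/-- standing smallness hypothesis -/
structure Smal (u : ℝ → ℝ → ℂ) (κ : ℝ) : Prop where
  pos : 0 < κ
  cu : Continuous (fun z : ℝ × ℝ => u z.1 z.2)
  bd : ∀ R : ℝ, ∃ C : ℝ, ∀ t x, |t| ≤ R → ‖u t x‖ ≤ C
  sm : ∀ t x, EE (2 * κ) (fun y => ‖u t y‖) x ≤ 1 / 4

lemma Smal.bd1 {u : ℝ → ℝ → ℂ} {κ : ℝ} (h : Smal u κ) (t : ℝ) : ∃ C : ℝ, 0 ≤ C ∧ ∀ x, ‖u t x‖ ≤ C := by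
  obtain ⟨C, hC⟩ := h.bd |t|
  exact ⟨C, (norm_nonneg _).trans (hC t 0 le_rfl), fun x => hC t x le_rfl⟩

lemma Smal.cx {u : ℝ → ℝ → ℂ} {κ : ℝ} (h : Smal u κ) (t : ℝ) : Continuous (u t) :=
  h.cu.comp (by fun_prop : Continuous fun x : ℝ => (t, x))

/-- If `‖v y‖ ≤ B ‖u y‖` then the average is at most `B/4` -/
lemma Smal.CE_le {u : ℝ → ℝ → ℂ} {κ : ℝ} (h : Smal u κ) (s t : ℝ) {v : ℝ → ℂ} (hv : Continuous v)
    {B : ℝ} (hB : 0 ≤ B) (hle : ∀ y, ‖v y‖ ≤ B * ‖u t y‖) (x : ℝ) : ‖CE (lam κ s) v x‖ ≤ B / 4 := by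
  obtain ⟨C, hC0, hC⟩ := h.bd1 t
  refine (CE_norm_le x).trans ?_
  rw [lam_re, neg_neg]
  have h2 : 0 < 2 * κ := by linarith [h.pos]
  calc EE (2 * κ) (fun y => ‖v y‖) x ≤ EE (2 * κ) (fun y => B * ‖u t y‖) x := by
        refine EE_mono h2 hv.norm (K := B * C) (fun y => ?_) ((h.cx t).norm.const_mul B |>.congr fun _ => rfl) (L := B * C)
          (fun y => ?_) x (fun r _ => hle _)
        · rw [abs_of_nonneg (norm_nonneg _)]
          exact (hle y).trans (mul_le_mul_of_nonneg_left (hC y) hB)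
        · rw [abs_of_nonneg (by positivity)]
          exact mul_le_mul_of_nonneg_left (hC y) hB
    _ = B * EE (2 * κ) (fun y => ‖u t y‖) x := EE_const_mul _ _ _ _
    _ ≤ B * (1 / 4) := mul_le_mul_of_nonneg_left (h.sm t x) hB
    _ = B / 4 := by ring

lemma C3.cx {G : ℝ → ℝ → ℝ → ℂ} (h : C3 G) (s t : ℝ) : Continuous (G s t) :=
  h.comp (by fun_prop : Continuous fun x : ℝ => (s, t, x))

lemma Smal.c3u {u : ℝ → ℝ → ℂ} {κ : ℝ} (h : Smal u κ) : C3 (fun _ t x => u t x) :=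
  h.cu.comp (by fun_prop : Continuous fun z : ℝ × ℝ × ℝ => (z.2.1, z.2.2))

lemma nl_bd {a w : ℂ} (hw : ‖w‖ ≤ 1 / 2) : ‖a - conj a * w ^ 2‖ ≤ 5 / 4 * ‖a‖ := by
  refine (norm_sub_le _ _).trans ?_
  rw [norm_mul, norm_pow, RCLike.norm_conj]
  have : ‖w‖ ^ 2 ≤ 1 / 4 := by nlinarith [norm_nonneg w]
  nlinarith [norm_nonneg a]

lemma Smal.wn_prop {u : ℝ → ℝ → ℂ} {κ : ℝ} (h : Smal u κ) (n : ℕ) :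
    C3 (wn u κ n) ∧ ∀ s t x, ‖wn u κ n s t x‖ ≤ 1 / 2 := by
  induction n with
  | zero => exact ⟨continuous_const, fun s t x => by simp [wn]⟩
  | succ n ih =>
    obtain ⟨hc, hb⟩ := ih
    have hc' : C3 (fun s t y => u t y - conj (u t y) * (wn u κ n s t y) ^ 2) :=
      h.c3u.sub ((continuous_conj.comp h.c3u).mul (hc.pow 2))
    refine ⟨?_, fun s t x => ?_⟩
    · refine CE_cont3 h.pos hc' fun R => ?_
      obtain ⟨C, hC⟩ := h.bd R
      exact ⟨5 / 4 * C, fun s t x ht => (nl_bd (hb s t x)).trans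
        (mul_le_mul_of_nonneg_left (hC t x ht) (by norm_num))⟩
    · refine (h.CE_le s t (hc'.cx s t) (B := 5 / 4) (by norm_num) (fun y => nl_bd (hb s t y)) x).trans (by norm_num)

lemma CE_sub {l : ℂ} (hl : l.re < 0) {g k : ℝ → ℂ} (hc : Continuous g) {K : ℝ} (hb : ∀ x, ‖g x‖ ≤ K)
    (kc : Continuous k) {L : ℝ} (kb : ∀ x, ‖k x‖ ≤ L) (x : ℝ) :
    CE l (fun y => g y - k y) x = CE l g x - CE l k x := by
  unfold CE
  rw [← integral_sub (CE_int hl hc hb x) (CE_int hl kc kb x)]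
  congr 1; ext r; ring

/-- one contraction step -/
lemma Smal.contr {u : ℝ → ℝ → ℂ} {κ : ℝ} (h : Smal u κ) (s t : ℝ) {v w : ℝ → ℂ} (hv : Continuous v)
    (hw : Continuous w) (bv : ∀ x, ‖v x‖ ≤ 1 / 2) (bw : ∀ x, ‖w x‖ ≤ 1 / 2) {δ : ℝ} (hδ : 0 ≤ δ)
    (hle : ∀ x, ‖v x - w x‖ ≤ δ) (x : ℝ) :
    ‖CE (lam κ s) (fun y => u t y - conj (u t y) * v y ^ 2) x -
      CE (lam κ s) (fun y => u t y - conj (u t y) * w y ^ 2) x‖ ≤ δ / 4 := by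
  obtain ⟨C, hC0, hC⟩ := h.bd1 t
  have cu := h.cx t
  have hl : (lam κ s).re < 0 := by rw [lam_re]; linarith [h.pos]
  have cc : Continuous fun y => conj (u t y) := continuous_conj.comp cu
  rw [← CE_sub hl (K := 5 / 4 * C) (by fun_prop) (fun y => (nl_bd (bv y)).trans
        (mul_le_mul_of_nonneg_left (hC y) (by norm_num))) (L := 5 / 4 * C) (by fun_prop)
        (fun y => (nl_bd (bw y)).trans (mul_le_mul_of_nonneg_left (hC y) (by norm_num)))]
  refine h.CE_le s t (by fun_prop) hδ (fun y => ?_) x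
  have : u t y - conj (u t y) * v y ^ 2 - (u t y - conj (u t y) * w y ^ 2)
      = conj (u t y) * ((v y + w y) * (w y - v y)) := by ring
  rw [this, norm_mul, norm_mul, RCLike.norm_conj, norm_sub_rev]
  have h1 : ‖v y + w y‖ ≤ 1 := (norm_add_le _ _).trans (by linarith [bv y, bw y])
  have h2 := hle y
  calc ‖u t y‖ * (‖v y + w y‖ * ‖v y - w y‖) ≤ ‖u t y‖ * (1 * δ) := by gcongr
    _ = _ := by ring

/-- the Riccati function -/
def ww (u : ℝ → ℝ → ℂ) (κ s t x : ℝ) : ℂ := limUnder atTop (fun n => wn u κ n s t x)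

lemma Smal.wn_step {u : ℝ → ℝ → ℂ} {κ : ℝ} (h : Smal u κ) (n : ℕ) (s t x : ℝ) :
    ‖wn u κ n s t x - wn u κ (n + 1) s t x‖ ≤ 1 / 2 * (1 / 4) ^ n := by
  induction n generalizing x with
  | zero =>
    have := (h.wn_prop 1).2 s t x
    simpa [wn] using this
  | succ n ih =>
    have := h.contr s t ((h.wn_prop n).1.cx s t) ((h.wn_prop (n + 1)).1.cx s t)
      ((h.wn_prop n).2 s t) ((h.wn_prop (n + 1)).2 s t) (δ := 1 / 2 * (1 / 4) ^ n) (by positivity) ih x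
    refine this.trans (le_of_eq ?_)
    rw [pow_succ]; ring

lemma Smal.tends {u : ℝ → ℝ → ℂ} {κ : ℝ} (h : Smal u κ) (s t x : ℝ) :
    Tendsto (fun n => wn u κ n s t x) atTop (𝓝 (ww u κ s t x)) := by
  have : CauchySeq (fun n => wn u κ n s t x) := by
    refine cauchySeq_of_le_geometric (1 / 4) (1 / 2) (by norm_num) fun n => ?_
    rw [dist_eq_norm]; exact h.wn_step n s t x
  exact this.tendsto_limUnder

lemma Smal.dist {u : ℝ → ℝ → ℂ} {κ : ℝ} (h : Smal u κ) (n : ℕ) (s t x : ℝ) :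
    ‖wn u κ n s t x - ww u κ s t x‖ ≤ (1 / 4) ^ n := by
  have := dist_le_of_le_geometric_of_tendsto (r := 1 / 4) (C := 1 / 2) (by norm_num)
    (fun n => by rw [dist_eq_norm]; exact h.wn_step n s t x) (h.tends s t x) n
  rw [dist_eq_norm] at this
  refine this.trans ?_
  have : (0 : ℝ) < (1 / 4) ^ n := by positivity
  rw [div_le_iff₀ (by norm_num)]; linarith

lemma Smal.w_c3 {u : ℝ → ℝ → ℂ} {κ : ℝ} (h : Smal u κ) : C3 (ww u κ) := by
  have : TendstoUniformly (fun n (z : ℝ × ℝ × ℝ) => wn u κ n z.1 z.2.1 z.2.2)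
      (fun z => ww u κ z.1 z.2.1 z.2.2) atTop := by
    rw [Metric.tendstoUniformly_iff]
    intro ε hε
    have : Tendsto (fun n : ℕ => (1 / 4 : ℝ) ^ n) atTop (𝓝 0) :=
      tendsto_pow_atTop_nhds_zero_of_lt_one (by norm_num) (by norm_num)
    filter_upwards [this.eventually (gt_mem_nhds hε)] with n hn z
    rw [dist_comm, dist_eq_norm]
    exact (h.dist n _ _ _).trans_lt hn
  exact this.continuous (Eventually.of_forall fun n => (h.wn_prop n).1).frequently

lemma Smal.w_bd {u : ℝ → ℝ → ℂ} {κ : ℝ} (h : Smal u κ) (s t x : ℝ) : ‖ww u κ s t x‖ ≤ 1 / 2 :=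
  le_of_tendsto (h.tends s t x).norm (Eventually.of_forall fun n => (h.wn_prop n).2 s t x)

lemma Smal.w_fix {u : ℝ → ℝ → ℂ} {κ : ℝ} (h : Smal u κ) (s t x : ℝ) :
    ww u κ s t x = CE (lam κ s) (fun y => u t y - conj (u t y) * (ww u κ s t y) ^ 2) x := by
  have h1 := (h.tends s t x).comp (tendsto_add_atTop_nat 1)
  refine tendsto_nhds_unique h1 ?_
  rw [tendsto_iff_norm_sub_tendsto_zero]
  have h0 : Tendsto (fun n : ℕ => (1 / 4 : ℝ) ^ n / 4) atTop (𝓝 0) := by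
    simpa using (tendsto_pow_atTop_nhds_zero_of_lt_one (r := (1 / 4 : ℝ)) (by norm_num) (by norm_num)).div_const 4
  refine squeeze_zero (fun n => norm_nonneg _) (fun n => ?_) h0
  exact h.contr s t ((h.wn_prop n).1.cx s t) (h.w_c3.cx s t) ((h.wn_prop n).2 s t) (h.w_bd s t)
    (by positivity) (h.dist n s t) x

lemma Smal.w_nl_c {u : ℝ → ℝ → ℂ} {κ : ℝ} (h : Smal u κ) (s t : ℝ) :
    Continuous (fun y => u t y - conj (u t y) * (ww u κ s t y) ^ 2) :=
  (h.cx t).sub ((continuous_conj.comp (h.cx t)).mul ((h.w_c3.cx s t).pow 2))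

lemma Smal.w_dx {u : ℝ → ℝ → ℂ} {κ : ℝ} (h : Smal u κ) (s t x : ℝ) :
    HasDerivAt (ww u κ s t) (lam κ s * ww u κ s t x + (u t x - conj (u t x) * (ww u κ s t x) ^ 2)) x := by
  obtain ⟨C, hC0, hC⟩ := h.bd1 t
  have e : ww u κ s t = CE (lam κ s) (fun y => u t y - conj (u t y) * (ww u κ s t y) ^ 2) :=
    funext (h.w_fix s t)
  have := CE_hasDerivAt (l := lam κ s) (by rw [lam_re]; linarith [h.pos]) (h.w_nl_c s t)
    (K := 5 / 4 * C) (fun y => (nl_bd (h.w_bd s t y)).trans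
        (mul_le_mul_of_nonneg_left (hC y) (by norm_num))) x
  rw [← e] at this
  exact this

end PartW

noncomputable section PartWt
open scoped ComplexConjugate
open Filter Topology Set

lemma EE_dec {l : ℝ} (hl : 0 < l) {g : ℝ → ℝ} (hc : Continuous g) (hg : ∀ x, 0 ≤ g x) {C : ℝ} (hC : 0 ≤ C)
    (hb : ∀ x, g x ≤ C * (1 + x ^ 2)⁻¹) (x : ℝ) :
    EE l g x ≤ (C * (4 / l * (1 + 8 / l ^ 2))) * (1 + x ^ 2)⁻¹ := by
  have hbd : ∀ x, |g x| ≤ C := fun x => by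
    rw [abs_of_nonneg (hg x)]
    exact (hb x).trans (by nlinarith [wt_le_one x, wt_nonneg x])
  have := EE_le_exp (l := l) (m := l / 2) (c := C * (2 * (1 + 8 / l ^ 2)) * (1 + x ^ 2)⁻¹) (by linarith) hl hg hc hbd x ?_
  · refine this.trans (le_of_eq ?_)
    field_simp; ring
  · intro r hr
    refine (hb _).trans ?_
    have h1 : 1 + l ^ 2 * r ^ 2 / 8 ≤ Real.exp (l / 2 * r) := by
      have := Real.quadratic_le_exp_of_nonneg (x := l / 2 * r) (by positivity)
      nlinarith [mul_pos hl hr]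
    have h2 : 1 + r ^ 2 ≤ (1 + 8 / l ^ 2) * Real.exp (l / 2 * r) := by
      calc 1 + r ^ 2 ≤ (1 + 8 / l ^ 2) * (1 + l ^ 2 * r ^ 2 / 8) := by
            have : (1 + 8 / l ^ 2) * (1 + l ^ 2 * r ^ 2 / 8) = 1 + r ^ 2 + (8 / l ^ 2 + l ^ 2 * r ^ 2 / 8) := by
              field_simp; ring
            rw [this]
            have : 0 ≤ 8 / l ^ 2 + l ^ 2 * r ^ 2 / 8 := by positivity
            linarith
        _ ≤ _ := by gcongr
    have h3 : (1 + (x - r) ^ 2)⁻¹ ≤ 2 * (1 + r ^ 2) * (1 + x ^ 2)⁻¹ := by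
      rw [inv_le_iff_one_le_mul₀ (by positivity), ← div_eq_mul_inv]
      rw [mul_comm, ← mul_div_assoc, le_div_iff₀ (by positivity)]
      nlinarith [sq_nonneg (x - 2 * r), sq_nonneg (r * (x - r)), sq_nonneg (x-r)]
    calc C * (1 + (x - r) ^ 2)⁻¹ ≤ C * (2 * (1 + r ^ 2) * (1 + x ^ 2)⁻¹) := by gcongr
      _ ≤ C * (2 * ((1 + 8 / l ^ 2) * Real.exp (l / 2 * r)) * (1 + x ^ 2)⁻¹) := by gcongr
      _ = _ := by ring

lemma Smal.w_le {u : ℝ → ℝ → ℂ} {κ : ℝ} (h : Smal u κ) (s t x : ℝ) :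
    ‖ww u κ s t x‖ ≤ 5 / 4 * EE (2 * κ) (fun y => ‖u t y‖) x := by
  obtain ⟨C, hC0, hC⟩ := h.bd1 t
  rw [h.w_fix]
  refine (CE_norm_le x).trans ?_
  rw [lam_re, neg_neg, ← EE_const_mul]
  refine EE_mono (by linarith [h.pos]) (h.w_nl_c s t).norm (K := 5 / 4 * C) (fun y => ?_)
    ((h.cx t).norm.const_mul _ |>.congr fun _ => rfl) (L := 5 / 4 * C) (fun y => ?_) x
    (fun r _ => nl_bd (h.w_bd s t _))
  · rw [abs_of_nonneg (norm_nonneg _)]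
    exact (nl_bd (h.w_bd s t _)).trans (mul_le_mul_of_nonneg_left (hC y) (by norm_num))
  · rw [abs_of_nonneg (by positivity)]
    exact (mul_le_mul_of_nonneg_left (hC y) (by norm_num))

lemma Smal.w_dec {u : ℝ → ℝ → ℂ} {κ : ℝ} (h : Smal u κ) (hu : Dec u) (s : ℝ) : Dec (ww u κ s) := by
  refine ⟨h.w_c3.comp (by fun_prop : Continuous fun z : ℝ × ℝ => (s, z.1, z.2)), fun R => ?_⟩
  obtain ⟨C, hC0, hC⟩ := hu.2 R
  have hκ := h.pos
  refine ⟨5 / 4 * (C * (4 / (2 * κ) * (1 + 8 / (2 * κ) ^ 2))), by positivity, fun t x ht => ?_⟩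
  rw [mul_assoc]
  refine (h.w_le s t x).trans (mul_le_mul_of_nonneg_left ?_ (by norm_num))
  exact EE_dec (by linarith) (h.cx t).norm (fun y => norm_nonneg _) hC0 (fun y => hC t y ht) x

/-- time derivative of the Riccati function -/
def wt (u ux : ℝ → ℝ → ℂ) (κ s t x : ℝ) : ℂ :=
  I * ((lam κ s ^ 2 - 2 * (u t x * conj (u t x))) * ww u κ s t x + lam κ s * u t x + ux t x
    + (conj (ux t x) - lam κ s * conj (u t x)) * ww u κ s t x ^ 2)

lemma conj_deriv {f : ℝ → ℂ} {f' : ℂ} {x : ℝ} (h : HasDerivAt f f' x) :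
    HasDerivAt (fun y => conj (f y)) (conj f') x := by
  simpa using h.star

variable {u ux uxx ut : ℝ → ℝ → ℂ} {κ : ℝ}

lemma wt_dx (g : Good u ux uxx ut) (h : Smal u κ) (s t x : ℝ) :
    HasDerivAt (wt u ux κ s t) ((lam κ s - 2 * conj (u t x) * ww u κ s t x) * wt u ux κ s t x
      + ut t x - conj (ut t x) * ww u κ s t x ^ 2) x := by
  have d1 := g.dx t x
  have d2 := conj_deriv d1
  have d3 := g.dxx t x
  have d4 := conj_deriv d3
  have dw := h.w_dx s t x
  have := (((((((hasDerivAt_const x (lam κ s ^ 2)).sub ((d1.mul d2).const_mul 2)).mul dw).add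
    (d1.const_mul (lam κ s))).add d3).add ((d4.sub (d2.const_mul (lam κ s))).mul (dw.pow 2))).const_mul I)
  refine HasDerivAt.congr_deriv (f := wt u ux κ s t) this ?_
  simp only [wt, g.eq t x, map_sub, map_mul, Complex.conj_I, Complex.conj_conj, map_ofNat, Pi.pow_apply, Pi.sub_apply, Pi.mul_apply]
  push_cast
  ring

lemma Smal.sm_of_le (h : Smal u κ) (t : ℝ) {c : ℝ → ℂ} (hc : Continuous c) (hle : ∀ y, ‖c y‖ ≤ ‖u t y‖) (x : ℝ) :
    EE (2 * κ) (fun y => ‖c y‖) x ≤ 1 / 2 := by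
  obtain ⟨C, hC0, hC⟩ := h.bd1 t
  have : EE (2 * κ) (fun y => ‖c y‖) x ≤ EE (2 * κ) (fun y => ‖u t y‖) x :=
    EE_mono (by linarith [h.pos]) hc.norm (K := C) (fun y => by
      rw [abs_of_nonneg (norm_nonneg _)]; exact (hle y).trans (hC y)) (h.cx t).norm (L := C)
      (fun y => by rw [abs_of_nonneg (norm_nonneg _)]; exact hC y) x (fun r _ => hle _)
  linarith [h.sm t x]

lemma w_dt (g : Good u ux uxx ut) (h : Smal u κ) (s t x : ℝ) :
    HasDerivAt (fun t => ww u κ s t x) (wt u ux κ s t x) t := by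
  set R := |t| + 1
  have hκ := h.pos
  obtain ⟨A, hA0, hA⟩ := g.bd R
  obtain ⟨T, hT0, hT⟩ := g.tay R
  have htR : |t| ≤ R := by simp [R]
  set w := ww u κ s t with hw
  have A1 : ∀ t' x, |t'| ≤ R → ‖u t' x‖ ≤ A ∧ ‖ux t' x‖ ≤ A ∧ ‖ut t' x‖ ≤ A := by
    intro t' x ht'
    obtain ⟨a, b, _, d⟩ := hA t' x ht'
    have : A * (1 + x ^ 2)⁻¹ ≤ A := by nlinarith [wt_le_one x, wt_nonneg x]
    exact ⟨a.trans this, b.trans this, d.trans this⟩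
  have cW : Continuous (wt u ux κ s t) :=
    continuous_iff_continuousAt.2 fun x => (wt_dx g h s t x).continuousAt
  obtain ⟨D0, hD0⟩ : ∃ D0 : ℝ, ∀ x, ‖wt u ux κ s t x‖ ≤ D0 := by
    refine ⟨1 * ((‖lam κ s ^ 2‖ + 2 * (A * A)) * (1 / 2) + ‖lam κ s‖ * A + A + (A + ‖lam κ s‖ * A) * (1 / 2) ^ 2),
      fun x => ?_⟩
    obtain ⟨a1, a2, a3⟩ := A1 t x htR
    have a4 := h.w_bd s t x
    unfold wt
    rw [norm_mul, norm_I]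
    refine mul_le_mul_of_nonneg_left ?_ (by norm_num)
    refine (norm_add_le _ _).trans (add_le_add ((norm_add_le _ _).trans (add_le_add ((norm_add_le _ _).trans
      (add_le_add ?_ ?_)) a2)) ?_)
    · rw [norm_mul]
      have : ‖lam κ s ^ 2 - 2 * (u t x * conj (u t x))‖ ≤ ‖lam κ s ^ 2‖ + 2 * (A * A) := by
        refine (norm_sub_le _ _).trans (add_le_add le_rfl ?_)
        rw [norm_mul, norm_mul, RCLike.norm_conj, Complex.norm_ofNat]
        gcongr
      gcongr
    · rw [norm_mul]; gcongr
    · rw [norm_mul, norm_pow]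
      have : ‖conj (ux t x) - lam κ s * conj (u t x)‖ ≤ A + ‖lam κ s‖ * A := by
        refine (norm_sub_le _ _).trans (add_le_add ?_ ?_)
        · rwa [RCLike.norm_conj]
        · rw [norm_mul, RCLike.norm_conj]; gcongr
      gcongr
  have key : ∃ K : ℝ, ∀ t', |t' - t| < 1 → ‖ww u κ s t' x - ww u κ s t x - (t' - t : ℝ) * wt u ux κ s t x‖ ≤ K * (t' - t) ^ 2 := by
    set B := A + T with hB
    set B1 := 5 / 4 * B / κ with hB1
    refine ⟨(5 / 4 * T + A * B1 ^ 2 + B * B1) / κ, fun t' ht' => ?_⟩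
    have ht'R : |t'| ≤ R := by
      have := abs_sub_abs_le_abs_sub t' t
      simp only [R]; linarith
    set q := |t' - t| with hq
    have q0 : 0 ≤ q := abs_nonneg _
    have qq : q ^ 2 = (t' - t) ^ 2 := sq_abs _
    have lip : ∀ y, ‖u t' y - u t y‖ ≤ B * q := by
      intro y
      have h1 := hT t t' y htR ht'R
      have h2 := (A1 t y htR).2.2
      calc ‖u t' y - u t y‖ = ‖(u t' y - u t y - (t' - t : ℝ) * ut t y) + (t' - t : ℝ) * ut t y‖ := by congr 1; ring
        _ ≤ T * (t' - t) ^ 2 + q * A := by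
          refine (norm_add_le _ _).trans (add_le_add h1 ?_)
          rw [norm_mul, Complex.norm_real, Real.norm_eq_abs]; gcongr
        _ ≤ _ := by 
          rw [← qq, hB]
          have hq1 : q ≤ 1 := ht'.le
          have : q ^ 2 ≤ q := by nlinarith
          nlinarith [mul_le_mul_of_nonneg_left this hT0]
    have cu := h.cx t
    have cu' := h.cx t'
    have cc : Continuous fun y => conj (u t y) := continuous_conj.comp cu
    have cc' : Continuous fun y => conj (u t' y) := continuous_conj.comp cu'
    have cw : Continuous (ww u κ s t) := h.w_c3.cx s t
    have cw' : Continuous (ww u κ s t') := h.w_c3.cx s t'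
    have cut : Continuous (ut t) := g.cut.comp (by fun_prop : Continuous fun x : ℝ => (t, x))
    have cct : Continuous fun y => conj (ut t y) := continuous_conj.comp cut
    have w1 := h.w_bd s t
    have w2 := h.w_bd s t'
    have dest : ∀ y, ‖ww u κ s t' y - ww u κ s t y‖ ≤ B1 * q := by
      intro y
      have := CE_stab hκ (lam_re κ s) (d := fun y => ww u κ s t' y - ww u κ s t y)
        (F := fun y => (u t' y - u t y) - conj (u t' y - u t y) * ww u κ s t y ^ 2)
        (c := fun y => conj (u t' y) * (ww u κ s t' y + ww u κ s t y))
        (by simp only [map_sub]; fun_prop) (K := 5 / 4 * (B * q)) (fun y => (nl_bd (w1 y)).trans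
          (mul_le_mul_of_nonneg_left (lip y) (by norm_num)))
        (D := 1) (fun y => (norm_sub_le _ _).trans (by linarith [w1 y, w2 y])) (by fun_prop)
        (L := A) (fun y => ?_) (fun y => h.sm_of_le t' (by fun_prop) (fun y => ?_) y) (fun y => ?_) y
      · refine this.trans (le_of_eq ?_)
        rw [hB1]; ring
      · rw [norm_mul, RCLike.norm_conj]
        have := (norm_add_le (ww u κ s t' y) (ww u κ s t y)).trans (by linarith [w1 y, w2 y] : _ ≤ (1 : ℝ))
        have := (A1 t' y ht'R).1
        calc _ ≤ A * 1 := by gcongr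
          _ = A := mul_one _
      · rw [norm_mul, RCLike.norm_conj]
        have := (norm_add_le (ww u κ s t' y) (ww u κ s t y)).trans (by linarith [w1 y, w2 y] : _ ≤ (1 : ℝ))
        nlinarith [norm_nonneg (u t' y)]
      · refine ((h.w_dx s t' y).sub (h.w_dx s t y)).congr_deriv ?_
        simp only [map_sub]; ring
    have := CE_stab hκ (lam_re κ s) (d := fun y => ww u κ s t' y - ww u κ s t y - (t' - t : ℝ) * wt u ux κ s t y)
        (F := fun y => ((u t' y - u t y - (t' - t : ℝ) * ut t y) -
          conj (u t' y - u t y - (t' - t : ℝ) * ut t y) * ww u κ s t y ^ 2)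
          - conj (u t' y) * (ww u κ s t' y - ww u κ s t y) ^ 2
          - 2 * conj (u t' y - u t y) * ww u κ s t y * (ww u κ s t' y - ww u κ s t y))
        (c := fun y => 2 * conj (u t y) * ww u κ s t y)
        (by simp only [map_sub, map_mul]; fun_prop) (K := (5 / 4 * T + A * B1 ^ 2 + B * B1) * q ^ 2) (fun y => ?_)
        (D := 1 + q * D0) (fun y => ?_) (by fun_prop)
        (L := A) (fun y => ?_) (fun y => h.sm_of_le t (by fun_prop) (fun y => ?_) y) (fun y => ?_) x
    · refine this.trans (le_of_eq ?_)
      rw [qq]; ring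
    · have e1 := (nl_bd (a := u t' y - u t y - (t' - t : ℝ) * ut t y) (w1 y)).trans
          (mul_le_mul_of_nonneg_left (hT t t' y htR ht'R) (by norm_num))
      have e2 : ‖conj (u t' y) * (ww u κ s t' y - ww u κ s t y) ^ 2‖ ≤ A * (B1 * q) ^ 2 := by
        rw [norm_mul, norm_pow, RCLike.norm_conj]
        have := (A1 t' y ht'R).1
        have := dest y
        gcongr
      have e3 : ‖2 * conj (u t' y - u t y) * ww u κ s t y * (ww u κ s t' y - ww u κ s t y)‖
          ≤ 2 * (B * q) * (1 / 2) * (B1 * q) := by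
        rw [norm_mul, norm_mul, norm_mul, RCLike.norm_conj, Complex.norm_ofNat]
        have := lip y
        have := dest y
        have := w1 y
        gcongr
      refine (norm_sub_le _ _).trans ((add_le_add ((norm_sub_le _ _).trans (add_le_add e1 e2)) e3).trans (le_of_eq ?_))
      rw [← qq]; ring
    · refine (norm_sub_le _ _).trans (add_le_add ((norm_sub_le _ _).trans (by linarith [w1 y, w2 y])) ?_)
      rw [norm_mul, Complex.norm_real, Real.norm_eq_abs]
      exact mul_le_mul_of_nonneg_left (hD0 y) q0
    · rw [norm_mul, norm_mul, RCLike.norm_conj, Complex.norm_ofNat]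
      have := (A1 t y htR).1
      have := w1 y
      calc _ ≤ 2 * A * (1 / 2) := by gcongr
        _ = A := by ring
    · rw [norm_mul, norm_mul, RCLike.norm_conj, Complex.norm_ofNat]
      have := w1 y
      nlinarith [norm_nonneg (u t y)]
    · refine (((h.w_dx s t' y).sub (h.w_dx s t y)).sub ((wt_dx g h s t y).const_mul _)).congr_deriv ?_
      simp only [map_sub, map_mul, Complex.conj_ofReal]; ring
  obtain ⟨K, hK⟩ := key
  rw [hasDerivAt_iff_isLittleO]
  have big : (fun t' => ww u κ s t' x - ww u κ s t x - (t' - t) • wt u ux κ s t x) =O[𝓝 t] fun t' => (t' - t) ^ 2 := by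
    refine Asymptotics.IsBigO.of_bound K ?_
    have : ∀ᶠ t' in 𝓝 t, |t' - t| < 1 :=
      ((by fun_prop : Continuous fun t' : ℝ => |t' - t|).tendsto t).eventually (gt_mem_nhds (by simp))
    filter_upwards [this] with t' ht'
    have := hK t' ht'
    rw [Real.norm_eq_abs, abs_of_nonneg (sq_nonneg _)]
    simpa [Complex.real_smul] using this
  refine big.trans_isLittleO ?_
  have : (fun z : ℝ => z ^ 2) =o[𝓝 0] fun z => z := by
    simpa using Asymptotics.isLittleO_pow_id (𝕜 := ℝ) (n := 2) (by norm_num)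
  have tt : Tendsto (fun t' : ℝ => t' - t) (𝓝 t) (𝓝 0) := by
    have := (by fun_prop : Continuous fun t' : ℝ => t' - t).tendsto t
    simpa using this
  exact this.comp_tendsto tt

end PartWt

noncomputable section PartCl
open scoped ComplexConjugate
open Filter Topology Set

lemma re_deriv {f : ℝ → ℂ} {f' : ℂ} {x : ℝ} (h : HasDerivAt f f' x) :
    HasDerivAt (fun y => (f y).re) f'.re x := by
  exact Complex.reCLM.hasFDerivAt.comp_hasDerivAt x h

lemma im_deriv {f : ℝ → ℂ} {f' : ℂ} {x : ℝ} (h : HasDerivAt f f' x) :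
    HasDerivAt (fun y => (f y).im) f'.im x := by
  exact Complex.imCLM.hasFDerivAt.comp_hasDerivAt x h

/-- integral of an exact derivative vanishes -/
lemma Dec.int_deriv {F F' : ℝ → ℝ → ℝ} (h : Dec F) (h' : Dec F') (t : ℝ)
    (hd : ∀ x, HasDerivAt (F t) (F' t x) x) : ∫ x, F' t x = 0 := by
  have := integral_of_hasDerivAt_of_tendsto hd (h'.integrable t) (h.tendsto_atBot t) (h.tendsto_atTop t)
  simpa using this

def ff (u : ℝ → ℝ → ℂ) (t x : ℝ) : ℝ := normSq (u t x)
def fx (u ux : ℝ → ℝ → ℂ) (t x : ℝ) : ℝ := 2 * (conj (u t x) * ux t x).re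
def aa (u : ℝ → ℝ → ℂ) (κ s t x : ℝ) : ℝ := (conj (u t x) * ww u κ s t x).re
def bb (u : ℝ → ℝ → ℂ) (κ s t x : ℝ) : ℝ := (conj (u t x) * ww u κ s t x).im
def pp (u : ℝ → ℝ → ℂ) (κ s t x : ℝ) : ℝ := normSq (ww u κ s t x)
def TT (u : ℝ → ℝ → ℂ) (κ s t x : ℝ) : ℝ := pp u κ s t x / (1 - pp u κ s t x)

section
variable {u ux uxx ut : ℝ → ℝ → ℂ}

lemma Good.du (g : Good u ux uxx ut) : Dec u :=
  ⟨g.cu, fun R => by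
    obtain ⟨C, h0, h⟩ := g.bd R
    exact ⟨C, h0, fun t x ht => (h t x ht).1⟩⟩
lemma Good.dux (g : Good u ux uxx ut) : Dec ux :=
  ⟨g.cux, fun R => by
    obtain ⟨C, h0, h⟩ := g.bd R
    exact ⟨C, h0, fun t x ht => (h t x ht).2.1⟩⟩
lemma Good.duxx (g : Good u ux uxx ut) : Dec uxx :=
  ⟨g.cuxx, fun R => by
    obtain ⟨C, h0, h⟩ := g.bd R
    exact ⟨C, h0, fun t x ht => (h t x ht).2.2.1⟩⟩
lemma Good.dut (g : Good u ux uxx ut) : Dec ut :=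
  ⟨g.cut, fun R => by
    obtain ⟨C, h0, h⟩ := g.bd R
    exact ⟨C, h0, fun t x ht => (h t x ht).2.2.2⟩⟩

lemma ff_eq (u : ℝ → ℝ → ℂ) : ff u = fun t x => (conj (u t x) * u t x).re := by
  ext t x; simp [ff, normSq_apply]

lemma Good.df (g : Good u ux uxx ut) : Dec (ff u) := by
  rw [ff_eq]; exact (g.du.conj.mul g.du).re

lemma Good.dfx (g : Good u ux uxx ut) : Dec (fx u ux) :=
  Dec.cmul 2 (g.du.conj.mul g.dux).re

lemma Good.f_dx (g : Good u ux uxx ut) (t x : ℝ) : HasDerivAt (ff u t) (fx u ux t x) x := by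
  rw [ff_eq]
  refine (re_deriv ((conj_deriv (g.dx t x)).mul (g.dx t x))).congr_deriv ?_
  simp [fx]; ring

lemma Good.mass (g : Good u ux uxx ut) :
    Cons (ff u) (fun t x => 2 * (conj (u t x) * ux t x).im) (fun t x => 2 * (conj (u t x) * ut t x).re) where
  r := g.df
  fl := Dec.cmul 2 (g.du.conj.mul g.dux).im
  rt := Dec.cmul 2 (g.du.conj.mul g.dut).re
  dt := fun t x => by
    rw [ff_eq]
    refine (re_deriv ((conj_deriv (g.dt t x)).mul (g.dt t x))).congr_deriv ?_
    simp; ring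
  dx := fun t x => by
    refine ((im_deriv ((conj_deriv (g.dx t x)).mul (g.dxx t x))).const_mul 2).congr_deriv ?_
    rw [g.eq]
    simp; ring

variable {κ : ℝ}

lemma Smal.pp_le (h : Smal u κ) (s t x : ℝ) : pp u κ s t x ≤ 1 / 4 := by
  have := h.w_bd s t x
  unfold pp; rw [normSq_eq_norm_sq]
  nlinarith [norm_nonneg (ww u κ s t x)]

lemma pp_nonneg (s t x : ℝ) : 0 ≤ pp u κ s t x := normSq_nonneg _

lemma fp_eq (s t x : ℝ) : ff u t x * pp u κ s t x = aa u κ s t x ^ 2 + bb u κ s t x ^ 2 := by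
  simp [ff, pp, aa, bb, normSq_apply]; ring

variable (s : ℝ)

lemma dw (g : Good u ux uxx ut) (h : Smal u κ) (s : ℝ) : Dec (ww u κ s) := h.w_dec g.du s

lemma da (g : Good u ux uxx ut) (h : Smal u κ) (s : ℝ) : Dec (aa u κ s) := (g.du.conj.mul (dw g h s)).re
lemma db (g : Good u ux uxx ut) (h : Smal u κ) (s : ℝ) : Dec (bb u κ s) := (g.du.conj.mul (dw g h s)).im

lemma dp (g : Good u ux uxx ut) (h : Smal u κ) (s : ℝ) : Dec (pp u κ s) := by
  have e : pp u κ s = fun t x => (conj (ww u κ s t x) * ww u κ s t x).re := by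
    ext t x; simp [pp, normSq_apply]
  rw [e]; exact ((dw g h s).conj.mul (dw g h s)).re

lemma dT (g : Good u ux uxx ut) (h : Smal u κ) (s : ℝ) : Dec (TT u κ s) := by
  refine (dp g h s).mono ?_ (4 / 3) ?_
  · refine (dp g h s).1.div (continuous_const.sub (dp g h s).1) fun z => ?_
    have := h.pp_le s z.1 z.2
    intro h'; linarith
  · intro t x
    have h1 := h.pp_le s t x
    have h0 := pp_nonneg (u := u) (κ := κ) s t x
    rw [Real.norm_of_nonneg h0, Real.norm_of_nonneg (by unfold TT; exact div_nonneg h0 (by linarith))]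
    unfold TT
    rw [div_le_iff₀ (by linarith)]; nlinarith

lemma dwt (g : Good u ux uxx ut) (h : Smal u κ) (s : ℝ) : Dec (wt u ux κ s) := by
  have w := dw g h s
  have c : Bdc (fun t x => lam κ s ^ 2 - 2 * (u t x * conj (u t x))) :=
    (Bdc.of_const _).sub (Dec.cmul 2 (g.du.mul g.du.conj)).bdc
  have := Dec.cmul I ((((c.mulD w).add (Dec.cmul (lam κ s) g.du)).add g.dux).add
    ((g.dux.conj.sub (Dec.cmul (lam κ s) g.du.conj)).mul (w.mul w)))
  refine (this.mono ?_ 1 ?_)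
  · simpa [wt, pow_two] using this.1
  · intro t x; simp only [wt, pow_two, one_mul]; exact le_rfl

def BB (u ux : ℝ → ℝ → ℂ) (κ s t x : ℝ) : ℂ :=
  (-I * lam κ s * conj (u t x) + I * conj (ux t x)) * ww u κ s t x - I * (u t x * conj (u t x))

lemma dB (g : Good u ux uxx ut) (h : Smal u κ) (s : ℝ) : Dec (BB u ux κ s) :=
  (((Dec.cmul _ g.du.conj).add (Dec.cmul _ g.dux.conj)).mul (dw g h s)).sub
    (Dec.cmul _ (g.du.mul g.du.conj))

lemma A_dt (g : Good u ux uxx ut) (h : Smal u κ) (s : ℝ) (t x : ℝ) : HasDerivAt (fun t => conj (u t x) * ww u κ s t x)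
    (conj (ut t x) * ww u κ s t x + conj (u t x) * wt u ux κ s t x) t :=
  (conj_deriv (g.dt t x)).mul (w_dt g h s t x)

lemma B_dx (g : Good u ux uxx ut) (h : Smal u κ) (s : ℝ) (t x : ℝ) : HasDerivAt (BB u ux κ s t)
    (-(conj (ut t x) * ww u κ s t x + conj (u t x) * wt u ux κ s t x)) x := by
  have d1 := g.dx t x
  have d2 := conj_deriv d1
  have d4 := conj_deriv (g.dxx t x)
  have d5 := h.w_dx s t x
  unfold BB
  refine ((((d2.const_mul (-I * lam κ s)).add (d4.const_mul I)).mul d5).sub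
    ((d1.mul d2).const_mul I)).congr_deriv ?_
  rw [g.eq]
  simp only [wt, map_sub, map_mul, conj_I, conj_conj, map_ofNat, neg_mul, Pi.add_apply, Pi.mul_apply]
  linear_combination 0 * I_sq

lemma cA (g : Good u ux uxx ut) (h : Smal u κ) (s : ℝ) : Cons (aa u κ s) (fun t x => (BB u ux κ s t x).re)
    (fun t x => (conj (ut t x) * ww u κ s t x + conj (u t x) * wt u ux κ s t x).re) where
  r := da g h s
  fl := (dB g h s).re
  rt := ((g.dut.conj.mul (dw g h s)).add (g.du.conj.mul (dwt g h s))).re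
  dt := fun t x => re_deriv (A_dt g h s t x)
  dx := fun t x => re_deriv (B_dx g h s t x)

lemma cB (g : Good u ux uxx ut) (h : Smal u κ) (s : ℝ) : Cons (bb u κ s) (fun t x => (BB u ux κ s t x).im)
    (fun t x => (conj (ut t x) * ww u κ s t x + conj (u t x) * wt u ux κ s t x).im) where
  r := db g h s
  fl := (dB g h s).im
  rt := ((g.dut.conj.mul (dw g h s)).add (g.du.conj.mul (dwt g h s))).im
  dt := fun t x => im_deriv (A_dt g h s t x)
  dx := fun t x => im_deriv (B_dx g h s t x)
end

end PartCl

noncomputable section PartCm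
set_option linter.unusedSectionVars false
open scoped ComplexConjugate
open Filter Topology Set

lemma EE_eq_CE (l : ℝ) (g : ℝ → ℝ) (x : ℝ) : ((EE l g x : ℝ) : ℂ) = CE (lam (l / 2) 0) (fun y => (g y : ℂ)) x := by
  unfold EE CE
  rw [← integral_complex_ofReal]
  congr 1; ext r
  simp [lam]
  left
  congr 1; ring

lemma EE_eq_CE_re (l : ℝ) (g : ℝ → ℝ) (x : ℝ) : EE l g x = (CE (lam (l / 2) 0) (fun y => (g y : ℂ)) x).re := by
  rw [← EE_eq_CE, ofReal_re]

lemma EE_hasDerivAt {l : ℝ} (hl : 0 < l) {g : ℝ → ℝ} (hc : Continuous g) {K : ℝ} (hb : ∀ x, |g x| ≤ K)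
    (x : ℝ) : HasDerivAt (EE l g) (g x - l * EE l g x) x := by
  have e : EE l g = fun x => (CE (lam (l / 2) 0) (fun y => (g y : ℂ)) x).re := by
    ext x; exact EE_eq_CE_re l g x
  have h1 := CE_hasDerivAt (l := lam (l / 2) 0) (by rw [lam_re]; linarith) (g := fun y => (g y : ℂ)) (by fun_prop)
    (K := K) (fun x => by simpa using hb x) x
  have h2 := re_deriv h1
  rw [← EE_eq_CE] at h2
  rw [← e] at h2
  refine h2.congr_deriv ?_
  simp [lam]; ring

lemma Dec.EE' {F : ℝ → ℝ → ℝ} (h : Dec F) (h0 : ∀ t x, 0 ≤ F t x) {l : ℝ} (hl : 0 < l) :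
    Dec (fun t x => EE l (F t) x) := by
  constructor
  · have h1 : C3 (fun _ t x => ((F t x : ℝ) : ℂ)) :=
      continuous_ofReal.comp (h.1.comp (by fun_prop : Continuous fun z : ℝ × ℝ × ℝ => (z.2.1, z.2.2)))
    have h2 := CE_cont3 (κ := l / 2) (by linarith) h1 (fun R => by
      obtain ⟨C, hC, hb⟩ := h.bdc.2 R
      exact ⟨C, fun _ t x ht => by simpa using hb t x ht⟩)
    have h3 := continuous_re.comp (h2.comp (by fun_prop : Continuous fun z : ℝ × ℝ => ((0 : ℝ), z.1, z.2)))
    refine h3.congr fun z => ?_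
    simp only [Function.comp]
    rw [← EE_eq_CE_re]
  · intro R
    obtain ⟨C, hC, hb⟩ := h.2 R
    refine ⟨C * (4 / l * (1 + 8 / l ^ 2)), ?_, fun t x ht => ?_⟩
    rotate_left
    · rw [Real.norm_of_nonneg (EE_nonneg (h0 t) x)]
      exact EE_dec hl (h.cx t) (h0 t) hC (fun x => (le_abs_self _).trans (hb t x ht)) x
    · positivity

/-- reflected function -/
def rfx (F : ℝ → ℝ → ℝ) (t x : ℝ) : ℝ := F t (-x)

lemma Dec.rfx' {F : ℝ → ℝ → ℝ} (h : Dec F) : Dec (rfx F) :=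
  ⟨h.1.comp (by fun_prop : Continuous fun z : ℝ × ℝ => (z.1, -z.2)), fun R => by
    obtain ⟨C, hC, hb⟩ := h.2 R
    exact ⟨C, hC, fun t x ht => by simpa [rfx] using hb t (-x) ht⟩⟩

/-- forward average -/
def mtt (u : ℝ → ℝ → ℂ) (κ t x : ℝ) : ℝ := 4 * κ * EE (4 * κ) (rfx (ff u) t) (-x)
/-- backward average -/
def mm (u : ℝ → ℝ → ℂ) (κ t x : ℝ) : ℝ := 4 * κ * EE (4 * κ) (ff u t) x

lemma C3.cz {G : ℝ → ℝ → ℝ → ℂ} (h : C3 G) (s : ℝ) : Continuous (fun z : ℝ × ℝ => G s z.1 z.2) :=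
  Continuous.comp (g := fun z : ℝ × ℝ × ℝ => G z.1 z.2.1 z.2.2) h
    (by fun_prop : Continuous fun z : ℝ × ℝ => (s, z.1, z.2))

/-- first Picard iterate -/
def w1 (u : ℝ → ℝ → ℂ) (κ s t x : ℝ) : ℂ := CE (lam κ s) (u t) x

def a1 (u : ℝ → ℝ → ℂ) (κ s t x : ℝ) : ℝ := (conj (u t x) * w1 u κ s t x).re
def p1 (u : ℝ → ℝ → ℂ) (κ s t x : ℝ) : ℝ := normSq (w1 u κ s t x)
def LL (u : ℝ → ℝ → ℂ) (κ s t x : ℝ) : ℝ := 2 * aa u κ s t x - 4 * κ * TT u κ s t x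
def Om (u : ℝ → ℝ → ℂ) (κ s t x : ℝ) : ℝ := 4 * (aa u κ s t x - a1 u κ s t x) - 2 * aa u κ s t x * pp u κ s t x
  - 2 * aa u κ s t x * pp u κ s t x ^ 2 - 2 * κ * pp u κ s t x ^ 2

lemma ff_nonneg (u : ℝ → ℝ → ℂ) (t x : ℝ) : 0 ≤ ff u t x := normSq_nonneg _

section
variable {u ux uxx ut : ℝ → ℝ → ℂ} {κ : ℝ} 
variable (s : ℝ)

lemma dmt (g : Good u ux uxx ut) (h : Smal u κ) : Dec (mtt u κ) := by
  have := Dec.cmul (4 * κ) ((g.df.rfx'.EE' (fun t x => ff_nonneg u t (-x)) (by linarith [h.pos] : 0 < 4 * κ)).rfx')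
  exact this

lemma mt_dx (g : Good u ux uxx ut) (h : Smal u κ) (t x : ℝ) : HasDerivAt (mtt u κ t) (4 * κ * (mtt u κ t x - ff u t x)) x := by
  obtain ⟨C, hC, hb⟩ := g.df.rfx'.bdc.2 |t|
  have h1 := EE_hasDerivAt (by linarith [h.pos] : 0 < 4 * κ) (g.df.rfx'.cx t) (K := C) (fun x => hb t x le_rfl) (-x)
  have h2 := (h1.scomp x (hasDerivAt_neg x)).const_mul (4 * κ)
  refine h2.congr_deriv ?_
  simp [rfx, mtt]

lemma w1_c3 (g : Good u ux uxx ut) (h : Smal u κ) : C3 (w1 u κ) := by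
  refine CE_cont3 h.pos (h.c3u) fun R => ?_
  obtain ⟨C, hC⟩ := h.bd R
  exact ⟨C, fun _ t x ht => hC t x ht⟩

lemma w1_le (g : Good u ux uxx ut) (h : Smal u κ) (s : ℝ) (t x : ℝ) : ‖w1 u κ s t x‖ ≤ EE (2 * κ) (fun y => ‖u t y‖) x := by
  have := CE_norm_le (l := lam κ s) (g := u t) x
  rwa [lam_re, neg_neg] at this

lemma dw1 (g : Good u ux uxx ut) (h : Smal u κ) (s : ℝ) : Dec (w1 u κ s) := by
  have h1 : Dec (fun t x => EE (2 * κ) (fun y => ‖u t y‖) x) :=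
    Dec.EE' g.du.norm (fun t x => norm_nonneg (u t x)) (by linarith [h.pos] : 0 < 2 * κ)
  refine h1.mono ?_ 1 ?_
  · exact (w1_c3 g h).cz s
  · intro t x
    rw [one_mul]
    exact (w1_le g h s t x).trans (le_abs_self _)

lemma w1_dx (g : Good u ux uxx ut) (h : Smal u κ) (s : ℝ) (t x : ℝ) : HasDerivAt (w1 u κ s t) (lam κ s * w1 u κ s t x + u t x) x := by
  obtain ⟨C, hC0, hC⟩ := h.bd1 t
  exact CE_hasDerivAt (by rw [lam_re]; linarith [h.pos]) (h.cx t) hC x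

lemma da1 (g : Good u ux uxx ut) (h : Smal u κ) (s : ℝ) : Dec (a1 u κ s) := (g.du.conj.mul (dw1 g h s)).re

lemma dp1 (g : Good u ux uxx ut) (h : Smal u κ) (s : ℝ) : Dec (p1 u κ s) := by
  have e : p1 u κ s = fun t x => (conj (w1 u κ s t x) * w1 u κ s t x).re := by
    ext t x; simp [p1, normSq_apply]
  rw [e]; exact ((dw1 g h s).conj.mul (dw1 g h s)).re

lemma p1_dx (g : Good u ux uxx ut) (h : Smal u κ) (s : ℝ) (t x : ℝ) : HasDerivAt (p1 u κ s t) (-4 * κ * p1 u κ s t x + 2 * a1 u κ s t x) x := by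
  have e : p1 u κ s t = fun x => (conj (w1 u κ s t x) * w1 u κ s t x).re := by
    ext x; simp [p1, normSq_apply]
  have d := w1_dx g h s t x
  rw [e]
  refine (re_deriv ((conj_deriv d).mul d)).congr_deriv ?_
  simp [a1, lam]; ring

lemma p_dx (g : Good u ux uxx ut) (h : Smal u κ) (s : ℝ) (t x : ℝ) : HasDerivAt (pp u κ s t)
    (-4 * κ * pp u κ s t x + 2 * aa u κ s t x * (1 - pp u κ s t x)) x := by
  have e : pp u κ s t = fun x => (conj (ww u κ s t x) * ww u κ s t x).re := by
    ext x; simp [pp, normSq_apply]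
  have d := h.w_dx s t x
  rw [e]
  refine (re_deriv ((conj_deriv d).mul d)).congr_deriv ?_
  simp [aa, lam, pow_two]; ring

lemma p_dt (g : Good u ux uxx ut) (h : Smal u κ) (s : ℝ) (t x : ℝ) : HasDerivAt (fun t => pp u κ s t x)
    (2 * (conj (ww u κ s t x) * wt u ux κ s t x).re) t := by
  have e : (fun t => pp u κ s t x) = fun t => (conj (ww u κ s t x) * ww u κ s t x).re := by
    ext t; simp [pp, normSq_apply]
  have d := w_dt g h s t x
  rw [e]
  refine (re_deriv ((conj_deriv d).mul d)).congr_deriv ?_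
  simp; ring

lemma one_sub_pp_ne (g : Good u ux uxx ut) (h : Smal u κ) (s : ℝ) (t x : ℝ) : 1 - pp u κ s t x ≠ 0 := by
  have := h.pp_le s t x
  intro h'; linarith

lemma oneT (g : Good u ux uxx ut) (h : Smal u κ) (s : ℝ) (t x : ℝ) : (1 - pp u κ s t x)⁻¹ = 1 + TT u κ s t x := by
  have := one_sub_pp_ne g h s t x
  unfold TT; field_simp; ring

lemma T_of (g : Good u ux uxx ut) (h : Smal u κ) {f : ℝ → ℝ} {f' x : ℝ} (hf : HasDerivAt f f' x) (h1 : 1 - f x ≠ 0) :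
    HasDerivAt (fun y => f y / (1 - f y)) (f' * ((1 - f x)⁻¹) ^ 2) x := by
  refine (hf.div (hf.const_sub 1) h1).congr_deriv ?_
  field_simp; ring

lemma T_dx (g : Good u ux uxx ut) (h : Smal u κ) (s : ℝ) (t x : ℝ) : HasDerivAt (TT u κ s t) ((1 + TT u κ s t x) * LL u κ s t x) x := by
  have h1 := one_sub_pp_ne g h s t x
  refine (T_of g h (p_dx g h s t x) h1).congr_deriv ?_
  unfold LL TT; field_simp; ring

lemma T_dt (g : Good u ux uxx ut) (h : Smal u κ) (s : ℝ) (t x : ℝ) : HasDerivAt (fun t => TT u κ s t x)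
    (2 * (conj (ww u κ s t x) * wt u ux κ s t x).re * (1 + TT u κ s t x) ^ 2) t := by
  have h1 := one_sub_pp_ne g h s t x
  refine (T_of g h (p_dt g h s t x) h1).congr_deriv ?_
  rw [oneT g h]

lemma A_dx (g : Good u ux uxx ut) (h : Smal u κ) (s : ℝ) (t x : ℝ) : HasDerivAt (fun x => conj (u t x) * ww u κ s t x)
    (conj (ux t x) * ww u κ s t x + conj (u t x) * (lam κ s * ww u κ s t x + (u t x - conj (u t x) * ww u κ s t x ^ 2))) x :=
  (conj_deriv (g.dx t x)).mul (h.w_dx s t x)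

lemma dL (g : Good u ux uxx ut) (h : Smal u κ) (s : ℝ) : Dec (LL u κ s) := (Dec.cmul 2 (da g h s)).sub (Dec.cmul (4 * κ) (dT g h s))

/-- flux of `T` -/
def jT (u : ℝ → ℝ → ℂ) (κ s t x : ℝ) : ℝ := 4 * s * TT u κ s t x - 2 * bb u κ s t x * (1 + TT u κ s t x)

lemma bT (g : Good u ux uxx ut) (h : Smal u κ) (s : ℝ) : Bdc (fun t x => 1 + TT u κ s t x) := (Bdc.of_const 1).add (dT g h s).bdc

lemma cT (g : Good u ux uxx ut) (h : Smal u κ) (s : ℝ) : Cons (TT u κ s) (jT u κ s)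
    (fun t x => 2 * (conj (ww u κ s t x) * wt u ux κ s t x).re * (1 + TT u κ s t x) ^ 2) where
  r := dT g h s
  fl := (Dec.cmul (4 * s) (dT g h s)).sub ((Dec.cmul 2 (db g h s)).mulB (bT g h s))
  rt := by
    simp only [pow_two]
    exact (Dec.cmul 2 ((dw g h s).conj.mul (dwt g h s)).re).mulB ((bT g h s).mul (bT g h s))
  dt := T_dt g h s
  dx := fun t x => by
    have h1 := one_sub_pp_ne g h s t x
    have d := T_dx g h s t x
    have e := im_deriv (A_dx g h s t x)
    refine ((d.const_mul (4 * s)).sub ((e.const_mul 2).mul (d.const_add 1))).congr_deriv ?_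
    rw [← oneT g h]
    unfold LL TT
    field_simp
    simp only [pp, aa, normSq_apply, wt, lam] at h1 ⊢
    simp [pow_two]
    ring
end

end PartCm

noncomputable section PartCn
set_option linter.unusedSectionVars false
open scoped ComplexConjugate
open Filter Topology Set

section
variable {u ux uxx ut : ℝ → ℝ → ℂ} {κ : ℝ} 
variable (s : ℝ)

lemma TT_nonneg (g : Good u ux uxx ut) (h : Smal u κ) (s : ℝ) (t x : ℝ) : 0 ≤ TT u κ s t x :=
  div_nonneg (pp_nonneg s t x) (by linarith [h.pp_le s t x])

lemma TT_le (g : Good u ux uxx ut) (h : Smal u κ) (s : ℝ) (t x : ℝ) : TT u κ s t x ≤ 4 / 3 * pp u κ s t x := by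
  have h1 := h.pp_le s t x
  have h0 := pp_nonneg (u := u) (κ := κ) s t x
  unfold TT
  rw [div_le_iff₀ (by linarith)]; nlinarith

lemma pp_le_TT (g : Good u ux uxx ut) (h : Smal u κ) (s : ℝ) (t x : ℝ) : pp u κ s t x ≤ TT u κ s t x := by
  have h1 := h.pp_le s t x
  have h0 := pp_nonneg (u := u) (κ := κ) s t x
  unfold TT
  rw [le_div_iff₀ (by linarith)]; nlinarith

def RC (u : ℝ → ℝ → ℂ) (κ s t x : ℝ) : ℝ :=
  ff u t x * pp u κ s t x * TT u κ s t x + 1 / 2 * (2 + TT u κ s t x) * LL u κ s t x ^ 2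

lemma dRC (g : Good u ux uxx ut) (h : Smal u κ) (s : ℝ) : Dec (RC u κ s) := by
  have h1 := (g.df.mul (dp g h s)).mul (dT g h s)
  have h2 := ((Bdc.of_const (1 / 2)).mul ((Bdc.of_const 2).add (dT g h s).bdc)).mulD ((dL g h s).mul (dL g h s))
  refine (h1.add h2).mono ?_ 1 ?_
  · simpa only [RC, pow_two] using (h1.add h2).1
  · intro t x; simp only [RC, pow_two, one_mul]; exact le_rfl

lemma dlog (g : Good u ux uxx ut) (h : Smal u κ) (s : ℝ) : Dec (fun t x => Real.log (1 + TT u κ s t x)) := by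
  refine (dT g h s).mono ?_ 1 ?_
  · refine Continuous.log (continuous_const.add (dT g h s).1) fun z => ?_
    have := TT_nonneg g h s z.1 z.2
    positivity
  · intro t x
    have h0 := TT_nonneg g h s t x
    rw [Real.norm_of_nonneg h0, Real.norm_of_nonneg (Real.log_nonneg (by linarith)), one_mul]
    have := Real.log_le_sub_one_of_pos (x := 1 + TT u κ s t x) (by linarith)
    linarith

lemma C_int (g : Good u ux uxx ut) (h : Smal u κ) (s : ℝ) (t : ℝ) : ∫ x, (TT u κ s t x * (BB u ux κ s t x).im - jT u κ s t x * bb u κ s t x)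
    = - ∫ x, RC u κ s t x := by
  have hF : Dec (fun t x => TT u κ s t x * aa u κ s t x - 2 * κ * (TT u κ s t x + 1 / 2 * (TT u κ s t x * TT u κ s t x)
      - Real.log (1 + TT u κ s t x))) :=
    ((dT g h s).mul (da g h s)).sub (Dec.cmul (2 * κ) (((dT g h s).add
      (Dec.cmul (1 / 2) ((dT g h s).mul (dT g h s)))).sub (dlog g h s)))
  have h1 : Dec (fun t x => TT u κ s t x * (BB u ux κ s t x).im - jT u κ s t x * bb u κ s t x) :=
    ((dT g h s).mul (dB g h s).im).sub ((cT g h s).fl.mul (db g h s))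
  have h2 := dRC g h s
  have := hF.int_deriv (h1.add h2) t (fun x => by
    have d := T_dx g h s t x
    have e := re_deriv (A_dx g h s t x)
    have hT := TT_nonneg g h s t x
    refine ((d.mul e).sub (((d.add ((d.mul d).const_mul (1 / 2))).sub ((d.const_add 1).log
      (by positivity))).const_mul (2 * κ))).congr_deriv ?_
    have h1 := one_sub_pp_ne g h s t x
    rw [← oneT g h]
    simp only [RC, LL, TT, jT]
    field_simp
    simp only [pp, aa, bb, normSq_apply, lam, ff, BB] at h1 ⊢
    simp [pow_two]
    field_simp
    ring)
  rw [integral_add (h1.integrable t) (h2.integrable t)] at this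
  linarith

lemma C_ftc (g : Good u ux uxx ut) (h : Smal u κ) (s : ℝ) (a b : ℝ) : ∫ t in a..b, ∫ x, RC u κ s t x =
    Inta (TT u κ s) (bb u κ s) a - Inta (TT u κ s) (bb u κ s) b := by
  have := Cons.inter_ftc (cT g h s) (cB g h s) a b
  simp_rw [C_int g h s] at this
  rw [intervalIntegral.integral_neg] at this
  linarith

def phi (u : ℝ → ℝ → ℂ) (κ t x : ℝ) : ℝ := ff u t x - mtt u κ t x
lemma dphi (g : Good u ux uxx ut) (h : Smal u κ) : Dec (phi u κ) := g.df.sub (dmt g h)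

def GB (u ux : ℝ → ℝ → ℂ) (κ s t x : ℝ) : ℝ := -2 * fx u ux t x * p1 u κ s t x + phi u κ t x * Om u κ s t x
  + ff u t x * (4 * κ * pp u κ s t x ^ 2 + 2 * aa u κ s t x * pp u κ s t x ^ 2)

lemma dOm (g : Good u ux uxx ut) (h : Smal u κ) (s : ℝ) : Dec (Om u κ s) := by
  have a := da g h s
  have p := dp g h s
  have := (((Dec.cmul 4 (a.sub (da1 g h s))).sub ((Dec.cmul 2 a).mul p)).sub ((Dec.cmul 2 a).mul (p.mul p))).sub
    (Dec.cmul (2 * κ) (p.mul p))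
  refine this.mono ?_ 1 ?_
  · simpa only [Om, pow_two] using this.1
  · intro t x; simp only [Om, pow_two, one_mul]; exact le_rfl

lemma dGB (g : Good u ux uxx ut) (h : Smal u κ) (s : ℝ) : Dec (GB u ux κ s) := by
  have a := da g h s
  have p := dp g h s
  have := (((Dec.cmul (-2) g.dfx).mul (dp1 g h s)).add ((dphi g h).mul (dOm g h s))).add
    (g.df.mul ((Dec.cmul (4 * κ) (p.mul p)).add ((Dec.cmul 2 a).mul (p.mul p))))
  refine this.mono ?_ 1 ?_
  · simpa only [GB, pow_two] using this.1
  · intro t x; simp only [GB, pow_two, one_mul]; exact le_rfl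

lemma B_int (g : Good u ux uxx ut) (h : Smal u κ) (s : ℝ) (t : ℝ) : ∫ x, GB u ux κ s t x =
    ∫ x, 2 * (bb u κ s t x * (BB u ux κ s t x).re - aa u κ s t x * (BB u ux κ s t x).im) := by
  have p := dp g h s
  have q := p.sub (dp1 g h s)
  have hF : Dec (fun t x => ff u t x * pp u κ s t x - 2 * (phi u κ t x * (pp u κ s t x - p1 u κ s t x))
      + 1 / 2 * (mtt u κ t x * (pp u κ s t x * pp u κ s t x))) :=
    ((g.df.mul p).sub (Dec.cmul 2 ((dphi g h).mul q))).add (Dec.cmul (1 / 2) ((dmt g h).mul (p.mul p)))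
  have h1 : Dec (fun t x => 2 * (bb u κ s t x * (BB u ux κ s t x).re - aa u κ s t x * (BB u ux κ s t x).im)) :=
    Dec.cmul 2 (((db g h s).mul (dB g h s).re).sub ((da g h s).mul (dB g h s).im))
  have h2 := dGB g h s
  have := hF.int_deriv (h1.sub h2) t (fun x => by
    have f' := g.f_dx t x
    have m' := mt_dx g h t x
    have p' := p_dx g h s t x
    have q' := p1_dx g h s t x
    refine (((f'.mul p').sub (((f'.sub m').mul (p'.sub q')).const_mul 2)).add
      ((m'.mul (p'.mul p')).const_mul (1 / 2))).congr_deriv ?_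
    have e : 2 * (bb u κ s t x * (BB u ux κ s t x).re - aa u κ s t x * (BB u ux κ s t x).im) =
        -4 * κ * (ff u t x * pp u κ s t x) - fx u ux t x * pp u κ s t x + 2 * ff u t x * aa u κ s t x := by
      simp only [pp, aa, bb, normSq_apply, lam, ff, BB, fx]
      simp
      ring
    rw [e]
    simp only [GB, Om, phi, Pi.sub_apply, Pi.mul_apply]
    ring)
  rw [integral_sub (h1.integrable t) (h2.integrable t)] at this
  linarith

def NN (u : ℝ → ℝ → ℂ) (κ s t : ℝ) : ℝ := Inta (bb u κ s) (aa u κ s) t - Inta (aa u κ s) (bb u κ s) t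

lemma B_ftc (g : Good u ux uxx ut) (h : Smal u κ) (s : ℝ) (a b : ℝ) : ∫ t in a..b, ∫ x, GB u ux κ s t x = NN u κ s b - NN u κ s a := by
  have e1 := Cons.inter_ftc (cB g h s) (cA g h s) a b
  have e2 := Cons.inter_ftc (cA g h s) (cB g h s) a b
  have i1 : Dec (fun t x => bb u κ s t x * (BB u ux κ s t x).re - (BB u ux κ s t x).im * aa u κ s t x) :=
    ((db g h s).mul (dB g h s).re).sub ((dB g h s).im.mul (da g h s))
  have i2 : Dec (fun t x => aa u κ s t x * (BB u ux κ s t x).im - (BB u ux κ s t x).re * bb u κ s t x) :=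
    ((da g h s).mul (dB g h s).im).sub ((dB g h s).re.mul (db g h s))
  unfold NN
  have : NN u κ s b - NN u κ s a = (Inta (bb u κ s) (aa u κ s) b - Inta (bb u κ s) (aa u κ s) a) -
    (Inta (aa u κ s) (bb u κ s) b - Inta (aa u κ s) (bb u κ s) a) := by unfold NN; ring
  unfold NN at this
  rw [this, e1, e2, ← intervalIntegral.integral_sub (i1.continuous_integral.intervalIntegrable _ _)
    (i2.continuous_integral.intervalIntegrable _ _)]
  congr 1; ext t
  rw [B_int g h s, ← integral_sub (i1.integrable t) (i2.integrable t)]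
  congr 1; ext x; ring
end

end PartCn

noncomputable section PartFb
set_option linter.unusedSectionVars false
open scoped ComplexConjugate
open Filter Topology Set

lemma of_lint {ν : Measure ℝ} {F : ℝ → ℝ} (hF : Continuous F) (h0 : ∀ s, 0 ≤ F s) {B : ℝ} (hB : 0 ≤ B)
    (h : ∫⁻ s, ENNReal.ofReal (F s) ∂ν ≤ ENNReal.ofReal B) : Integrable F ν ∧ ∫ s, F s ∂ν ≤ B := by
  have i : Integrable F ν := by
    refine ⟨hF.aestronglyMeasurable, ?_⟩
    rw [hasFiniteIntegral_iff_ofReal (Eventually.of_forall h0)]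
    exact h.trans_lt ENNReal.ofReal_lt_top
  refine ⟨i, ?_⟩
  rw [← ofReal_integral_eq_lintegral_ofReal i (Eventually.of_forall h0)] at h
  exact (ENNReal.ofReal_le_ofReal_iff hB).1 h

lemma to_lint {ν : Measure ℝ} {F : ℝ → ℝ} (i : Integrable F ν) (h0 : ∀ s, 0 ≤ F s) {B : ℝ}
    (h : ∫ s, F s ∂ν ≤ B) : ∫⁻ s, ENNReal.ofReal (F s) ∂ν ≤ ENNReal.ofReal B := by
  rw [← ofReal_integral_eq_lintegral_ofReal i (Eventually.of_forall h0)]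
  exact ENNReal.ofReal_le_ofReal h

lemma EE_lint {ν : Measure ℝ} [SFinite ν] {l : ℝ} (hl : 0 < l) {G : ℝ → ℝ → ℝ}
    (hG : Continuous fun z : ℝ × ℝ => G z.1 z.2) (G0 : ∀ s y, 0 ≤ G s y) {K : ℝ} (GK : ∀ s y, G s y ≤ K)
    {H : ℝ → ℝ} (hH : Continuous H) (H0 : ∀ y, 0 ≤ H y) {L : ℝ} (HL : ∀ y, H y ≤ L)
    (hle : ∀ y, ∫⁻ s, ENNReal.ofReal (G s y) ∂ν ≤ ENNReal.ofReal (H y)) (x : ℝ) :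
    ∫⁻ s, ENNReal.ofReal (EE l (G s) x) ∂ν ≤ ENNReal.ofReal (EE l H x) := by
  have e : ∀ {F : ℝ → ℝ} {K : ℝ}, Continuous F → (∀ y, 0 ≤ F y) → (∀ y, F y ≤ K) →
      ENNReal.ofReal (EE l F x) = ∫⁻ r in Ioi (0 : ℝ), ENNReal.ofReal (Real.exp (-l * r) * F (x - r)) := by
    intro F K hF F0 FK
    refine ofReal_integral_eq_lintegral_ofReal (EE_int hl hF (K := K) (fun y => ?_) x)
      (Eventually.of_forall fun r => mul_nonneg (Real.exp_pos _).le (F0 _))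
    rw [abs_of_nonneg (F0 y)]; exact FK y
  have c : ∀ s, Continuous (G s) := fun s => hG.comp (by fun_prop : Continuous fun y : ℝ => (s, y))
  rw [e hH H0 HL]
  simp_rw [fun s => e (c s) (G0 s) (GK s)]
  rw [lintegral_lintegral_swap]
  · refine lintegral_mono fun r => ?_
    simp_rw [ENNReal.ofReal_mul (Real.exp_pos _).le]
    rw [lintegral_const_mul' _ _ ENNReal.ofReal_ne_top]
    gcongr
    exact hle _
  · refine Measurable.aemeasurable ?_
    refine Continuous.measurable ?_
    have : Continuous fun z : ℝ × ℝ => G z.1 (x - z.2) :=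
      hG.comp (by fun_prop : Continuous fun z : ℝ × ℝ => (z.1, x - z.2))
    unfold Function.uncurry
    exact ENNReal.continuous_ofReal.comp ((by fun_prop : Continuous fun z : ℝ × ℝ => Real.exp (-l * z.2)).mul this)

/-- `G` is continuous and integrable in `s` with `L¹` bound `B` -/
def SB (G : ℝ → ℝ → ℝ → ℝ) (B : ℝ → ℝ → ℝ) : Prop :=
  Continuous (fun z : ℝ × ℝ × ℝ => G z.1 z.2.1 z.2.2) ∧
    ∀ t x, Integrable (fun s => G s t x) ∧ ∫ s, |G s t x| ≤ B t x

lemma c3s {G : ℝ → ℝ → ℝ → ℝ} (h : Continuous (fun z : ℝ × ℝ × ℝ => G z.1 z.2.1 z.2.2)) (t x : ℝ) :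
    Continuous (fun s => G s t x) :=
  Continuous.comp (g := fun z : ℝ × ℝ × ℝ => G z.1 z.2.1 z.2.2) h (by fun_prop : Continuous fun s : ℝ => (s, t, x))

lemma SB.dom {G G' : ℝ → ℝ → ℝ → ℝ} {B c : ℝ → ℝ → ℝ} (h : SB G B)
    (hc : Continuous (fun z : ℝ × ℝ × ℝ => G' z.1 z.2.1 z.2.2)) (c0 : ∀ t x, 0 ≤ c t x)
    (hle : ∀ s t x, |G' s t x| ≤ c t x * |G s t x|) : SB G' (fun t x => c t x * B t x) := by
  refine ⟨hc, fun t x => ?_⟩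
  obtain ⟨i, hi⟩ := h.2 t x
  have i' : Integrable (fun s => c t x * |G s t x|) := i.norm.const_mul _
  have i2 : Integrable (fun s => G' s t x) :=
    i'.mono' (c3s hc t x).aestronglyMeasurable (Eventually.of_forall fun s => hle s t x)
  refine ⟨i2, ?_⟩
  calc ∫ s, |G' s t x| ≤ ∫ s, c t x * |G s t x| := integral_mono i2.norm i' fun s => hle s t x
    _ = c t x * ∫ s, |G s t x| := integral_const_mul _ _
    _ ≤ _ := mul_le_mul_of_nonneg_left hi (c0 t x)

lemma SB.add {G G' : ℝ → ℝ → ℝ → ℝ} {B B' : ℝ → ℝ → ℝ} (h : SB G B) (h' : SB G' B') :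
    SB (fun s t x => G s t x + G' s t x) (fun t x => B t x + B' t x) := by
  refine ⟨h.1.add h'.1, fun t x => ?_⟩
  obtain ⟨i, hi⟩ := h.2 t x
  obtain ⟨i', hi'⟩ := h'.2 t x
  refine ⟨i.add i', ?_⟩
  calc ∫ s, |G s t x + G' s t x| ≤ ∫ s, (|G s t x| + |G' s t x|) :=
        integral_mono (i.add i').norm (i.norm.add i'.norm) fun s => abs_add_le _ _
    _ = (∫ s, |G s t x|) + ∫ s, |G' s t x| := integral_add i.norm i'.norm
    _ ≤ _ := add_le_add hi hi'

lemma SB.mono {G : ℝ → ℝ → ℝ → ℝ} {B B' : ℝ → ℝ → ℝ} (h : SB G B) (hB : ∀ t x, B t x ≤ B' t x) : SB G B' :=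
  ⟨h.1, fun t x => ⟨(h.2 t x).1, (h.2 t x).2.trans (hB t x)⟩⟩

lemma SB.fub1 {G : ℝ → ℝ → ℝ → ℝ} {B : ℝ → ℝ → ℝ} (h : SB G B) (hB : Dec B) (t : ℝ) :
    Integrable (fun s => ∫ x, G s t x) ∧ Integrable (fun x => ∫ s, G s t x) ∧
      ∫ s, ∫ x, G s t x = ∫ x, ∫ s, G s t x := by
  have c : Continuous (fun z : ℝ × ℝ => G z.1 t z.2) :=
    Continuous.comp (g := fun z : ℝ × ℝ × ℝ => G z.1 z.2.1 z.2.2) h.1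
      (by fun_prop : Continuous fun z : ℝ × ℝ => (z.1, t, z.2))
  have i : Integrable (fun z : ℝ × ℝ => G z.1 t z.2) (volume.prod volume) := by
    rw [integrable_prod_iff' c.aestronglyMeasurable]
    refine ⟨Eventually.of_forall fun x => (h.2 t x).1, ?_⟩
    refine (hB.integrable t).mono' (c.norm.aestronglyMeasurable.prod_swap.integral_prod_right') (Eventually.of_forall fun x => ?_)
    rw [Real.norm_of_nonneg (integral_nonneg fun s => norm_nonneg _)]
    exact (h.2 t x).2
  exact ⟨i.integral_prod_left, i.integral_prod_right, integral_integral_swap i⟩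

lemma SB.fub2 {G : ℝ → ℝ → ℝ → ℝ} {B : ℝ → ℝ → ℝ} (h : SB G B) (hB : Dec B) {a b : ℝ} (hab : a ≤ b) :
    Integrable (fun s => ∫ t in a..b, ∫ x, G s t x) ∧
      IntervalIntegrable (fun t => ∫ x, ∫ s, G s t x) volume a b ∧
      ∫ s, ∫ t in a..b, ∫ x, G s t x = ∫ t in a..b, ∫ x, ∫ s, G s t x := by
  set ν := (volume.restrict (Ioc a b)).prod (volume : Measure ℝ) with hν
  have c := h.1
  have iB : Integrable (fun z : ℝ × ℝ => B z.1 z.2) ν := by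
    obtain ⟨C, hC, hb⟩ := hB.2 (max |a| |b|)
    have h1 : Integrable (fun z : ℝ × ℝ => C * (1 + z.2 ^ 2)⁻¹) ν :=
      (integrable_inv_one_add_sq.const_mul C).comp_snd (volume.restrict (Ioc a b))
    refine h1.mono' hB.1.aestronglyMeasurable ?_
    have e : ν = (volume.prod volume).restrict (Ioc a b ×ˢ univ) := by
      rw [hν, ← Measure.prod_restrict, Measure.restrict_univ]
    rw [e]
    filter_upwards [ae_restrict_mem (measurableSet_Ioc.prod MeasurableSet.univ)] with z hz
    refine hb z.1 z.2 ?_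
    obtain ⟨h1, h2⟩ := hz.1
    rw [abs_le]
    constructor
    · have := neg_abs_le a
      have := le_max_left |a| |b|
      linarith
    · have := le_abs_self b
      have := le_max_right |a| |b|
      linarith
  have i : Integrable (fun z : ℝ × ℝ × ℝ => G z.1 z.2.1 z.2.2) (volume.prod ν) := by
    rw [integrable_prod_iff' c.aestronglyMeasurable]
    refine ⟨Eventually.of_forall fun z => (h.2 z.1 z.2).1, ?_⟩
    refine iB.mono' (c.norm.aestronglyMeasurable.prod_swap.integral_prod_right') (Eventually.of_forall fun x => ?_)
    rw [Real.norm_of_nonneg (integral_nonneg fun s => norm_nonneg _)]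
    exact (h.2 x.1 x.2).2
  have h1 := i.integral_prod_left
  have h2 := i.integral_prod_right
  have h3 := integral_integral_swap (f := fun s (z : ℝ × ℝ) => G s z.1 z.2) i
  have e1 : (fun s => ∫ z, G s z.1 z.2 ∂ν) =ᵐ[volume] fun s => ∫ t in a..b, ∫ x, G s t x := by
    filter_upwards [i.prod_right_ae] with s hs
    rw [intervalIntegral.integral_of_le hab, ← integral_prod _ hs]
  have e2 : ∫ z, (∫ s, G s z.1 z.2) ∂ν = ∫ t in a..b, ∫ x, ∫ s, G s t x := by
    rw [intervalIntegral.integral_of_le hab, ← integral_prod _ h2]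
  refine ⟨h1.congr e1, ?_, ?_⟩
  · rw [intervalIntegrable_iff_integrableOn_Ioc_of_le hab]
    exact h2.integral_prod_left
  · rw [← e2, ← h3]
    exact integral_congr_ae e1.symm

end PartFb

noncomputable section PartBd
set_option linter.unusedSectionVars false
open scoped ComplexConjugate
open Filter Topology Set

/-- the half-line profile whose transform is `w1` -/
def gx (u : ℝ → ℝ → ℂ) (κ t x : ℝ) : ℝ → ℂ :=
  (Ioi (0 : ℝ)).indicator fun r => (Real.exp (-(2 * κ) * r) : ℂ) * u t (x - r)

lemma C3.cs {G : ℝ → ℝ → ℝ → ℂ} (h : C3 G) (t x : ℝ) : Continuous fun s => G s t x :=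
  Continuous.comp (g := fun z : ℝ × ℝ × ℝ => G z.1 z.2.1 z.2.2) h
    (by fun_prop : Continuous fun s : ℝ => (s, t, x))

section
variable {u : ℝ → ℝ → ℂ} {κ : ℝ} (h : Smal u κ)

lemma gx_meas (h : Smal u κ) (t x : ℝ) : AEStronglyMeasurable (gx u κ t x) volume := by
  have cu := h.cx t
  refine AEStronglyMeasurable.indicator ?_ measurableSet_Ioi
  exact Continuous.aestronglyMeasurable (by fun_prop)

lemma gx_le (h : Smal u κ) (t x : ℝ) {C : ℝ} (hC : ∀ x, ‖u t x‖ ≤ C) (r : ℝ) :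
    ‖gx u κ t x r‖ ≤ (Ioi (0 : ℝ)).indicator (fun r => Real.exp (-(2 * κ) * r) * C) r := by
  unfold gx
  by_cases hr : r ∈ Ioi (0 : ℝ)
  · rw [indicator_of_mem hr, indicator_of_mem hr, norm_mul, Complex.norm_real, Real.norm_eq_abs, abs_of_pos (Real.exp_pos _)]
    gcongr
    exact hC _
  · rw [indicator_of_notMem hr, indicator_of_notMem hr, norm_zero]

lemma gx_int (h : Smal u κ) (t x : ℝ) : Integrable (gx u κ t x) := by
  obtain ⟨C, hC0, hC⟩ := h.bd1 t
  have h1 : Integrable ((Ioi (0 : ℝ)).indicator (fun r => Real.exp (-(2 * κ) * r) * C)) :=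
    (integrable_indicator_iff measurableSet_Ioi).2 ((exp_int (by linarith [h.pos])).mul_const C)
  exact h1.mono' (gx_meas h t x) (Eventually.of_forall fun r => gx_le h t x hC r)

lemma gx_mem (h : Smal u κ) (t x : ℝ) : MemLp (gx u κ t x) 2 := by
  obtain ⟨C, hC0, hC⟩ := h.bd1 t
  rw [memLp_two_iff_integrable_sq_norm (gx_meas h t x)]
  refine ((gx_int h t x).norm.const_mul C).mono' ((gx_meas h t x).norm.pow 2) (Eventually.of_forall fun r => ?_)
  rw [Real.norm_of_nonneg (by positivity), pow_two]
  refine mul_le_mul_of_nonneg_right ?_ (norm_nonneg _)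
  refine (gx_le h t x hC r).trans ?_
  by_cases hr : r ∈ Ioi (0 : ℝ)
  · rw [indicator_of_mem hr]
    have : Real.exp (-(2 * κ) * r) ≤ 1 := by
      rw [Real.exp_le_one_iff]
      have := h.pos
      have : 0 < r := hr
      nlinarith [mul_pos h.pos this]
    nlinarith
  · rw [indicator_of_notMem hr]; exact hC0

lemma w1_eq (h : Smal u κ) (s t x : ℝ) : w1 u κ s t x = FT (gx u κ t x) s := by
  unfold w1 CE FT gx
  rw [← integral_indicator measurableSet_Ioi]
  congr 1; ext r
  by_cases hr : r ∈ Ioi (0 : ℝ)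
  · rw [indicator_of_mem hr, indicator_of_mem hr, ← mul_assoc]
    congr 1
    rw [ofReal_exp, ← Complex.exp_add]
    congr 1
    simp [lam]; ring
  · rw [indicator_of_notMem hr, indicator_of_notMem hr, mul_zero]

lemma w1_inner (h : Smal u κ) (t x y : ℝ) : ∫ s, w1 u κ s t x * conj (w1 u κ s t y) =
    Real.pi * ∫ r in Ioi (0 : ℝ), cexp ((-(4 * κ) : ℝ) * r) * (u t (x - r) * conj (u t (y - r))) := by
  simp_rw [w1_eq h]
  rw [FT_inner (gx_int h t y) (gx_mem h t y) (gx_int h t x) (gx_mem h t x)]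
  congr 1
  rw [← integral_indicator measurableSet_Ioi]
  congr 1; ext r
  unfold gx
  by_cases hr : r ∈ Ioi (0 : ℝ)
  · rw [indicator_of_mem hr, indicator_of_mem hr, indicator_of_mem hr]
    have : cexp ((-(4 * κ) : ℝ) * r) = (Real.exp (-(2 * κ) * r) : ℂ) * (Real.exp (-(2 * κ) * r) : ℂ) := by
      rw [ofReal_exp, ← Complex.exp_add]; congr 1; push_cast; ring
    rw [this, map_mul, conj_ofReal]; ring
  · rw [indicator_of_notMem hr, indicator_of_notMem hr, indicator_of_notMem hr, zero_mul]

lemma w1_sqint (h : Smal u κ) (t x : ℝ) : Integrable (fun s => p1 u κ s t x) := by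
  have := FT_integrable_sq (gx_int h t x) (gx_mem h t x)
  refine this.congr (Eventually.of_forall fun s => ?_)
  simp only [p1]
  rw [w1_eq h, normSq_eq_norm_sq]

lemma p1_int (h : Smal u κ) (t x : ℝ) : ∫ s, p1 u κ s t x = Real.pi * EE (4 * κ) (ff u t) x := by
  have := w1_inner h t x x
  simp_rw [mul_conj] at this
  rw [integral_complex_ofReal] at this
  have e : ∫ r in Ioi (0 : ℝ), cexp ((-(4 * κ) : ℝ) * r) * ((normSq (u t (x - r)) : ℝ) : ℂ) =
      ((EE (4 * κ) (ff u t) x : ℝ) : ℂ) := by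
    unfold EE
    rw [← integral_complex_ofReal]
    congr 1; ext r
    simp [ff]
  rw [e] at this
  exact_mod_cast this

lemma w1_sq_zero (h : Smal u κ) (t x : ℝ) : ∫ s, w1 u κ s t x ^ 2 = 0 := by
  set k : ℝ → ℂ := fun r => conj (gx u κ t x (-r)) with hk
  have k1 : Integrable k := by
    have := (gx_int h t x).comp_neg
    exact (Complex.conjLIE.toContinuousLinearEquiv.toContinuousLinearMap.integrable_comp this)
  have k2 : MemLp k 2 := by
    rw [memLp_two_iff_integrable_sq_norm k1.1]
    have := ((memLp_two_iff_integrable_sq_norm (gx_meas h t x)).1 (gx_mem h t x)).comp_neg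
    refine this.congr (Eventually.of_forall fun r => ?_)
    simp [hk]
  have e : ∀ s, conj (FT k s) = w1 u κ s t x := by
    intro s
    rw [w1_eq h]
    unfold FT
    rw [← integral_conj, ← integral_neg_eq_self]
    congr 1; ext r
    have c2 : conj (2 : ℂ) = 2 := map_ofNat _ 2
    simp [hk, ← Complex.exp_conj, c2]
  have := FT_inner k1 k2 (gx_int h t x) (gx_mem h t x)
  simp_rw [e, ← w1_eq h] at this
  simp_rw [pow_two]
  rw [this]
  have z : ∀ r, gx u κ t x r * conj (k r) = 0 := by
    intro r
    simp only [hk, conj_conj, gx]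
    by_cases hr : r ∈ Ioi (0 : ℝ)
    · rw [indicator_of_notMem (a := -r), mul_zero]
      simp only [mem_Ioi] at hr ⊢; linarith
    · rw [indicator_of_notMem hr, zero_mul]
  simp [z]

lemma w1_cs (h : Smal u κ) (t x : ℝ) : Continuous fun s => w1 u κ s t x := by
  have : C3 (w1 u κ) := by
    refine CE_cont3 h.pos (h.c3u) fun R => ?_
    obtain ⟨C, hC⟩ := h.bd R
    exact ⟨C, fun _ t x ht => hC t x ht⟩
  exact this.cs t x

lemma a1_sq_int (h : Smal u κ) (t x : ℝ) : Integrable (fun s => a1 u κ s t x ^ 2) ∧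
    2 * ∫ s, a1 u κ s t x ^ 2 = ff u t x * (Real.pi * EE (4 * κ) (ff u t) x) := by
  have i1 := w1_sqint h t x
  have i2 : Integrable (fun s => w1 u κ s t x ^ 2) := by
    refine i1.mono' ((w1_cs h t x).pow 2).aestronglyMeasurable (Eventually.of_forall fun s => ?_)
    simp [p1, normSq_eq_norm_sq]
  have i3 : Integrable (fun s => (conj (u t x) ^ 2 * w1 u κ s t x ^ 2).re) := (i2.const_mul _).re
  have z : ∫ s, (conj (u t x) ^ 2 * w1 u κ s t x ^ 2).re = 0 := by
    have := integral_re (i2.const_mul (conj (u t x) ^ 2))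
    simp only [RCLike.re_to_complex] at this
    rw [this, integral_const_mul, w1_sq_zero h]; simp
  have e : ∀ s, a1 u κ s t x ^ 2 = 1 / 2 * (ff u t x * p1 u κ s t x) +
      1 / 2 * (conj (u t x) ^ 2 * w1 u κ s t x ^ 2).re := by
    intro s
    simp [a1, ff, p1, normSq_apply, pow_two]; ring
  simp_rw [e]
  refine ⟨((i1.const_mul _).const_mul _).add (i3.const_mul _), ?_⟩
  rw [integral_add ((i1.const_mul _).const_mul _) (i3.const_mul _), integral_const_mul, integral_const_mul,
    integral_const_mul, z, p1_int h]
  ring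
end

end PartBd

noncomputable section PartBe
set_option linter.unusedSectionVars false
open scoped ComplexConjugate
open Filter Topology Set

lemma Dec.bd1 {E : Type*} [NormedAddCommGroup E] {F : ℝ → ℝ → E} (h : Dec F) (t : ℝ) : ∃ K : ℝ, ∀ x, ‖F t x‖ ≤ K := by
  obtain ⟨C, -, hC⟩ := h.bdc.2 |t|
  exact ⟨C, fun x => hC t x le_rfl⟩

/-- smeared density -/
def E0 (u : ℝ → ℝ → ℂ) (κ t x : ℝ) : ℝ := EE (κ / 2) (ff u t) x
/-- pointwise majorant of the Riccati function -/
def W0 (u : ℝ → ℝ → ℂ) (κ t x : ℝ) : ℝ := 5 / 4 * EE (2 * κ) (fun y => ‖u t y‖) x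
/-- difference from the first iterate -/
def DD (u : ℝ → ℝ → ℂ) (κ s t x : ℝ) : ℝ := ‖ww u κ s t x - w1 u κ s t x‖

structure St (u ux uxx ut : ℝ → ℝ → ℂ) (κ M : ℝ) : Prop where
  g : Good u ux uxx ut
  h : Smal u κ
  M0 : 0 < M
  hM : ∀ t, ∫ x, ff u t x = M
  hk : 64 * M ≤ κ

section
variable {u ux uxx ut : ℝ → ℝ → ℂ} {κ M : ℝ} (H : St u ux uxx ut κ M)

lemma St.pos (H : St u ux uxx ut κ M) : 0 < κ := H.h.pos

lemma St.ff_eq_norm (H : St u ux uxx ut κ M) (t x : ℝ) : ff u t x = ‖u t x‖ ^ 2 := normSq_eq_norm_sq _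

lemma St.dE (H : St u ux uxx ut κ M) : Dec (E0 u κ) := H.g.df.EE' (fun t x => ff_nonneg u t x) (by linarith [H.pos])

lemma St.E_nonneg (H : St u ux uxx ut κ M) (t x : ℝ) : 0 ≤ E0 u κ t x := EE_nonneg (ff_nonneg u t) x

lemma St.E_le (H : St u ux uxx ut κ M) (t x : ℝ) : E0 u κ t x ≤ M := by
  rw [← H.hM t]
  exact EE_le_int (by linarith [H.pos]) (ff_nonneg u t) (H.g.df.integrable t) x

lemma St.E_shift (H : St u ux uxx ut κ M) (t x r : ℝ) (hr : 0 < r) : E0 u κ t (x - r) ≤ Real.exp (κ / 2 * r) * E0 u κ t x := by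
  obtain ⟨K, hK⟩ := H.g.df.bd1 t
  exact EE_shift (by linarith [H.pos]) (ff_nonneg u t) (H.g.df.cx t) hK x r hr.le

lemma St.EE_E2 (H : St u ux uxx ut κ M) (t x : ℝ) : EE (7 * κ / 2) (fun y => E0 u κ t y ^ 2) x ≤ 2 / (5 * κ) * E0 u κ t x ^ 2 := by
  have hκ := H.pos
  obtain ⟨K, hK⟩ := H.dE.bd1 t
  have := EE_le_exp (l := 7 * κ / 2) (m := κ) (c := E0 u κ t x ^ 2) (by linarith) (by linarith)
    (g := fun y => E0 u κ t y ^ 2) (fun y => sq_nonneg _) ((H.dE.cx t).pow 2) (K := K ^ 2) (fun y => ?_) x (fun r hr => ?_)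
  · refine this.trans (le_of_eq ?_)
    have : κ ≠ 0 := hκ.ne'
    have : 7 * κ / 2 - κ = 5 * κ / 2 := by ring
    rw [this]; field_simp
  · rw [abs_pow]; exact pow_le_pow_left₀ (abs_nonneg _) (hK y) 2
  · have h1 := H.E_shift t x r hr
    have h2 : Real.exp (κ * r) = Real.exp (κ / 2 * r) ^ 2 := by rw [← Real.exp_nat_mul]; congr 1; push_cast; ring
    rw [h2, ← mul_pow]
    exact pow_le_pow_left₀ (H.E_nonneg _ _) h1 2

lemma St.dW (H : St u ux uxx ut κ M) : Dec (W0 u κ) :=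
  Dec.cmul (5 / 4) (Dec.EE' H.g.du.norm (fun t x => norm_nonneg (u t x)) (by linarith [H.pos] : 0 < 2 * κ))

lemma St.W_nonneg (H : St u ux uxx ut κ M) (t x : ℝ) : 0 ≤ W0 u κ t x := mul_nonneg (by norm_num) (EE_nonneg (fun _ => norm_nonneg _) x)

lemma St.w_le (H : St u ux uxx ut κ M) (s t x : ℝ) : ‖ww u κ s t x‖ ≤ W0 u κ t x := H.h.w_le s t x

/-- weighted Cauchy-Schwarz against `|u|` -/
lemma St.cs_u (H : St u ux uxx ut κ M) (t x : ℝ) {k : ℝ → ℝ} (hk : Continuous k) {L : ℝ} (hL : ∀ x, |k x| ≤ L) :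
    (EE (2 * κ) (fun y => ‖u t y‖ * k y) x) ^ 2 ≤ E0 u κ t x * EE (7 * κ / 2) (fun y => k y ^ 2) x := by
  have hκ := H.pos
  obtain ⟨K, hK0, hK⟩ := H.h.bd1 t
  have := EE_cs (l := 2 * κ) (a := κ / 2) (b := 7 * κ / 2) (by linarith) (by linarith) (by ring)
    (H.h.cx t).norm hk (K := K) (fun x => by simpa using hK x) hL x
  have e : (fun y => ‖u t y‖ ^ 2) = ff u t := by ext y; rw [H.ff_eq_norm]
  rw [e] at this
  exact this

lemma St.W_sq (H : St u ux uxx ut κ M) (t x : ℝ) : W0 u κ t x ^ 2 ≤ E0 u κ t x / κ := by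
  have hκ := H.pos
  have := H.cs_u t x (k := fun _ => 1) continuous_const (L := 1) (fun _ => by simp)
  simp only [mul_one, one_pow] at this
  rw [EE_const (by linarith)] at this
  have h2 := H.E_nonneg t x
  have e : 1 / (7 * κ / 2) = 2 / 7 * (1 / κ) := by field_simp
  have h3 : 0 ≤ E0 u κ t x * (1 / κ) := by positivity
  rw [e] at this
  have : W0 u κ t x ^ 2 = 25 / 16 * EE (2 * κ) (fun y => ‖u t y‖) x ^ 2 := by unfold W0; ring
  have e2 : E0 u κ t x / κ = E0 u κ t x * (1 / κ) := by ring
  rw [this, e2]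
  nlinarith

lemma St.p_le_W (H : St u ux uxx ut κ M) (s t x : ℝ) : pp u κ s t x ≤ W0 u κ t x ^ 2 := by
  unfold pp
  rw [normSq_eq_norm_sq]
  exact pow_le_pow_left₀ (norm_nonneg _) (H.w_le s t x) 2

lemma St.p_le (H : St u ux uxx ut κ M) (s t x : ℝ) : pp u κ s t x ≤ E0 u κ t x / κ := (H.p_le_W s t x).trans (H.W_sq t x)

lemma St.p_nn (H : St u ux uxx ut κ M) (s t x : ℝ) : 0 ≤ pp u κ s t x := pp_nonneg s t x

lemma St.D_le (H : St u ux uxx ut κ M) (s t x : ℝ) : DD u κ s t x ≤ EE (2 * κ) (fun y => ‖u t y‖ * pp u κ s t y) x := by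
  obtain ⟨C, hC0, hC⟩ := H.h.bd1 t
  unfold DD w1
  have hl : (lam κ s).re < 0 := by rw [lam_re]; linarith [H.pos]
  rw [H.h.w_fix, ← CE_sub hl (H.h.w_nl_c s t) (K := 5 / 4 * C) (fun y => ?_) (H.h.cx t) hC]
  · refine (CE_norm_le x).trans (le_of_eq ?_)
    rw [lam_re, neg_neg]
    congr 1; ext y
    simp [pp, normSq_eq_norm_sq]
  · exact (nl_bd (H.h.w_bd s t _)).trans (mul_le_mul_of_nonneg_left (hC y) (by norm_num))

lemma St.D_nn (H : St u ux uxx ut κ M) (s t x : ℝ) : 0 ≤ DD u κ s t x := norm_nonneg _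

lemma St.D_sq (H : St u ux uxx ut κ M) (s t x : ℝ) : DD u κ s t x ^ 2 ≤ E0 u κ t x * EE (7 * κ / 2) (fun y => E0 u κ t y / κ * pp u κ s t y) x := by
  have hκ := H.pos
  have h1 := H.cs_u t x (k := pp u κ s t) ((dp H.g H.h s).cx t) (L := 1 / 4)
    (fun y => by rw [abs_of_nonneg (H.p_nn s t y)]; exact H.h.pp_le s t y)
  have h2 := pow_le_pow_left₀ (H.D_nn s t x) (H.D_le s t x) 2
  refine h2.trans (h1.trans (mul_le_mul_of_nonneg_left ?_ (H.E_nonneg t x)))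
  have cp := (dp H.g H.h s).cx t
  have ce := H.dE.cx t
  have bp : ∀ y, |pp u κ s t y| ≤ 1 / 4 := fun y => by rw [abs_of_nonneg (H.p_nn s t y)]; exact H.h.pp_le s t y
  refine EE_mono (by linarith) (g := fun y => pp u κ s t y ^ 2) (by fun_prop) (K := (1 / 4) ^ 2) (fun y => ?_) (by fun_prop) (L := M / κ * (1 / 4)) (fun y => ?_) x (fun r hr => ?_)
  · rw [abs_pow]; exact pow_le_pow_left₀ (abs_nonneg _) (bp y) 2
  · rw [abs_mul]
    refine mul_le_mul ?_ (bp y) (abs_nonneg _) (div_nonneg H.M0.le hκ.le)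
    rw [abs_of_nonneg (div_nonneg (H.E_nonneg t y) hκ.le)]
    exact div_le_div_of_nonneg_right (H.E_le t y) hκ.le
  · rw [pow_two]
    exact mul_le_mul_of_nonneg_right (H.p_le s t _) (H.p_nn s t _)

lemma St.c_p (H : St u ux uxx ut κ M) : Continuous (fun z : ℝ × ℝ × ℝ => pp u κ z.1 z.2.1 z.2.2) := by
  have h1 : C3 (ww u κ) := H.h.w_c3
  unfold C3 at h1
  unfold pp
  exact Complex.continuous_normSq.comp h1

lemma St.c_w1 (H : St u ux uxx ut κ M) : Continuous (fun z : ℝ × ℝ × ℝ => w1 u κ z.1 z.2.1 z.2.2) := w1_c3 H.g H.h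

lemma St.c_ww (H : St u ux uxx ut κ M) : Continuous (fun z : ℝ × ℝ × ℝ => ww u κ z.1 z.2.1 z.2.2) := H.h.w_c3

lemma St.c_u (H : St u ux uxx ut κ M) : Continuous (fun z : ℝ × ℝ × ℝ => u z.2.1 z.2.2) := H.h.c3u

lemma St.c_D (H : St u ux uxx ut κ M) : Continuous (fun z : ℝ × ℝ × ℝ => DD u κ z.1 z.2.1 z.2.2) := (H.c_ww.sub H.c_w1).norm

lemma St.E_anti (H : St u ux uxx ut κ M) (t x : ℝ) : EE (4 * κ) (ff u t) x ≤ E0 u κ t x := by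
  have hκ := H.pos
  obtain ⟨K, hK⟩ := H.g.df.bd1 t
  exact EE_anti (by linarith) (by linarith) (ff_nonneg u t) (H.g.df.cx t) hK x

end

end PartBe

noncomputable section PartBf
set_option linter.unusedSectionVars false
open scoped ComplexConjugate
open Filter Topology Set

section
variable {u ux uxx ut : ℝ → ℝ → ℂ} {κ M : ℝ} (H : St u ux uxx ut κ M)

lemma St.cp2 (H : St u ux uxx ut κ M) (t : ℝ) : Continuous (fun z : ℝ × ℝ => pp u κ z.1 t z.2) := by
  have h := H.c_p
  generalize pp u κ = G at h
  exact Continuous.comp (g := fun z : ℝ × ℝ × ℝ => G z.1 z.2.1 z.2.2) h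
    (by fun_prop : Continuous fun z : ℝ × ℝ => (z.1, t, z.2))

lemma St.p_bd (H : St u ux uxx ut κ M) (s t y : ℝ) : |pp u κ s t y| ≤ 1 / 4 := by
  rw [abs_of_nonneg (H.p_nn s t y)]; exact H.h.pp_le s t y

lemma St.Ek_nn (H : St u ux uxx ut κ M) (t y : ℝ) : 0 ≤ E0 u κ t y / κ := div_nonneg (H.E_nonneg t y) H.pos.le

lemma St.Ek_le (H : St u ux uxx ut κ M) (t y : ℝ) : E0 u κ t y / κ ≤ M / κ := div_le_div_of_nonneg_right (H.E_le t y) H.pos.le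

/-- a bound on the `s`-integral of `p` propagates to the quadratic error -/
lemma St.D_lint (H : St u ux uxx ut κ M) {ν : Measure ℝ} [SFinite ν] (t : ℝ) {K : ℝ} (K0 : 0 ≤ K)
    (hK : ∀ x, ∫⁻ s, ENNReal.ofReal (pp u κ s t x) ∂ν ≤ ENNReal.ofReal (K * E0 u κ t x)) (x : ℝ) :
    ∫⁻ s, ENNReal.ofReal (DD u κ s t x ^ 2) ∂ν ≤ ENNReal.ofReal (K * (2 / 5) * E0 u κ t x ^ 3 / κ ^ 2) := by
  have hκ := H.pos
  have ce := H.dE.cx t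
  have c2 := H.cp2 t
  have h1 : ∫⁻ s, ENNReal.ofReal (EE (7 * κ / 2) (fun y => E0 u κ t y / κ * pp u κ s t y) x) ∂ν ≤
      ENNReal.ofReal (EE (7 * κ / 2) (fun y => K / κ * E0 u κ t y ^ 2) x) := by
    refine EE_lint (G := fun s y => E0 u κ t y / κ * pp u κ s t y) (by linarith) ?_
      (fun s y => mul_nonneg (H.Ek_nn t y) (H.p_nn s t y)) (K := M / κ * (1 / 4)) (fun s y => ?_)
      (by fun_prop) (fun y => by positivity) (L := K / κ * M ^ 2) (fun y => ?_) (fun y => ?_) x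
    · exact ((ce.comp continuous_snd).div_const κ).mul c2
    · exact mul_le_mul (H.Ek_le t y) (H.h.pp_le s t y) (H.p_nn s t y) (div_nonneg H.M0.le hκ.le)
    · have := pow_le_pow_left₀ (H.E_nonneg t y) (H.E_le t y) 2
      exact mul_le_mul_of_nonneg_left this (by positivity)
    · simp_rw [ENNReal.ofReal_mul (H.Ek_nn t y)]
      rw [lintegral_const_mul' _ _ ENNReal.ofReal_ne_top]
      refine (mul_le_mul_right (hK y) _).trans (le_of_eq ?_)
      rw [← ENNReal.ofReal_mul (H.Ek_nn t y)]
      congr 1; ring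
  calc ∫⁻ s, ENNReal.ofReal (DD u κ s t x ^ 2) ∂ν
      ≤ ∫⁻ s, ENNReal.ofReal (E0 u κ t x) *
          ENNReal.ofReal (EE (7 * κ / 2) (fun y => E0 u κ t y / κ * pp u κ s t y) x) ∂ν := by
        refine lintegral_mono fun s => ?_
        rw [← ENNReal.ofReal_mul (H.E_nonneg t x)]
        exact ENNReal.ofReal_le_ofReal (H.D_sq s t x)
    _ = ENNReal.ofReal (E0 u κ t x) *
          ∫⁻ s, ENNReal.ofReal (EE (7 * κ / 2) (fun y => E0 u κ t y / κ * pp u κ s t y) x) ∂ν :=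
        lintegral_const_mul' _ _ ENNReal.ofReal_ne_top
    _ ≤ ENNReal.ofReal (E0 u κ t x) * ENNReal.ofReal (EE (7 * κ / 2) (fun y => K / κ * E0 u κ t y ^ 2) x) :=
        mul_le_mul_right h1 _
    _ = ENNReal.ofReal (E0 u κ t x * (K / κ * EE (7 * κ / 2) (fun y => E0 u κ t y ^ 2) x)) := by
        rw [← ENNReal.ofReal_mul (H.E_nonneg t x), EE_const_mul]
    _ ≤ _ := by
        refine ENNReal.ofReal_le_ofReal ?_
        have h2 := H.EE_E2 t x
        have e0 := H.E_nonneg t x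
        calc _ ≤ E0 u κ t x * (K / κ * (2 / (5 * κ) * E0 u κ t x ^ 2)) := by gcongr
          _ = _ := by field_simp

lemma St.p_step (H : St u ux uxx ut κ M) {ν : Measure ℝ} [SFinite ν] (hν : ν ≤ volume) (t : ℝ) {K : ℝ} (K0 : 0 ≤ K)
    (hK : ∀ x, ∫⁻ s, ENNReal.ofReal (pp u κ s t x) ∂ν ≤ ENNReal.ofReal (K * E0 u κ t x)) (x : ℝ) :
    ∫⁻ s, ENNReal.ofReal (pp u κ s t x) ∂ν ≤ ENNReal.ofReal ((2 * Real.pi + K / 2) * E0 u κ t x) := by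
  have hκ := H.pos
  have e0 := H.E_nonneg t x
  have pi0 := Real.pi_pos
  have hp : ∀ s, 0 ≤ p1 u κ s t x := fun s => normSq_nonneg _
  have c1 : Continuous (fun s => p1 u κ s t x) := Complex.continuous_normSq.comp (w1_cs H.h t x)
  have h1 : ∫⁻ s, ENNReal.ofReal (p1 u κ s t x) ∂ν ≤ ENNReal.ofReal (Real.pi * E0 u κ t x) := by
    refine (lintegral_mono' hν le_rfl).trans ?_
    refine to_lint (w1_sqint H.h t x) hp ?_
    rw [p1_int H.h]
    exact mul_le_mul_of_nonneg_left (H.E_anti t x) pi0.le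
  have h2 := H.D_lint t K0 hK x
  calc ∫⁻ s, ENNReal.ofReal (pp u κ s t x) ∂ν
      ≤ ∫⁻ s, (ENNReal.ofReal 2 * ENNReal.ofReal (p1 u κ s t x) + ENNReal.ofReal 2 * ENNReal.ofReal (DD u κ s t x ^ 2)) ∂ν := by
        refine lintegral_mono fun s => ?_
        rw [← ENNReal.ofReal_mul (by norm_num), ← ENNReal.ofReal_mul (by norm_num),
          ← ENNReal.ofReal_add (by have := hp s; positivity) (by positivity)]
        refine ENNReal.ofReal_le_ofReal ?_
        simp only [pp, p1, DD, normSq_eq_norm_sq]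
        have : ‖ww u κ s t x‖ ≤ ‖w1 u κ s t x‖ + ‖ww u κ s t x - w1 u κ s t x‖ := by
          simpa using norm_add_le (w1 u κ s t x) (ww u κ s t x - w1 u κ s t x)
        nlinarith [sq_nonneg (‖w1 u κ s t x‖ - ‖ww u κ s t x - w1 u κ s t x‖), norm_nonneg (ww u κ s t x)]
    _ = ENNReal.ofReal 2 * (∫⁻ s, ENNReal.ofReal (p1 u κ s t x) ∂ν) + ENNReal.ofReal 2 * ∫⁻ s, ENNReal.ofReal (DD u κ s t x ^ 2) ∂ν := by
        rw [lintegral_add_left (by fun_prop), lintegral_const_mul' _ _ ENNReal.ofReal_ne_top,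
          lintegral_const_mul' _ _ ENNReal.ofReal_ne_top]
    _ ≤ ENNReal.ofReal 2 * ENNReal.ofReal (Real.pi * E0 u κ t x) +
        ENNReal.ofReal 2 * ENNReal.ofReal (K * (2 / 5) * E0 u κ t x ^ 3 / κ ^ 2) := by gcongr
    _ ≤ _ := by
        rw [← ENNReal.ofReal_mul (by norm_num), ← ENNReal.ofReal_mul (by norm_num),
          ← ENNReal.ofReal_add (by positivity) (by positivity)]
        refine ENNReal.ofReal_le_ofReal ?_
        have q : E0 u κ t x / κ ≤ 1 / 64 := by
          rw [div_le_iff₀ hκ]; linarith [H.E_le t x, H.hk]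
        have q2 : (E0 u κ t x / κ) ^ 2 ≤ 1 / 2 := by
          nlinarith [H.Ek_nn t x]
        have : K * (2 / 5) * E0 u κ t x ^ 3 / κ ^ 2 = K * (2 / 5) * E0 u κ t x * (E0 u κ t x / κ) ^ 2 := by
          field_simp
        rw [this]
        nlinarith [mul_nonneg K0 e0]

lemma St.p_lint_S (H : St u ux uxx ut κ M) (t S : ℝ) (hS : 0 ≤ S) (x : ℝ) :
    ∫⁻ s in Icc (-S) S, ENNReal.ofReal (pp u κ s t x) ≤ ENNReal.ofReal (4 * Real.pi * E0 u κ t x) := by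
  have hκ := H.pos
  have pi0 := Real.pi_pos
  have key : ∀ n : ℕ, ∀ x, ∫⁻ s in Icc (-S) S, ENNReal.ofReal (pp u κ s t x) ≤
      ENNReal.ofReal ((4 * Real.pi + (2 * S / κ) * (1 / 2) ^ n) * E0 u κ t x) := by
    intro n
    induction n with
    | zero =>
      intro x
      calc ∫⁻ s in Icc (-S) S, ENNReal.ofReal (pp u κ s t x)
          ≤ ∫⁻ s in Icc (-S) S, ENNReal.ofReal (E0 u κ t x / κ) :=
            lintegral_mono fun s => ENNReal.ofReal_le_ofReal (H.p_le s t x)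
        _ = ENNReal.ofReal (E0 u κ t x / κ) * ENNReal.ofReal (S - -S) := by
            rw [setLIntegral_const, Real.volume_Icc]
        _ = ENNReal.ofReal (E0 u κ t x / κ * (2 * S)) := by
            rw [← ENNReal.ofReal_mul (H.Ek_nn t x)]; congr 2; ring
        _ ≤ _ := by
            refine ENNReal.ofReal_le_ofReal ?_
            have e0 := H.E_nonneg t x
            have : E0 u κ t x / κ * (2 * S) = 2 * S / κ * E0 u κ t x := by ring
            rw [this, pow_zero, mul_one, add_mul]
            have : 0 ≤ 4 * Real.pi * E0 u κ t x := by positivity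
            linarith
    | succ n ih =>
      intro x
      refine (H.p_step Measure.restrict_le_self t (by positivity) ih x).trans (le_of_eq ?_)
      congr 2; rw [pow_succ]; ring
  have lim : Tendsto (fun n : ℕ => ENNReal.ofReal ((4 * Real.pi + (2 * S / κ) * (1 / 2) ^ n) * E0 u κ t x)) atTop
      (𝓝 (ENNReal.ofReal ((4 * Real.pi + (2 * S / κ) * 0) * E0 u κ t x))) := by
    refine ENNReal.tendsto_ofReal (Tendsto.mul_const _ (Tendsto.const_add _ (Tendsto.const_mul _ ?_)))
    exact tendsto_pow_atTop_nhds_zero_of_lt_one (by norm_num) (by norm_num)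
  rw [mul_zero, add_zero] at lim
  exact ge_of_tendsto' lim fun n => key n x

lemma St.p_lint (H : St u ux uxx ut κ M) (t x : ℝ) :
    ∫⁻ s, ENNReal.ofReal (pp u κ s t x) ≤ ENNReal.ofReal (4 * Real.pi * E0 u κ t x) := by
  have cov : AECover (volume : Measure ℝ) atTop (fun n : ℕ => Icc (-(n : ℝ)) n) :=
    aecover_Icc (tendsto_neg_atTop_atBot.comp tendsto_natCast_atTop_atTop) tendsto_natCast_atTop_atTop
  have cp := c3s H.c_p t x
  have := cov.lintegral_tendsto_of_countably_generated (f := fun s => ENNReal.ofReal (pp u κ s t x))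
    (by fun_prop)
  exact le_of_tendsto' this fun n => H.p_lint_S t n (Nat.cast_nonneg n) x

lemma St.sb_p (H : St u ux uxx ut κ M) : SB (pp u κ) (fun t x => 4 * Real.pi * E0 u κ t x) := by
  refine ⟨H.c_p, fun t x => ?_⟩
  have e0 := H.E_nonneg t x
  have pi0 := Real.pi_pos
  have := of_lint (c3s H.c_p t x) (fun s => H.p_nn s t x) (by positivity) (H.p_lint t x)
  refine ⟨this.1, ?_⟩
  simp_rw [abs_of_nonneg (H.p_nn _ t x)]
  exact this.2

lemma St.sb_D2 (H : St u ux uxx ut κ M) : SB (fun s t x => DD u κ s t x ^ 2) (fun t x => 2 * Real.pi * E0 u κ t x ^ 3 / κ ^ 2) := by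
  refine ⟨H.c_D.pow 2, fun t x => ?_⟩
  have e0 := H.E_nonneg t x
  have pi0 := Real.pi_pos
  have hκ := H.pos
  have := of_lint ((c3s H.c_D t x).pow 2) (fun s => sq_nonneg _) (by positivity) (H.D_lint t (by positivity) (H.p_lint t) x)
  refine ⟨this.1, ?_⟩
  simp_rw [abs_of_nonneg (sq_nonneg (DD u κ _ t x))]
  refine this.2.trans ?_
  rw [mul_div_assoc, mul_div_assoc]
  have : 0 ≤ E0 u κ t x ^ 3 / κ ^ 2 := by positivity
  nlinarith

/-- majorant for the `s`-integral of `D` -/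
def B1 (u : ℝ → ℝ → ℂ) (κ t x : ℝ) : ℝ := EE (2 * κ) (fun y => ‖u t y‖ * (4 * Real.pi * E0 u κ t y)) x

lemma St.dB1 (H : St u ux uxx ut κ M) : Dec (B1 u κ) := by
  have hκ := H.pos
  have pi0 := Real.pi_pos
  exact Dec.EE' (H.g.du.norm.mul (Dec.cmul (4 * Real.pi) H.dE)) (fun t x => by
    have := H.E_nonneg t x; positivity) (by linarith : 0 < 2 * κ)

lemma St.B1_nn (H : St u ux uxx ut κ M) (t x : ℝ) : 0 ≤ B1 u κ t x := by
  have pi0 := Real.pi_pos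
  exact EE_nonneg (fun y => by have := H.E_nonneg t y; positivity) x

lemma St.B1_sq (H : St u ux uxx ut κ M) (t x : ℝ) : B1 u κ t x ^ 2 ≤ 7 * Real.pi ^ 2 * E0 u κ t x ^ 3 / κ := by
  have hκ := H.pos
  have pi0 := Real.pi_pos
  have e0 := H.E_nonneg t x
  have ce := H.dE.cx t
  have h1 := H.cs_u t x (k := fun y => 4 * Real.pi * E0 u κ t y) (by fun_prop) (L := 4 * Real.pi * M) (fun y => by
    rw [abs_of_nonneg (by have := H.E_nonneg t y; positivity)]
    exact mul_le_mul_of_nonneg_left (H.E_le t y) (by positivity))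
  have e : (fun y => (4 * Real.pi * E0 u κ t y) ^ 2) = fun y => 16 * Real.pi ^ 2 * E0 u κ t y ^ 2 := by
    ext y; ring
  rw [e, EE_const_mul] at h1
  refine h1.trans ?_
  have h2 := H.EE_E2 t x
  calc _ ≤ E0 u κ t x * (16 * Real.pi ^ 2 * (2 / (5 * κ) * E0 u κ t x ^ 2)) := by gcongr
    _ = (32 / 5) * (Real.pi ^ 2 * E0 u κ t x ^ 3 / κ) := by field_simp; ring
    _ ≤ 7 * (Real.pi ^ 2 * E0 u κ t x ^ 3 / κ) := by
      have : 0 ≤ Real.pi ^ 2 * E0 u κ t x ^ 3 / κ := by positivity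
      linarith
    _ = _ := by ring

lemma St.sb_D (H : St u ux uxx ut κ M) : SB (DD u κ) (B1 u κ) := by
  refine ⟨H.c_D, fun t x => ?_⟩
  have pi0 := Real.pi_pos
  have hκ := H.pos
  have ce := H.dE.cx t
  have c2 := H.cp2 t
  have cu := H.h.cx t
  obtain ⟨C, hC0, hC⟩ := H.h.bd1 t
  have h1 : ∫⁻ s, ENNReal.ofReal (EE (2 * κ) (fun y => ‖u t y‖ * pp u κ s t y) x) ≤ ENNReal.ofReal (B1 u κ t x) := by
    refine EE_lint (G := fun s y => ‖u t y‖ * pp u κ s t y) (by linarith) ?_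
      (fun s y => mul_nonneg (norm_nonneg _) (H.p_nn s t y)) (K := C * (1 / 4)) (fun s y => ?_)
      (by fun_prop) (fun y => by have := H.E_nonneg t y; positivity) (L := C * (4 * Real.pi * M)) (fun y => ?_) (fun y => ?_) x
    · exact (cu.norm.comp continuous_snd).mul c2
    · exact mul_le_mul (hC y) (H.h.pp_le s t y) (H.p_nn s t y) hC0
    · have := H.E_nonneg t y
      exact mul_le_mul (hC y) (mul_le_mul_of_nonneg_left (H.E_le t y) (by positivity)) (by positivity) hC0
    · simp_rw [ENNReal.ofReal_mul (norm_nonneg (u t y))]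
      rw [lintegral_const_mul' _ _ ENNReal.ofReal_ne_top]
      exact (mul_le_mul_right (H.p_lint t y) _)
  have := of_lint (c3s H.c_D t x) (fun s => H.D_nn s t x) (H.B1_nn t x)
    ((lintegral_mono fun s => ENNReal.ofReal_le_ofReal (H.D_le s t x)).trans h1)
  refine ⟨this.1, ?_⟩
  simp_rw [abs_of_nonneg (H.D_nn _ t x)]
  exact this.2
end

end PartBf

noncomputable section PartBg
set_option linter.unusedSectionVars false
open scoped ComplexConjugate
open Filter Topology Set

lemma Dec.EE_intg {F : ℝ → ℝ → ℝ} (h : Dec F) (h0 : ∀ t x, 0 ≤ F t x) {l : ℝ} (hl : 0 < l) (t : ℝ) :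
    ∫ x, EE l (F t) x = (∫ x, F t x) / l := by
  have d := h.EE' h0 hl
  obtain ⟨K, hK⟩ := h.bd1 t
  have := Dec.int_deriv d (h.sub (Dec.cmul l d)) t (fun x => EE_hasDerivAt hl (h.cx t) hK x)
  rw [integral_sub (h.integrable t) ((Dec.cmul l d).integrable t), integral_const_mul] at this
  field_simp; linarith

lemma Dec.Inta_le {ρ1 ρ2 : ℝ → ℝ → ℝ} (h1 : Dec ρ1) (h2 : Dec ρ2) (t : ℝ) :
    |Inta ρ1 ρ2 t| ≤ (∫ x, |ρ1 t x|) * ∫ x, |ρ2 t x| := by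
  have hb : ∀ y, |∫ x in Iic y, ρ1 t x| ≤ ∫ x, |ρ1 t x| := fun y =>
    (abs_integral_le_integral_abs).trans (setIntegral_le_integral (h1.integrable t).abs
        (Eventually.of_forall fun x => abs_nonneg _))
  unfold Inta
  refine (abs_integral_le_integral_abs).trans ?_
  rw [mul_comm, ← integral_mul_const]
  refine integral_mono_of_nonneg (Eventually.of_forall fun x => abs_nonneg _) ((h2.integrable t).abs.mul_const _)
    (Eventually.of_forall fun y => ?_)
  simp only [abs_mul]
  exact mul_le_mul_of_nonneg_left (hb y) (abs_nonneg _)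

section
variable {u ux uxx ut : ℝ → ℝ → ℂ} {κ M : ℝ} (H : St u ux uxx ut κ M)

lemma St.E_intg (H : St u ux uxx ut κ M) (t : ℝ) : ∫ x, E0 u κ t x = 2 * M / κ := by
  have hκ := H.pos
  have := H.g.df.EE_intg (fun t x => ff_nonneg u t x) (by linarith : 0 < κ / 2) t
  rw [H.hM] at this
  unfold E0
  rw [this]; field_simp

lemma St.abs_A_le (H : St u ux uxx ut κ M) (s t x : ℝ) : ‖conj (u t x) * ww u κ s t x‖ ≤ ‖u t x‖ * W0 u κ t x := by
  rw [norm_mul, RCLike.norm_conj]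
  exact mul_le_mul_of_nonneg_left (H.w_le s t x) (norm_nonneg _)

lemma St.uW_intg (H : St u ux uxx ut κ M) (t : ℝ) : ∫ x, ‖u t x‖ * W0 u κ t x ≤ M / κ := by
  have hκ := H.pos
  have hM := H.M0
  have d2 : Dec (fun t x => EE (2 * κ) (ff u t) x) := H.g.df.EE' (fun t x => ff_nonneg u t x) (by linarith)
  have i2 := H.g.df.EE_intg (fun t x => ff_nonneg u t x) (by linarith : 0 < 2 * κ) t
  rw [H.hM] at i2
  have hle : ∀ x, ‖u t x‖ * W0 u κ t x ≤ 1 / (2 * κ) * ff u t x + 25 / 64 * EE (2 * κ) (ff u t) x := by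
    intro x
    obtain ⟨K, hK0, hK⟩ := H.h.bd1 t
    have h1 := EE_cs (l := 2 * κ) (a := 2 * κ) (b := 2 * κ) (by linarith) (by linarith) (by ring)
      (H.h.cx t).norm (h := fun _ => 1) continuous_const (K := K) (L := 1) (fun x => by simpa using hK x) (by simp) x
    have e : (fun y => ‖u t y‖ ^ 2) = ff u t := by ext y; rw [H.ff_eq_norm]
    simp only [mul_one, one_pow] at h1
    rw [e, EE_const (by linarith)] at h1
    rw [H.ff_eq_norm]
    have hW : W0 u κ t x ^ 2 = 25 / 16 * EE (2 * κ) (fun y => ‖u t y‖) x ^ 2 := by unfold W0; ring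
    have hW2 : κ * W0 u κ t x ^ 2 ≤ 25 / 32 * EE (2 * κ) (ff u t) x := by
      rw [hW]
      have : κ * (25 / 16 * (EE (2 * κ) (ff u t) x * (1 / (2 * κ)))) = 25 / 32 * EE (2 * κ) (ff u t) x := by
        field_simp; ring
      rw [← this]
      gcongr
    have h3 : ‖u t x‖ * W0 u κ t x ≤ 1 / (2 * κ) * ‖u t x‖ ^ 2 + 1 / 2 * (κ * W0 u κ t x ^ 2) := by
      have : 0 ≤ 1 / (2 * κ) * (‖u t x‖ - κ * W0 u κ t x) ^ 2 := by positivity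
      have e : 1 / (2 * κ) * (‖u t x‖ - κ * W0 u κ t x) ^ 2 = 1 / (2 * κ) * ‖u t x‖ ^ 2 + 1 / 2 * (κ * W0 u κ t x ^ 2) -
        ‖u t x‖ * W0 u κ t x := by field_simp; ring
      linarith
    linarith
  calc ∫ x, ‖u t x‖ * W0 u κ t x ≤ ∫ x, (1 / (2 * κ) * ff u t x + 25 / 64 * EE (2 * κ) (ff u t) x) :=
        integral_mono ((H.g.du.norm.mul H.dW).integrable t) (((Dec.cmul _ H.g.df).add (Dec.cmul _ d2)).integrable t) hle
    _ = 1 / (2 * κ) * M + 25 / 64 * (M / (2 * κ)) := by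
        rw [integral_add ((Dec.cmul _ H.g.df).integrable t) ((Dec.cmul _ d2).integrable t), integral_const_mul, integral_const_mul, H.hM, i2]
    _ = 89 / 128 * (M / κ) := by field_simp; ring
    _ ≤ M / κ := by
        have : 0 ≤ M / κ := by positivity
        linarith

lemma St.b_intg (H : St u ux uxx ut κ M) (s t : ℝ) : ∫ x, |bb u κ s t x| ≤ M / κ :=
  (integral_mono (db H.g H.h s |>.integrable t).abs ((H.g.du.norm.mul H.dW).integrable t)
    (fun x => (Complex.abs_im_le_norm _).trans (H.abs_A_le s t x))).trans (H.uW_intg t)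

lemma St.a_intg (H : St u ux uxx ut κ M) (s t : ℝ) : ∫ x, |aa u κ s t x| ≤ M / κ :=
  (integral_mono (da H.g H.h s |>.integrable t).abs ((H.g.du.norm.mul H.dW).integrable t)
    (fun x => (Complex.abs_re_le_norm _).trans (H.abs_A_le s t x))).trans (H.uW_intg t)

lemma St.c_a (H : St u ux uxx ut κ M) : Continuous (fun z : ℝ × ℝ × ℝ => aa u κ z.1 z.2.1 z.2.2) :=
  Complex.continuous_re.comp ((Complex.continuous_conj.comp H.c_u).mul H.c_ww)
lemma St.c_b (H : St u ux uxx ut κ M) : Continuous (fun z : ℝ × ℝ × ℝ => bb u κ z.1 z.2.1 z.2.2) :=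
  Complex.continuous_im.comp ((Complex.continuous_conj.comp H.c_u).mul H.c_ww)
lemma St.c_a1 (H : St u ux uxx ut κ M) : Continuous (fun z : ℝ × ℝ × ℝ => a1 u κ z.1 z.2.1 z.2.2) :=
  Complex.continuous_re.comp ((Complex.continuous_conj.comp H.c_u).mul H.c_w1)
lemma St.c_f (H : St u ux uxx ut κ M) : Continuous (fun z : ℝ × ℝ × ℝ => ff u z.2.1 z.2.2) := Complex.continuous_normSq.comp H.c_u
lemma St.c_T (H : St u ux uxx ut κ M) : Continuous (fun z : ℝ × ℝ × ℝ => TT u κ z.1 z.2.1 z.2.2) :=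
  H.c_p.div (continuous_const.sub H.c_p) fun z => one_sub_pp_ne H.g H.h _ _ _
lemma St.c_L (H : St u ux uxx ut κ M) : Continuous (fun z : ℝ × ℝ × ℝ => LL u κ z.1 z.2.1 z.2.2) :=
  (continuous_const.mul H.c_a).sub (continuous_const.mul H.c_T)
lemma St.c_RC (H : St u ux uxx ut κ M) : Continuous (fun z : ℝ × ℝ × ℝ => RC u κ z.1 z.2.1 z.2.2) :=
  ((H.c_f.mul H.c_p).mul H.c_T).add ((continuous_const.mul (continuous_const.add H.c_T)).mul (H.c_L.pow 2))

lemma St.T_nn (H : St u ux uxx ut κ M) (s t x : ℝ) : 0 ≤ TT u κ s t x := TT_nonneg H.g H.h s t x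
lemma St.T_le (H : St u ux uxx ut κ M) (s t x : ℝ) : TT u κ s t x ≤ 4 / 3 * pp u κ s t x := TT_le H.g H.h s t x

lemma St.a_sq (H : St u ux uxx ut κ M) (s t x : ℝ) : aa u κ s t x ^ 2 ≤ ff u t x * pp u κ s t x := by
  rw [fp_eq]; nlinarith [sq_nonneg (bb u κ s t x)]

lemma St.RC_lower (H : St u ux uxx ut κ M) (s t x : ℝ) : ff u t x * pp u κ s t x ^ 2 + LL u κ s t x ^ 2 ≤ RC u κ s t x := by
  unfold RC
  have h1 := pp_le_TT H.g H.h s t x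
  have h2 := H.T_nn s t x
  have h3 := H.p_nn s t x
  have h4 := ff_nonneg u t x
  nlinarith [mul_nonneg h2 (sq_nonneg (LL u κ s t x)), mul_nonneg (mul_nonneg h4 h3) (sub_nonneg.2 h1)]

lemma St.RC_upper (H : St u ux uxx ut κ M) (s t x : ℝ) : RC u κ s t x ≤ (11 * ff u t x + 20 * κ ^ 2) * pp u κ s t x := by
  have h1 := H.T_le s t x
  have h2 := H.T_nn s t x
  have h3 := H.p_nn s t x
  have h4 := ff_nonneg u t x
  have h5 := H.h.pp_le s t x
  have h6 := H.a_sq s t x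
  have hT : TT u κ s t x ≤ 1 / 3 := by linarith
  have hT2 : TT u κ s t x ^ 2 ≤ 4 / 9 * pp u κ s t x := by nlinarith
  have hL : LL u κ s t x ^ 2 ≤ 8 * (ff u t x * pp u κ s t x) + 32 * κ ^ 2 * (4 / 9 * pp u κ s t x) := by
    have : LL u κ s t x ^ 2 ≤ 8 * aa u κ s t x ^ 2 + 32 * κ ^ 2 * TT u κ s t x ^ 2 := by
      unfold LL; nlinarith [sq_nonneg (2 * aa u κ s t x + 4 * κ * TT u κ s t x)]
    refine this.trans ?_
    gcongr
  have h7 : 1 / 2 * (2 + TT u κ s t x) * LL u κ s t x ^ 2 ≤ 7 / 6 * LL u κ s t x ^ 2 := by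
    nlinarith [sq_nonneg (LL u κ s t x)]
  have h8 : ff u t x * pp u κ s t x * TT u κ s t x ≤ 1 / 3 * (ff u t x * pp u κ s t x) := by
    nlinarith [mul_nonneg h4 h3]
  unfold RC
  have : 0 ≤ κ ^ 2 * pp u κ s t x := by positivity
  nlinarith [mul_nonneg h4 h3]

lemma St.RC_nn (H : St u ux uxx ut κ M) (s t x : ℝ) : 0 ≤ RC u κ s t x := by
  have := H.RC_lower s t x
  have h3 := ff_nonneg u t x
  have : 0 ≤ ff u t x * pp u κ s t x ^ 2 := by positivity
  nlinarith [sq_nonneg (LL u κ s t x)]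

def BC (u : ℝ → ℝ → ℂ) (κ t x : ℝ) : ℝ := (11 * ff u t x + 20 * κ ^ 2) * (4 * Real.pi * E0 u κ t x)

lemma St.dBC (H : St u ux uxx ut κ M) : Dec (BC u κ) :=
  ((Dec.cmul 11 H.g.df).bdc.add (Bdc.of_const (20 * κ ^ 2))).mulD (Dec.cmul _ H.dE)

lemma St.sb_RC (H : St u ux uxx ut κ M) : SB (RC u κ) (BC u κ) := by
  refine H.sb_p.dom H.c_RC (c := fun t x => 11 * ff u t x + 20 * κ ^ 2) (fun t x => ?_) (fun s t x => ?_)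
  · have := ff_nonneg u t x; positivity
  · rw [abs_of_nonneg (H.RC_nn s t x), abs_of_nonneg (H.p_nn s t x)]
    exact H.RC_upper s t x

lemma St.sb_T (H : St u ux uxx ut κ M) : SB (TT u κ) (fun t x => 4 / 3 * (4 * Real.pi * E0 u κ t x)) := by
  refine H.sb_p.dom H.c_T (c := fun t x => 4 / 3) (fun t x => by norm_num) (fun s t x => ?_)
  rw [abs_of_nonneg (H.T_nn s t x), abs_of_nonneg (H.p_nn s t x)]
  exact H.T_le s t x

lemma St.T_ss (H : St u ux uxx ut κ M) (t : ℝ) : Integrable (fun s => ∫ x, TT u κ s t x) ∧ ∫ s, ∫ x, TT u κ s t x ≤ 11 * Real.pi * M / κ := by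
  have hκ := H.pos
  have hM := H.M0
  have pi0 := Real.pi_pos
  have d : Dec (fun t x => 4 / 3 * (4 * Real.pi * E0 u κ t x)) := Dec.cmul _ (Dec.cmul _ H.dE)
  obtain ⟨i1, i2, e⟩ := H.sb_T.fub1 d t
  refine ⟨i1, ?_⟩
  rw [e]
  calc ∫ x, ∫ s, TT u κ s t x ≤ ∫ x, 4 / 3 * (4 * Real.pi * E0 u κ t x) := by
        refine integral_mono i2 (d.integrable t) fun x => ?_
        refine le_trans (le_of_eq ?_) (H.sb_T.2 t x).2
        simp_rw [abs_of_nonneg (H.T_nn _ t x)]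
    _ = 4 / 3 * (4 * Real.pi * (2 * M / κ)) := by
        rw [integral_const_mul, integral_const_mul, H.E_intg]
    _ = 32 / 3 * (Real.pi * M / κ) := by ring
    _ ≤ 11 * (Real.pi * M / κ) := by
        have : 0 ≤ Real.pi * M / κ := by positivity
        linarith
    _ = _ := by ring

/-- the interaction estimate (C) -/
lemma St.C_est (H : St u ux uxx ut κ M) (T : ℝ) (hT : 0 ≤ T) : ∫ t in (-T)..T, ∫ x, ∫ s, RC u κ s t x ≤ 22 * Real.pi * M ^ 2 / κ ^ 2 := by
  have hκ := H.pos
  have hM := H.M0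
  obtain ⟨i1, i2, e⟩ := H.sb_RC.fub2 H.dBC (a := -T) (b := T) (by linarith)
  rw [← e]
  have hb : ∀ s t, |Inta (TT u κ s) (bb u κ s) t| ≤ M / κ * ∫ x, TT u κ s t x := by
    intro s t
    refine ((dT H.g H.h s).Inta_le (db H.g H.h s) t).trans ?_
    rw [mul_comm]
    simp_rw [abs_of_nonneg (H.T_nn s t _)]
    exact mul_le_mul_of_nonneg_right (H.b_intg s t) (integral_nonneg fun x => H.T_nn s t x)
  obtain ⟨j1, k1⟩ := H.T_ss (-T)
  obtain ⟨j2, k2⟩ := H.T_ss T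
  calc ∫ s, ∫ t in (-T)..T, ∫ x, RC u κ s t x ≤ ∫ s, (M / κ * (∫ x, TT u κ s (-T) x) + M / κ * ∫ x, TT u κ s T x) := by
        refine integral_mono i1 ((j1.const_mul _).add (j2.const_mul _)) fun s => ?_
        simp only
        rw [C_ftc H.g H.h s]
        have := hb s (-T)
        have := hb s T
        have := le_abs_self (Inta (TT u κ s) (bb u κ s) (-T))
        have := neg_abs_le (Inta (TT u κ s) (bb u κ s) T)
        linarith
    _ = M / κ * (∫ s, ∫ x, TT u κ s (-T) x) + M / κ * ∫ s, ∫ x, TT u κ s T x := by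
        rw [integral_add (j1.const_mul _) (j2.const_mul _), integral_const_mul, integral_const_mul]
    _ ≤ M / κ * (11 * Real.pi * M / κ) + M / κ * (11 * Real.pi * M / κ) := by gcongr
    _ = _ := by field_simp; ring
end

end PartBg

noncomputable section PartBh
set_option linter.unusedSectionVars false
open scoped ComplexConjugate
open Filter Topology Set

/-- mean of squares -/
def m2 (u : ℝ → ℝ → ℂ) (κ t x : ℝ) : ℝ := 4 * κ * EE (4 * κ) (fun y => ff u t y ^ 2) x
/-- averaged squared increments of the density -/
def hh (u : ℝ → ℝ → ℂ) (κ t x : ℝ) : ℝ := ff u t x ^ 2 - 2 * (ff u t x * mm u κ t x) + m2 u κ t x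
def eb (u : ℝ → ℝ → ℂ) (κ t x : ℝ) : ℝ := κ / 2 * E0 u κ t x

lemma Dec.sq {F : ℝ → ℝ → ℝ} (h : Dec F) : Dec (fun t x => F t x ^ 2) := by
  have := h.mul h
  simpa only [pow_two] using this

lemma Dec.cube {F : ℝ → ℝ → ℝ} (h : Dec F) : Dec (fun t x => F t x ^ 3) := by
  have := (h.mul h).mul h
  have e : (fun t x => F t x ^ 3) = fun t x => F t x * F t x * F t x := by ext t x; ring
  rw [e]; exact this

section
variable {u ux uxx ut : ℝ → ℝ → ℂ} {κ M : ℝ} (H : St u ux uxx ut κ M)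

lemma St.df2 (H : St u ux uxx ut κ M) : Dec (fun t x => ff u t x ^ 2) := H.g.df.sq

lemma St.dmm (H : St u ux uxx ut κ M) : Dec (mm u κ) :=
  Dec.cmul (4 * κ) (H.g.df.EE' (fun t x => ff_nonneg u t x) (by linarith [H.pos] : 0 < 4 * κ))
lemma St.dm2 (H : St u ux uxx ut κ M) : Dec (m2 u κ) :=
  Dec.cmul (4 * κ) (H.df2.EE' (fun t x => sq_nonneg _) (by linarith [H.pos] : 0 < 4 * κ))
lemma St.dhh (H : St u ux uxx ut κ M) : Dec (hh u κ) := (H.df2.sub (Dec.cmul 2 (H.g.df.mul H.dmm))).add H.dm2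

/-- Jensen -/
lemma St.jens (H : St u ux uxx ut κ M) {F : ℝ → ℝ} (hF : Continuous F) {K : ℝ} (hK : ∀ x, |F x| ≤ K) (x : ℝ) :
    (4 * κ * EE (4 * κ) F x) ^ 2 ≤ 4 * κ * EE (4 * κ) (fun y => F y ^ 2) x := by
  have hκ := H.pos
  have h1 := EE_cs (l := 4 * κ) (a := 4 * κ) (b := 4 * κ) (by linarith) (by linarith) (by ring)
      hF (h := fun _ => 1) continuous_const (L := 1) hK (by simp) x
  simp only [mul_one, one_pow] at h1
  rw [EE_const (by linarith)] at h1
  have e : 4 * κ * EE (4 * κ) (fun y => F y ^ 2) x =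
    (4 * κ) ^ 2 * (EE (4 * κ) (fun y => F y ^ 2) x * (1 / (4 * κ))) := by field_simp
  rw [e, mul_pow]
  gcongr

lemma St.mm_sq (H : St u ux uxx ut κ M) (t x : ℝ) : mm u κ t x ^ 2 ≤ m2 u κ t x := by
  obtain ⟨K, hK⟩ := H.g.df.bd1 t
  exact H.jens (H.g.df.cx t) hK x

lemma St.hh_ge (H : St u ux uxx ut κ M) (t x : ℝ) : (ff u t x - mm u κ t x) ^ 2 ≤ hh u κ t x := by
  have := H.mm_sq t x
  unfold hh; nlinarith

lemma St.hh_nn (H : St u ux uxx ut κ M) (t x : ℝ) : 0 ≤ hh u κ t x := (sq_nonneg _).trans (H.hh_ge t x)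

lemma St.m2_intg (H : St u ux uxx ut κ M) (t : ℝ) : ∫ x, m2 u κ t x = ∫ x, ff u t x ^ 2 := by
  have hκ := H.pos
  have := H.df2.EE_intg (fun t x => sq_nonneg _) (by linarith : 0 < 4 * κ) t
  unfold m2
  rw [integral_const_mul, this]; field_simp

lemma St.hh_intg (H : St u ux uxx ut κ M) (t : ℝ) : ∫ x, hh u κ t x = 2 * (∫ x, ff u t x ^ 2) - 2 * ∫ x, ff u t x * mm u κ t x := by
  have d1 := (Dec.cmul 2 (H.g.df.mul H.dmm)).integrable t
  unfold hh
  rw [integral_add ((H.df2.sub (Dec.cmul 2 (H.g.df.mul H.dmm))).integrable t) (H.dm2.integrable t), integral_sub (H.df2.integrable t) d1,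
    integral_const_mul, H.m2_intg]
  ring

lemma St.mm_dx (H : St u ux uxx ut κ M) (t x : ℝ) : HasDerivAt (mm u κ t) (4 * κ * (ff u t x - mm u κ t x)) x := by
  obtain ⟨K, hK⟩ := H.g.df.bd1 t
  exact ((EE_hasDerivAt (by linarith [H.pos] : 0 < 4 * κ) (H.g.df.cx t) hK x).const_mul (4 * κ))

lemma St.f_mtt (H : St u ux uxx ut κ M) (t : ℝ) : ∫ x, ff u t x * mtt u κ t x = ∫ x, ff u t x * mm u κ t x := by
  have hκ := H.pos
  have dm := dmt H.g H.h
  have d1 := (H.g.df.mul dm)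
  have d2 := (H.g.df.mul H.dmm)
  have := Dec.int_deriv (H.dmm.mul dm) (Dec.cmul (4 * κ) (d1.sub d2)) t
    (fun x => ((H.mm_dx t x).mul (mt_dx H.g H.h t x)).congr_deriv (by ring))
  rw [integral_const_mul, integral_sub (d1.integrable t) (d2.integrable t)] at this
  have := (mul_eq_zero.1 this).resolve_left (by positivity)
  linarith

lemma St.fx_mm (H : St u ux uxx ut κ M) (t : ℝ) : ∫ x, fx u ux t x * mm u κ t x = -(4 * κ * (∫ x, ff u t x ^ 2 )) + 4 * κ * ∫ x, ff u t x * mm u κ t x := by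
  have d1 := (H.g.dfx.mul H.dmm)
  have d2 := (H.g.df.mul H.dmm)
  have d3 := Dec.cmul (4 * κ) (H.df2.sub d2)
  have := Dec.int_deriv (H.g.df.mul H.dmm) (d1.add d3) t
    (fun x => ((H.g.f_dx t x).mul (H.mm_dx t x)).congr_deriv (by ring))
  rw [integral_add (d1.integrable t) (d3.integrable t), integral_const_mul, integral_sub (H.df2.integrable t) (d2.integrable t)] at this
  linarith

/-- forward mean of squares -/
lemma St.phi_intg (H : St u ux uxx ut κ M) (t : ℝ) : ∫ x, phi u κ t x ^ 2 ≤ ∫ x, hh u κ t x := by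
  have hκ := H.pos
  obtain ⟨K, hK⟩ := H.g.df.rfx'.bd1 t
  set n : ℝ → ℝ → ℝ := fun t x => 4 * κ * EE (4 * κ) (fun y => rfx (ff u) t y ^ 2) x with hn
  have dn : Dec n := Dec.cmul (4 * κ) (H.g.df.rfx'.sq.EE' (fun t x => sq_nonneg _) (by linarith : 0 < 4 * κ))
  have dn' : Dec (rfx n) := dn.rfx'
  have hle : ∀ x, phi u κ t x ^ 2 ≤ ff u t x ^ 2 - 2 * (ff u t x * mtt u κ t x) + rfx n t x := by
    intro x
    have : mtt u κ t x ^ 2 ≤ rfx n t x := H.jens (H.g.df.rfx'.cx t) hK (-x)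
    unfold phi; nlinarith
  have e1 : ∫ x, rfx n t x = ∫ x, ff u t x ^ 2 := by
    have a1 : ∫ x, rfx n t x = ∫ x, n t x := integral_neg_eq_self (n t) volume
    have a2 : ∫ x, rfx (ff u) t x ^ 2 = ∫ x, ff u t x ^ 2 := integral_neg_eq_self (fun x => ff u t x ^ 2) volume
    have := H.g.df.rfx'.sq.EE_intg (fun t x => sq_nonneg _) (by linarith : 0 < 4 * κ) t
    rw [a1, hn]
    simp only
    rw [integral_const_mul, this, a2]; field_simp
  have d1 := (Dec.cmul 2 (H.g.df.mul (dmt H.g H.h))).integrable t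
  calc ∫ x, phi u κ t x ^ 2 ≤ ∫ x, (ff u t x ^ 2 - 2 * (ff u t x * mtt u κ t x) + rfx n t x) :=
        integral_mono ((dphi H.g H.h).sq.integrable t) (((H.df2.integrable t).sub d1).add (dn'.integrable t)) hle
    _ = _ := by
        rw [integral_add ((H.df2.sub (Dec.cmul 2 (H.g.df.mul (dmt H.g H.h)))).integrable t) (dn'.integrable t), integral_sub (H.df2.integrable t) d1,
          integral_const_mul, e1, H.f_mtt, H.hh_intg]
        ring

/-- cubic Jensen -/
lemma St.deb (H : St u ux uxx ut κ M) : Dec (eb u κ) := Dec.cmul (κ / 2) H.dE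
lemma St.eb_nn (H : St u ux uxx ut κ M) (t x : ℝ) : 0 ≤ eb u κ t x := mul_nonneg (by linarith [H.pos]) (H.E_nonneg t x)

lemma St.eb_cube (H : St u ux uxx ut κ M) (t x : ℝ) : eb u κ t x ^ 3 ≤ κ / 2 * EE (κ / 2) (fun y => ff u t y ^ 3) x := by
  have hκ := H.pos
  have hl : 0 < κ / 2 := by linarith
  obtain ⟨K, hK⟩ := H.g.df.bd1 t
  obtain ⟨K3, hK3⟩ := H.g.df.cube.bd1 t
  set c := eb u κ t x with hc
  have c0 : 0 ≤ c := H.eb_nn t x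
  have cf := H.g.df.cx t
  have key : EE (κ / 2) (fun y => 3 * c ^ 2 * ff u t y) x ≤ EE (κ / 2) (fun y => ff u t y ^ 3 + 2 * c ^ 3) x := by
    refine EE_mono hl (by fun_prop) (K := 3 * c ^ 2 * K) (fun y => ?_) (by fun_prop) (L := K3 + 2 * c ^ 3) (fun y => ?_) x (fun r hr => ?_)
    · rw [abs_mul, abs_of_nonneg (by positivity : 0 ≤ 3 * c ^ 2)]
      exact mul_le_mul_of_nonneg_left (hK y) (by positivity)
    · refine (abs_add_le _ _).trans ?_
      rw [abs_of_nonneg (by positivity : 0 ≤ 2 * c ^ 3)]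
      linarith [(Real.norm_eq_abs _).symm.le.trans (hK3 y)]
    · have := ff_nonneg u t (x - r)
      nlinarith [mul_nonneg (add_nonneg this (by linarith : 0 ≤ 2 * c)) (sq_nonneg (ff u t (x - r) - c))]
  have e2 : EE (κ / 2) (fun y => ff u t y ^ 3 + 2 * c ^ 3) x = EE (κ / 2) (fun y => ff u t y ^ 3) x + 2 * c ^ 3 / (κ / 2) := by
    rw [← EE_const hl (2 * c ^ 3) x]
    unfold EE
    rw [← integral_add (EE_int hl (g := fun y => ff u t y ^ 3) (by fun_prop) hK3 x) ((exp_int hl).mul_const _)]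
    congr 1; ext r; ring
  rw [e2, EE_const_mul] at key
  have e3 : κ / 2 * EE (κ / 2) (ff u t) x = c := rfl
  have h4 := mul_le_mul_of_nonneg_left key hl.le
  have e5 : κ / 2 * (3 * c ^ 2 * EE (κ / 2) (ff u t) x) = 3 * c ^ 3 := by
    rw [mul_left_comm, e3]; ring
  have e6 : κ / 2 * (EE (κ / 2) (fun y => ff u t y ^ 3) x + 2 * c ^ 3 / (κ / 2)) =
    κ / 2 * EE (κ / 2) (fun y => ff u t y ^ 3) x + 2 * c ^ 3 := by field_simp
  rw [e5, e6] at h4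
  linarith

lemma St.eb_intg (H : St u ux uxx ut κ M) (t : ℝ) : ∫ x, eb u κ t x ^ 3 ≤ ∫ x, ff u t x ^ 3 := by
  have hκ := H.pos
  have n3 : ∀ t x, 0 ≤ ff u t x ^ 3 := fun t x => pow_nonneg (ff_nonneg u t x) 3
  have d := Dec.cmul (κ / 2) (H.g.df.cube.EE' n3 (by linarith : 0 < κ / 2))
  have := H.g.df.cube.EE_intg n3 (by linarith : 0 < κ / 2) t
  calc ∫ x, eb u κ t x ^ 3 ≤ ∫ x, κ / 2 * EE (κ / 2) (fun y => ff u t y ^ 3) x :=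
        integral_mono (H.deb.cube.integrable t) (d.integrable t) (H.eb_cube t)
    _ = _ := by rw [integral_const_mul, this]; field_simp
end

end PartBh

noncomputable section PartBi
set_option linter.unusedSectionVars false
open scoped ComplexConjugate
open Filter Topology Set

/-- majorant for the `s`-integral of `Om` -/
def BO (u : ℝ → ℝ → ℂ) (κ t x : ℝ) : ℝ := 4 * ‖u t x‖ * B1 u κ t x +
  (3 * (‖u t x‖ * W0 u κ t x) + 2 * E0 u κ t x) * (4 * Real.pi * E0 u κ t x)

section
variable {u ux uxx ut : ℝ → ℝ → ℂ} {κ M : ℝ} (H : St u ux uxx ut κ M)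

lemma St.dBO (H : St u ux uxx ut κ M) : Dec (BO u κ) :=
  ((Dec.cmul 4 H.g.du.norm).mul H.dB1).add
    (((Dec.cmul 3 (H.g.du.norm.mul H.dW)).add (Dec.cmul 2 H.dE)).mul (Dec.cmul (4 * Real.pi) H.dE))

lemma St.BO_sq (H : St u ux uxx ut κ M) (t x : ℝ) : BO u κ t x ^ 2 ≤ Real.pi ^ 2 * (768 * ff u t x * E0 u κ t x ^ 3 / κ + 192 * E0 u κ t x ^ 4) := by
  have h1 := H.B1_sq t x
  have h2 := H.W_sq t x
  have hκ := H.pos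
  have e0 := H.E_nonneg t x
  have pi0 := Real.pi_pos
  rw [H.ff_eq_norm]
  set n := ‖u t x‖
  set E := E0 u κ t x
  have : ∀ a b c : ℝ, (a + b + c) ^ 2 ≤ 3 * (a ^ 2 + b ^ 2 + c ^ 2) := fun a b c => by
    nlinarith [sq_nonneg (a - b), sq_nonneg (b - c), sq_nonneg (a - c)]
  have h3 := this (4 * n * B1 u κ t x) (3 * (n * W0 u κ t x) * (4 * Real.pi * E)) (2 * E * (4 * Real.pi * E))
  have e : BO u κ t x = 4 * n * B1 u κ t x + 3 * (n * W0 u κ t x) * (4 * Real.pi * E) + 2 * E * (4 * Real.pi * E) := by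
    unfold BO; ring
  rw [← e] at h3
  refine h3.trans ?_
  calc 3 * ((4 * n * B1 u κ t x) ^ 2 + (3 * (n * W0 u κ t x) * (4 * Real.pi * E)) ^ 2 + (2 * E * (4 * Real.pi * E)) ^ 2)
      = 3 * (16 * n ^ 2 * B1 u κ t x ^ 2 + 144 * Real.pi ^ 2 * n ^ 2 * E ^ 2 * W0 u κ t x ^ 2 + 64 * Real.pi ^ 2 * E ^ 4) := by ring
    _ ≤ 3 * (16 * n ^ 2 * (7 * Real.pi ^ 2 * E ^ 3 / κ) + 144 * Real.pi ^ 2 * n ^ 2 * E ^ 2 * (E / κ) + 64 * Real.pi ^ 2 * E ^ 4) := by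
        gcongr
    _ = _ := by field_simp; ring

lemma St.c_Om (H : St u ux uxx ut κ M) : Continuous (fun z : ℝ × ℝ × ℝ => Om u κ z.1 z.2.1 z.2.2) := by
  have a := H.c_a
  have a' := H.c_a1
  have p := H.c_p
  unfold Om
  exact (((continuous_const.mul (a.sub a')).sub ((continuous_const.mul a).mul p)).sub
    ((continuous_const.mul a).mul (p.pow 2))).sub (continuous_const.mul (p.pow 2))

lemma St.a_abs (H : St u ux uxx ut κ M) (s t x : ℝ) : |aa u κ s t x| ≤ ‖u t x‖ * W0 u κ t x := (Complex.abs_re_le_norm _).trans (H.abs_A_le s t x)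

lemma St.aa1 (H : St u ux uxx ut κ M) (s t x : ℝ) : |aa u κ s t x - a1 u κ s t x| ≤ ‖u t x‖ * DD u κ s t x := by
  have : aa u κ s t x - a1 u κ s t x = (conj (u t x) * (ww u κ s t x - w1 u κ s t x)).re := by
    simp [aa, a1]; ring
  rw [this]
  refine (Complex.abs_re_le_norm _).trans (le_of_eq ?_)
  rw [norm_mul, RCLike.norm_conj]; rfl

lemma St.sb_uD (H : St u ux uxx ut κ M) : SB (fun s t x => 4 * ‖u t x‖ * DD u κ s t x) (fun t x => 4 * ‖u t x‖ * B1 u κ t x) := by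
  refine H.sb_D.dom ?_ (fun t x => by positivity) (fun s t x => ?_)
  · exact (continuous_const.mul H.c_u.norm).mul H.c_D
  · rw [abs_mul, abs_of_nonneg (by positivity : 0 ≤ 4 * ‖u t x‖)]

lemma St.Om_le (H : St u ux uxx ut κ M) (s t x : ℝ) : |Om u κ s t x| ≤ 4 * ‖u t x‖ * DD u κ s t x +
    (3 * (‖u t x‖ * W0 u κ t x) + 2 * E0 u κ t x) * pp u κ s t x := by
  have h1 := H.aa1 s t x
  have h2 := H.a_abs s t x
  have h3 := H.p_nn s t x
  have h4 := H.h.pp_le s t x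
  have h5 := H.p_le s t x
  have hκ := H.pos
  have h6 : κ * pp u κ s t x ≤ E0 u κ t x := by rw [le_div_iff₀ hκ] at h5; linarith
  set p := pp u κ s t x
  set a := aa u κ s t x
  set n := ‖u t x‖ * W0 u κ t x
  have hn : 0 ≤ n := (abs_nonneg _).trans h2
  have e : Om u κ s t x = 4 * (a - a1 u κ s t x) + (-(a * (2 * p + 2 * p ^ 2))) + (-(2 * κ * p ^ 2)) := by
    unfold Om; ring
  rw [e]
  refine (abs_add_three _ _ _).trans ?_
  rw [abs_neg, abs_neg, abs_mul, abs_mul, abs_of_nonneg (by positivity : 0 ≤ 2 * p + 2 * p ^ 2),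
    abs_of_nonneg (by positivity : 0 ≤ 2 * κ * p ^ 2), abs_of_nonneg (by norm_num : (0:ℝ) ≤ 4)]
  have k1 : |a| * (2 * p + 2 * p ^ 2) ≤ n * (3 * p) :=
    mul_le_mul h2 (by nlinarith) (by positivity) hn
  have k2 : 2 * κ * p ^ 2 ≤ 2 * E0 u κ t x * p := by nlinarith
  nlinarith

lemma St.sb_Om (H : St u ux uxx ut κ M) : SB (Om u κ) (BO u κ) := by
  have hb : ∀ t x, 0 ≤ 3 * (‖u t x‖ * W0 u κ t x) + 2 * E0 u κ t x := fun t x => by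
    have := H.W_nonneg t x
    have := H.E_nonneg t x
    positivity
  have h2 : SB (fun s t x => (3 * (‖u t x‖ * W0 u κ t x) + 2 * E0 u κ t x) * pp u κ s t x)
      (fun t x => (3 * (‖u t x‖ * W0 u κ t x) + 2 * E0 u κ t x) * (4 * Real.pi * E0 u κ t x)) := by
    refine H.sb_p.dom ?_ hb (fun s t x => ?_)
    · have d : Dec (fun t x => 3 * (‖u t x‖ * W0 u κ t x) + 2 * E0 u κ t x) :=
        (Dec.cmul 3 (H.g.du.norm.mul H.dW)).add (Dec.cmul 2 H.dE)
      exact (d.1.comp continuous_snd).mul H.c_p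
    · rw [abs_mul, abs_of_nonneg (hb t x)]
  have h3 := (H.sb_uD.add h2).dom H.c_Om (c := fun _ _ => 1) (fun _ _ => by norm_num) (fun s t x => by
    rw [one_mul]; exact (H.Om_le s t x).trans (le_abs_self _))
  refine h3.mono fun t x => ?_
  rw [one_mul]; rfl

lemma St.c_p1 (H : St u ux uxx ut κ M) : Continuous (fun z : ℝ × ℝ × ℝ => p1 u κ z.1 z.2.1 z.2.2) := Complex.continuous_normSq.comp H.c_w1

lemma St.sb_p1 (H : St u ux uxx ut κ M) : SB (p1 u κ) (fun t x => Real.pi * E0 u κ t x) := by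
  refine ⟨H.c_p1, fun t x => ⟨w1_sqint H.h t x, ?_⟩⟩
  have : ∀ s, |p1 u κ s t x| = p1 u κ s t x := fun s => abs_of_nonneg (normSq_nonneg _)
  simp_rw [this]
  rw [p1_int H.h]
  exact mul_le_mul_of_nonneg_left (H.E_anti t x) Real.pi_pos.le

lemma St.sb_G1 (H : St u ux uxx ut κ M) : SB (fun s t x => -2 * fx u ux t x * p1 u κ s t x) (fun t x => |2 * fx u ux t x| * (Real.pi * E0 u κ t x)) := by
  refine H.sb_p1.dom ?_ (fun t x => abs_nonneg _) (fun s t x => ?_)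
  · exact (continuous_const.mul (H.g.dfx.1.comp continuous_snd)).mul H.c_p1
  · rw [abs_mul, neg_mul, abs_neg]

lemma St.sb_G2 (H : St u ux uxx ut κ M) : SB (fun s t x => phi u κ t x * Om u κ s t x) (fun t x => |phi u κ t x| * BO u κ t x) := by
  refine H.sb_Om.dom ?_ (fun t x => abs_nonneg _) (fun s t x => ?_)
  · exact ((dphi H.g H.h).1.comp continuous_snd).mul H.c_Om
  · rw [abs_mul]

def G3 (u : ℝ → ℝ → ℂ) (κ s t x : ℝ) : ℝ :=
  ff u t x * (4 * κ * pp u κ s t x ^ 2 + 2 * aa u κ s t x * pp u κ s t x ^ 2)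

lemma St.sb_G3 (H : St u ux uxx ut κ M) : SB (G3 u κ) (fun t x => (ff u t x * (κ + ‖u t x‖ * W0 u κ t x)) * (4 * Real.pi * E0 u κ t x)) := by
  have hb : ∀ t x, 0 ≤ ff u t x * (κ + ‖u t x‖ * W0 u κ t x) := fun t x => by
    have := H.W_nonneg t x
    have := ff_nonneg u t x
    have := H.pos
    positivity
  refine H.sb_p.dom ?_ hb (fun s t x => ?_)
  · exact H.c_f.mul ((continuous_const.mul (H.c_p.pow 2)).add ((continuous_const.mul H.c_a).mul (H.c_p.pow 2)))
  · unfold G3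
    have h2 := H.a_abs s t x
    have h3 := H.p_nn s t x
    have h4 := H.h.pp_le s t x
    have hf := ff_nonneg u t x
    have hκ := H.pos
    rw [abs_mul, abs_of_nonneg hf, mul_assoc (ff u t x), abs_of_nonneg h3]
    refine mul_le_mul_of_nonneg_left ?_ hf
    refine (abs_add_le _ _).trans ?_
    rw [abs_of_nonneg (by positivity), abs_mul, abs_mul, abs_of_nonneg (by norm_num : (0:ℝ) ≤ 2), abs_of_nonneg (by positivity : 0 ≤ pp u κ s t x ^ 2)]
    have hp2 : pp u κ s t x ^ 2 ≤ 1 / 4 * pp u κ s t x := by nlinarith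
    have k1 : |aa u κ s t x| * pp u κ s t x ^ 2 ≤ ‖u t x‖ * W0 u κ t x * (1 / 4 * pp u κ s t x) :=
      mul_le_mul h2 hp2 (by positivity) ((abs_nonneg _).trans h2)
    have k2 : 0 ≤ ‖u t x‖ * W0 u κ t x * pp u κ s t x := mul_nonneg ((abs_nonneg _).trans h2) h3
    have k3 : κ * pp u κ s t x ^ 2 ≤ κ * (1 / 4 * pp u κ s t x) := by gcongr
    nlinarith

lemma St.G3_ge (H : St u ux uxx ut κ M) (s t x : ℝ) : -(ff u t x ^ 2 * E0 u κ t x ^ 2 / (4 * κ ^ 3)) * pp u κ s t x ≤ G3 u κ s t x := by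
  have h1 := H.a_sq s t x
  have h3 := H.p_nn s t x
  have h5 := H.p_le s t x
  have hf := ff_nonneg u t x
  have hκ := H.pos
  unfold G3
  set p := pp u κ s t x
  set a := aa u κ s t x
  set f := ff u t x
  have k1 : -(a ^ 2) / (4 * κ) ≤ 4 * κ + 2 * a := by
    rw [div_le_iff₀ (by positivity)]
    nlinarith [sq_nonneg (4 * κ + a)]
  have k2 : -(f * p) / (4 * κ) ≤ 4 * κ + 2 * a := le_trans (by gcongr) k1
  have k3 : f * p ^ 2 * (-(f * p) / (4 * κ)) ≤ f * p ^ 2 * (4 * κ + 2 * a) :=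
    mul_le_mul_of_nonneg_left k2 (by positivity)
  have k4 : f ^ 2 * p * p ^ 2 / (4 * κ) ≤ f ^ 2 * p * (E0 u κ t x / κ) ^ 2 / (4 * κ) := by gcongr
  have e1 : f * p ^ 2 * (-(f * p) / (4 * κ)) = -(f ^ 2 * p * p ^ 2 / (4 * κ)) := by ring
  have e2 : f ^ 2 * p * (E0 u κ t x / κ) ^ 2 / (4 * κ) = (f ^ 2 * E0 u κ t x ^ 2 / (4 * κ ^ 3)) * p := by
    field_simp
  rw [e1] at k3; rw [e2] at k4
  nlinarith

lemma St.sb_GB (H : St u ux uxx ut κ M) : SB (GB u ux κ) (fun t x => |2 * fx u ux t x| * (Real.pi * E0 u κ t x) + |phi u κ t x| * BO u κ t x +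
    (ff u t x * (κ + ‖u t x‖ * W0 u κ t x)) * (4 * Real.pi * E0 u κ t x)) := (H.sb_G1.add H.sb_G2).add H.sb_G3

lemma St.dGBB (H : St u ux uxx ut κ M) : Dec (fun t x => |2 * fx u ux t x| * (Real.pi * E0 u κ t x) + |phi u κ t x| * BO u κ t x +
    (ff u t x * (κ + ‖u t x‖ * W0 u κ t x)) * (4 * Real.pi * E0 u κ t x)) := by
  have h1 : Dec (fun t x => |2 * fx u ux t x|) := (Dec.cmul 2 H.g.dfx).norm
  have h2 : Dec (fun t x => |phi u κ t x|) := (dphi H.g H.h).norm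
  exact ((h1.mul (Dec.cmul Real.pi H.dE)).add (h2.mul H.dBO)).add
    ((H.g.df.mulB ((Bdc.of_const κ).add (H.g.du.norm.mul H.dW).bdc)).mul (Dec.cmul (4 * Real.pi) H.dE))

/-- pointwise lower bound for the `s`-integrated right side of (B) -/
lemma St.GB_pt (H : St u ux uxx ut κ M) (t x : ℝ) : -(Real.pi / (2 * κ)) * (fx u ux t x * mm u κ t x) - Real.pi / 2 * phi u κ t x ^ 2 -
    Real.pi * M / κ ^ 3 * (2400 * (ff u t x ^ 3 + eb u κ t x ^ 3)) ≤ ∫ s, GB u ux κ s t x := by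
  have hκ := H.pos
  have pi0 := Real.pi_pos
  have hM := H.M0
  have e0 := H.E_nonneg t x
  have f0 := ff_nonneg u t x
  have i1 := (H.sb_G1.2 t x).1
  have i2 := (H.sb_G2.2 t x).1
  have i3 := (H.sb_G3.2 t x).1
  have e : ∫ s, GB u ux κ s t x = (∫ s, -2 * fx u ux t x * p1 u κ s t x) + (∫ s, phi u κ t x * Om u κ s t x) + ∫ s, G3 u κ s t x := by
    rw [← integral_add i1 i2]
    exact integral_add (i1.add i2) i3
  have t1 : ∫ s, -2 * fx u ux t x * p1 u κ s t x = -(Real.pi / (2 * κ)) * (fx u ux t x * mm u κ t x) := by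
    rw [integral_const_mul, p1_int H.h]; unfold mm; field_simp; ring
  have t2 : -(Real.pi / 2 * phi u κ t x ^ 2 + 1 / (2 * Real.pi) * BO u κ t x ^ 2) ≤ ∫ s, phi u κ t x * Om u κ s t x := by
    have h1 := (H.sb_G2.2 t x).2
    have h2 : |∫ s, phi u κ t x * Om u κ s t x| ≤ |phi u κ t x| * BO u κ t x := (abs_integral_le_integral_abs).trans h1
    have h3 := neg_abs_le (∫ s, phi u κ t x * Om u κ s t x)
    have h4 : |phi u κ t x| * BO u κ t x ≤ Real.pi / 2 * phi u κ t x ^ 2 + 1 / (2 * Real.pi) * BO u κ t x ^ 2 := by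
      have : 0 ≤ 1 / (2 * Real.pi) * (Real.pi * |phi u κ t x| - BO u κ t x) ^ 2 := by positivity
      have e : 1 / (2 * Real.pi) * (Real.pi * |phi u κ t x| - BO u κ t x) ^ 2 = Real.pi / 2 * |phi u κ t x| ^ 2 + 1 / (2 * Real.pi) * BO u κ t x ^ 2
        - |phi u κ t x| * BO u κ t x := by field_simp; ring
      rw [sq_abs] at e
      linarith
    linarith
  have t3 : -(Real.pi * ff u t x ^ 2 * E0 u κ t x ^ 3 / κ ^ 3) ≤ ∫ s, G3 u κ s t x := by
    have h1 := (H.sb_p.2 t x).2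
    simp_rw [abs_of_nonneg (H.p_nn _ t x)] at h1
    have h2 : ∫ s, -(ff u t x ^ 2 * E0 u κ t x ^ 2 / (4 * κ ^ 3)) * pp u κ s t x ≤ ∫ s, G3 u κ s t x :=
      integral_mono ((H.sb_p.2 t x).1.const_mul _) i3 (fun s => H.G3_ge s t x)
    rw [integral_const_mul] at h2
    refine le_trans ?_ h2
    have h3 : (ff u t x ^ 2 * E0 u κ t x ^ 2 / (4 * κ ^ 3)) * ∫ s, pp u κ s t x ≤
      (ff u t x ^ 2 * E0 u κ t x ^ 2 / (4 * κ ^ 3)) * (4 * Real.pi * E0 u κ t x) := by gcongr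
    have e : (ff u t x ^ 2 * E0 u κ t x ^ 2 / (4 * κ ^ 3)) * (4 * Real.pi * E0 u κ t x) =
      Real.pi * ff u t x ^ 2 * E0 u κ t x ^ 3 / κ ^ 3 := by field_simp
    rw [e] at h3
    linarith
  have t4 := H.BO_sq t x
  have hE := H.E_le t x
  have b0 := H.eb_nn t x
  have hEb : E0 u κ t x = 2 / κ * eb u κ t x := by unfold eb; field_simp
  set f := ff u t x
  set b := eb u κ t x
  set E := E0 u κ t x
  have q1 : f * b ^ 2 ≤ f ^ 3 + b ^ 3 := by
    rcases le_total f b with h | h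
    · have : f * b ^ 2 ≤ b * b ^ 2 := by gcongr
      nlinarith [pow_nonneg f0 3]
    · have : f * b ^ 2 ≤ f * f ^ 2 := by gcongr
      nlinarith [pow_nonneg b0 3]
  have q2 : f ^ 2 * b ≤ f ^ 3 + b ^ 3 := by
    rcases le_total f b with h | h
    · have : f ^ 2 * b ≤ b ^ 2 * b := by gcongr
      nlinarith [pow_nonneg f0 3]
    · have : f ^ 2 * b ≤ f ^ 2 * f := by gcongr
      nlinarith [pow_nonneg b0 3]
  have r1 : 1 / (2 * Real.pi) * BO u κ t x ^ 2 ≤ Real.pi * M / κ ^ 3 * (1536 * (f * b ^ 2) + 768 * b ^ 3) := by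
    calc _ ≤ 1 / (2 * Real.pi) * (Real.pi ^ 2 * (768 * f * E ^ 3 / κ + 192 * E ^ 4)) := by gcongr
      _ = Real.pi * E * (384 * f * E ^ 2 / κ + 96 * E ^ 3) := by field_simp; ring
      _ ≤ Real.pi * M * (384 * f * E ^ 2 / κ + 96 * E ^ 3) := by gcongr
      _ = _ := by rw [hEb]; field_simp; ring
  have r2 : Real.pi * f ^ 2 * E ^ 3 / κ ^ 3 ≤ Real.pi * M / κ ^ 3 * (f ^ 2 * b) := by
    have hs : E * E ≤ M * (κ / 2) := by
      have := H.hk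
      exact mul_le_mul hE (by linarith) e0 hM.le
    calc Real.pi * f ^ 2 * E ^ 3 / κ ^ 3 = Real.pi * f ^ 2 / κ ^ 3 * E * (E * E) := by ring
      _ ≤ Real.pi * f ^ 2 / κ ^ 3 * E * (M * (κ / 2)) := by gcongr
      _ = _ := by rw [hEb]; field_simp
  have r3 : Real.pi * M / κ ^ 3 * (1536 * (f * b ^ 2) + 768 * b ^ 3 + f ^ 2 * b) ≤ Real.pi * M / κ ^ 3 * (2400 * (f ^ 3 + b ^ 3)) := by
    gcongr
    nlinarith [pow_nonneg f0 3, pow_nonneg b0 3]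
  rw [mul_add, mul_add] at r3
  rw [mul_add] at r1
  rw [e, t1]
  linarith

end

end PartBi

noncomputable section PartBj
set_option linter.unusedSectionVars false
open scoped ComplexConjugate
open Filter Topology Set

def XX (u : ℝ → ℝ → ℂ) (T : ℝ) : ℝ := ∫ t in (-T)..T, ∫ x, ff u t x ^ 3
def HH (u : ℝ → ℝ → ℂ) (κ T : ℝ) : ℝ := ∫ t in (-T)..T, ∫ x, hh u κ t x

lemma Dec.ii {F : ℝ → ℝ → ℝ} (h : Dec F) (a b : ℝ) : IntervalIntegrable (fun t => ∫ x, F t x) volume a b :=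
  h.continuous_integral.intervalIntegrable _ _

section
variable {u ux uxx ut : ℝ → ℝ → ℂ} {κ M : ℝ} (H : St u ux uxx ut κ M)

lemma St.GB_t (H : St u ux uxx ut κ M) (t : ℝ) : Real.pi / 2 * (∫ x, hh u κ t x) - 4800 * Real.pi * M / κ ^ 3 * (∫ x, ff u t x ^ 3) ≤
    ∫ x, ∫ s, GB u ux κ s t x := by
  have hκ := H.pos
  have hM := H.M0
  have pi0 := Real.pi_pos
  have d1 := (Dec.cmul (-(Real.pi / (2 * κ))) (H.g.dfx.mul H.dmm))
  have d2 := (Dec.cmul (Real.pi / 2) (dphi H.g H.h).sq)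
  have d3 := (Dec.cmul (Real.pi * M / κ ^ 3) (Dec.cmul 2400 (H.g.df.cube.add H.deb.cube)))
  have h1 := integral_mono (((d1.sub d2).sub d3).integrable t) (H.sb_GB.fub1 H.dGBB t).2.1 (fun x => H.GB_pt t x)
  rw [integral_sub ((d1.sub d2).integrable t) (d3.integrable t), integral_sub (d1.integrable t) (d2.integrable t),
    integral_const_mul, integral_const_mul, integral_const_mul, integral_const_mul, integral_add (H.g.df.cube.integrable t) (H.deb.cube.integrable t),
    H.fx_mm t] at h1
  have h2 := H.phi_intg t
  have h3 := H.eb_intg t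
  have h4 := H.hh_intg t
  set F := ∫ x, ff u t x ^ 3
  have h5 : Real.pi * M / κ ^ 3 * (2400 * (F + ∫ x, eb u κ t x ^ 3)) ≤ Real.pi * M / κ ^ 3 * (2400 * (F + F)) := by gcongr
  have e5 : Real.pi * M / κ ^ 3 * (2400 * (F + F)) = 4800 * Real.pi * M / κ ^ 3 * F := by ring
  have h6 : Real.pi / 2 * (∫ x, phi u κ t x ^ 2) ≤ Real.pi / 2 * ∫ x, hh u κ t x := by gcongr
  have e7 : -(Real.pi / (2 * κ)) * (-(4 * κ * (∫ x, ff u t x ^ 2 )) + 4 * κ * ∫ x, ff u t x * mm u κ t x) =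
    Real.pi * ∫ x, hh u κ t x := by rw [h4]; field_simp; ring
  rw [e7] at h1
  linarith

lemma St.B_est (H : St u ux uxx ut κ M) (T : ℝ) (hT : 0 ≤ T) : Real.pi / 2 * HH u κ T ≤
    (∫ s, (NN u κ s T - NN u κ s (-T))) + 4800 * Real.pi * M / κ ^ 3 * XX u T := by
  obtain ⟨i1, i2, e⟩ := H.sb_GB.fub2 H.dGBB (a := -T) (b := T) (by linarith)
  simp_rw [B_ftc H.g H.h] at e
  rw [e]
  have j1 := (H.dhh.ii (-T) T).const_mul (Real.pi / 2)
  have j2 := (H.g.df.cube.ii (-T) T).const_mul (4800 * Real.pi * M / κ ^ 3)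
  have := intervalIntegral.integral_mono_on (by linarith : -T ≤ T) (j1.sub j2) i2 (fun t _ => H.GB_t t)
  rw [intervalIntegral.integral_sub j1 j2, intervalIntegral.integral_const_mul, intervalIntegral.integral_const_mul] at this
  unfold HH XX
  linarith
end

end PartBj

noncomputable section PartHi
set_option linter.unusedSectionVars false
open scoped ComplexConjugate
open Filter Topology Set

lemma mem2_of_bdd {g : ℝ → ℂ} (h1 : Integrable g) {K : ℝ} (hK : ∀ x, ‖g x‖ ≤ K) : MemLp g 2 := by
  rw [memLp_two_iff_integrable_sq_norm h1.1]
  refine (h1.norm.const_mul K).mono' (h1.1.norm.pow 2) (Eventually.of_forall fun r => ?_)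
  rw [Real.norm_of_nonneg (by positivity), pow_two]
  exact mul_le_mul_of_nonneg_right (hK r) (norm_nonneg _)

lemma CE_prod {l : ℝ} (hl : 0 < l) {g : ℝ → ℂ} (hc : Continuous g) (h1 : Integrable g) (s : ℝ) :
    Integrable (fun z : ℝ × ℝ => cexp (2 * I * s * z.1) * (cexp ((-l : ℝ) * z.2) * g (z.1 - z.2)))
      (volume.prod (volume.restrict (Ioi 0))) := by
  have n1 : ∀ x : ℝ, ‖cexp (2 * I * s * x)‖ = 1 := fun x => by
    have : (2 * I * s * x : ℂ) = ((2 * s * x : ℝ) : ℂ) * I := by push_cast; ring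
    rw [this, norm_exp_ofReal_mul_I]
  have n2 : ∀ r : ℝ, ‖cexp ((-l : ℝ) * r)‖ = Real.exp (-l * r) := fun r => by
    rw [← ofReal_mul, norm_exp_ofReal]
  have cc : Continuous (fun z : ℝ × ℝ => cexp (2 * I * s * z.1) * (cexp ((-l : ℝ) * z.2) * g (z.1 - z.2))) := by fun_prop
  rw [integrable_prod_iff' cc.aestronglyMeasurable]
  constructor
  · refine Eventually.of_forall fun r => ?_
    have := ((h1.comp_sub_right r).norm.const_mul (Real.exp (-l * r)))
    refine this.mono' (Continuous.aestronglyMeasurable (by fun_prop)) (Eventually.of_forall fun x => ?_)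
    rw [norm_mul, norm_mul, n1, n2, one_mul]
  · simp_rw [norm_mul, n1, n2, one_mul, integral_const_mul]
    have e : ∀ r, ∫ x, ‖g (x - r)‖ = ∫ x, ‖g x‖ := fun r => integral_sub_right_eq_self (fun x => ‖g x‖) r
    simp_rw [e]
    exact (exp_int hl).mul_const _

lemma CE_L1 {l : ℝ} (hl : 0 < l) {g : ℝ → ℂ} (hc : Continuous g) (h1 : Integrable g) : Integrable (CE (-l : ℝ) g) := by
  have := (CE_prod hl hc h1 0).integral_prod_left
  refine this.congr (Eventually.of_forall fun x => ?_)
  simp [CE]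

lemma CE_L2 {l : ℝ} (hl : 0 < l) {g : ℝ → ℂ} (hc : Continuous g) (h1 : Integrable g) {K : ℝ} (hK : ∀ x, ‖g x‖ ≤ K) :
    MemLp (CE (-l : ℝ) g) 2 := by
  refine mem2_of_bdd (CE_L1 hl hc h1) (K := K / l) fun x => ?_
  refine (CE_norm_le x).trans ?_
  rw [ofReal_re, neg_neg]
  exact EE_le_const hl hc.norm (fun x => by rw [abs_of_nonneg (norm_nonneg _)]; exact hK x) x

lemma FT_CE {l : ℝ} (hl : 0 < l) {g : ℝ → ℂ} (hc : Continuous g) (h1 : Integrable g) (s : ℝ) :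
    FT (CE (-l : ℝ) g) s = FT g s / (l - 2 * I * s) := by
  have h := integral_integral_swap (f := fun (x r : ℝ) => cexp (2 * I * s * x) * (cexp ((-l : ℝ) * r) * g (x - r))) (CE_prod hl hc h1 s)
  have e1 : FT (CE (-l : ℝ) g) s = ∫ x : ℝ, ∫ r in Ioi (0 : ℝ), cexp (2 * I * s * x) * (cexp ((-l : ℝ) * r) * g (x - r)) := by
    unfold FT CE
    simp_rw [integral_const_mul]
  have e2 : ∀ r : ℝ, ∫ x : ℝ, cexp (2 * I * s * x) * (cexp ((-l : ℝ) * r) * g (x - r)) = cexp ((2 * I * s - l) * r) * FT g s := by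
    intro r
    have := integral_sub_right_eq_self (μ := volume) (fun x : ℝ => cexp (2 * I * s * (x + r : ℝ)) * (cexp ((-l : ℝ) * r) * g x)) r
    simp only [sub_add_cancel] at this
    rw [this]
    unfold FT
    rw [← integral_const_mul]
    congr 1; ext x
    have : cexp (2 * I * s * (x + r : ℝ)) * cexp ((-l : ℝ) * r) = cexp ((2 * I * s - l) * r) * cexp (2 * I * s * x) := by
      rw [← Complex.exp_add, ← Complex.exp_add]; congr 1; push_cast; ring
    rw [← mul_assoc, this, mul_assoc]
  rw [e1, h]
  simp_rw [e2]
  rw [integral_mul_const]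
  have hre : (2 * I * s - l : ℂ).re < 0 := by simp; exact hl
  have h3 := integral_exp_mul_complex_Ioi hre 0
  rw [h3]
  have hne : (2 * I * s - l : ℂ) ≠ 0 := fun h => by rw [h] at hre; simp at hre
  have hne' : (l - 2 * I * s : ℂ) ≠ 0 := fun h => hne (by rw [← neg_sub, h, neg_zero])
  field_simp
  simp
  ring

lemma CE_im {l : ℝ} (hl : 0 < l) {g : ℝ → ℂ} (hc : Continuous g) (h1 : Integrable g) {K : ℝ} (hK : ∀ x, ‖g x‖ ≤ K) :
    Real.pi * (∫ x, g x * conj (CE (-l : ℝ) g x)).im = ∫ s, -(2 * s / (l ^ 2 + 4 * s ^ 2)) * ‖FT g s‖ ^ 2 := by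
  have h := FT_inner (CE_L1 hl hc h1) (CE_L2 hl hc h1 hK) h1 (mem2_of_bdd h1 hK)
  have e : Real.pi * (∫ x, g x * conj (CE (-l : ℝ) g x)).im = (Real.pi * ∫ x, g x * conj (CE (-l : ℝ) g x) : ℂ).im := by
    rw [im_ofReal_mul]
  rw [e, ← h]
  have i : Integrable (fun s => FT g s * conj (FT (CE (-l : ℝ) g) s)) :=
    (FT_memLp h1 (mem2_of_bdd h1 hK)).integrable_mul (FT_memLp (CE_L1 hl hc h1) (CE_L2 hl hc h1 hK)).star
  have e2 := integral_im (𝕜 := ℂ) i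
  simp only [RCLike.im_to_complex] at e2
  rw [← e2]
  congr 1; ext s
  rw [FT_CE hl hc h1]
  have : FT g s * conj (FT g s / (l - 2 * I * s)) = ((‖FT g s‖ ^ 2 : ℝ) : ℂ) * (conj (l - 2 * I * s : ℂ))⁻¹ := by
    rw [map_div₀, ← mul_div_assoc, mul_conj, normSq_eq_norm_sq]; rfl
  rw [this, im_ofReal_mul]
  simp [Complex.inv_im, normSq_apply]
  ring

/-- dyadic telescoping -/
lemma dy_sum {k0 : ℝ} (hk : 0 < k0) (z : ℝ) (hz : 0 ≤ z) (J : ℕ) :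
    ∑ j ∈ Finset.range J, (2 ^ j * k0) * (2 * z / ((4 * (2 ^ j * k0)) ^ 2 + 4 * z ^ 2)) ≤ 5 / 4 := by
  have key : ∀ k : ℝ, 0 < k → k * (2 * z / ((4 * k) ^ 2 + 4 * z ^ 2)) ≤ 5 / 4 * (z / (k + z) - z / (2 * k + z)) := by
    intro k hk
    have e : z / (k + z) - z / (2 * k + z) = k * z / ((k + z) * (2 * k + z)) := by field_simp; ring
    rw [e, ← mul_div_assoc, ← mul_div_assoc, div_le_div_iff₀ (by positivity) (by positivity)]
    have : 0 ≤ k * z := by positivity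
    nlinarith [mul_nonneg this (sq_nonneg (k - z)), mul_nonneg this (sq_nonneg k), mul_nonneg this (sq_nonneg z)]
  have h : ∀ J : ℕ, ∑ j ∈ Finset.range J, (2 ^ j * k0) * (2 * z / ((4 * (2 ^ j * k0)) ^ 2 + 4 * z ^ 2)) ≤
      5 / 4 * (z / (k0 + z) - z / (2 ^ J * k0 + z)) := by
    intro J
    induction J with
    | zero => simp
    | succ n ih =>
      rw [Finset.sum_range_succ]
      have := key (2 ^ n * k0) (by positivity)
      have e : 2 * (2 ^ n * k0) = 2 ^ (n + 1) * k0 := by ring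
      rw [e] at this
      linarith
  refine (h J).trans ?_
  have h1 : z / (k0 + z) ≤ 1 := (div_le_one (by positivity)).2 (by linarith)
  have h2 : 0 ≤ z / (2 ^ J * k0 + z) := by positivity
  linarith

lemma hil {k0 : ℝ} (hk : 0 < k0) {g : ℝ → ℂ} (hc : Continuous g) (h1 : Integrable g) {K : ℝ} (hK : ∀ x, ‖g x‖ ≤ K) (J : ℕ) :
    |∑ j ∈ Finset.range J, (2 ^ j * k0) * (∫ x, g x * conj (CE (-(4 * (2 ^ j * k0)) : ℝ) g x)).im| ≤ 5 / 4 * ∫ x, ‖g x‖ ^ 2 := by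
  have pi0 := Real.pi_pos
  have h2 := mem2_of_bdd h1 hK
  have iF := FT_integrable_sq h1 h2
  have hm : AEStronglyMeasurable (fun s => ‖FT g s‖ ^ 2) volume := iF.1
  have c : ∀ j : ℕ, Continuous fun s : ℝ => (2 ^ j * k0) * -(2 * s / ((4 * (2 ^ j * k0)) ^ 2 + 4 * s ^ 2)) := fun j =>
    continuous_const.mul (Continuous.neg (Continuous.div (by fun_prop) (by fun_prop) fun s => by positivity))
  set W : ℝ → ℝ := fun s => ∑ j ∈ Finset.range J, (2 ^ j * k0) * -(2 * s / ((4 * (2 ^ j * k0)) ^ 2 + 4 * s ^ 2)) with hW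
  have cW : Continuous W := continuous_finsetSum _ fun j _ => c j
  have bW : ∀ s, |W s| ≤ 5 / 4 := by
    intro s
    refine (Finset.abs_sum_le_sum_abs _ _).trans (le_trans (le_of_eq (Finset.sum_congr rfl fun j _ => ?_)) (dy_sum hk |s| (abs_nonneg s) J))
    rw [abs_mul, abs_neg, abs_div, abs_mul 2 s, sq_abs, abs_of_nonneg (by positivity : (0:ℝ) ≤ 2 ^ j * k0), abs_of_nonneg (by positivity : (0:ℝ) ≤ (4 * (2 ^ j * k0)) ^ 2 + 4 * s ^ 2)]
    norm_num
  have ij : ∀ j ∈ Finset.range J, Integrable fun s => (2 ^ j * k0) * -(2 * s / ((4 * (2 ^ j * k0)) ^ 2 + 4 * s ^ 2)) * ‖FT g s‖ ^ 2 := by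
    intro j _
    refine (iF.const_mul (5 / 4)).mono' ((c j).aestronglyMeasurable.mul hm) (Eventually.of_forall fun s => ?_)
    rw [norm_mul, Real.norm_of_nonneg (by positivity : 0 ≤ ‖FT g s‖ ^ 2)]
    refine mul_le_mul_of_nonneg_right ?_ (by positivity)
    have hd := dy_sum (k0 := 2 ^ j * k0) (by positivity) |s| (abs_nonneg s) 1
    simp only [Finset.sum_range_one, pow_zero, one_mul, sq_abs] at hd
    rw [Real.norm_eq_abs, abs_mul, abs_neg, abs_div, abs_mul 2 s, abs_of_nonneg (by positivity : (0:ℝ) ≤ 2 ^ j * k0), abs_of_nonneg (by positivity : (0:ℝ) ≤ (4 * (2 ^ j * k0)) ^ 2 + 4 * s ^ 2)]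
    simpa using hd
  have e : Real.pi * ∑ j ∈ Finset.range J, (2 ^ j * k0) * (∫ x, g x * conj (CE (-(4 * (2 ^ j * k0)) : ℝ) g x)).im = ∫ s, W s * ‖FT g s‖ ^ 2 := by
    simp only [hW, Finset.sum_mul]
    rw [integral_finsetSum _ ij, Finset.mul_sum]
    refine Finset.sum_congr rfl fun j _ => ?_
    have := CE_im (l := 4 * (2 ^ j * k0)) (by positivity) hc h1 hK
    simp_rw [mul_assoc (2 ^ j * k0)]
    rw [integral_const_mul, ← this]; ring
  have h3 : |∫ s, W s * ‖FT g s‖ ^ 2| ≤ ∫ s, 5 / 4 * ‖FT g s‖ ^ 2 := by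
    rw [← Real.norm_eq_abs]
    refine norm_integral_le_of_norm_le (iF.const_mul _) (Eventually.of_forall fun s => ?_)
    rw [norm_mul, Real.norm_of_nonneg (by positivity : 0 ≤ ‖FT g s‖ ^ 2)]
    exact mul_le_mul_of_nonneg_right (bW s) (by positivity)
  rw [integral_const_mul, FT_sq h1 h2, ← e, abs_mul, abs_of_pos pi0] at h3
  refine le_of_mul_le_mul_left (h3.trans (le_of_eq ?_)) pi0
  ring

end PartHi

noncomputable section PartBk
set_option linter.unusedSectionVars false
open scoped ComplexConjugate
open Filter Topology Set

lemma cs_s {F G : ℝ → ℝ} (cF : Continuous F) (cG : Continuous G) (F0 : ∀ s, 0 ≤ F s) (G0 : ∀ s, 0 ≤ G s)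
    (iF : Integrable fun s => F s ^ 2) (iG : Integrable fun s => G s ^ 2) {A B : ℝ} (hA : 0 ≤ A) (hB : 0 ≤ B)
    (hF : ∫ s, F s ^ 2 ≤ A ^ 2) (hG : ∫ s, G s ^ 2 ≤ B ^ 2) : Integrable (fun s => F s * G s) ∧ ∫ s, F s * G s ≤ A * B := by
  have mF : MemLp F 2 := (memLp_two_iff_integrable_sq cF.aestronglyMeasurable).2 iF
  have mG : MemLp G 2 := (memLp_two_iff_integrable_sq cG.aestronglyMeasurable).2 iG
  refine ⟨mF.integrable_mul mG, ?_⟩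
  have h := integral_mul_le_Lp_mul_Lq_of_nonneg (μ := volume) (Real.HolderConjugate.two_two) (Eventually.of_forall F0) (Eventually.of_forall G0)
    (by simpa using mF) (by simpa using mG)
  refine h.trans ?_
  rw [← Real.sqrt_eq_rpow, ← Real.sqrt_eq_rpow]
  simp only [Real.rpow_two]
  exact mul_le_mul (Real.sqrt_le_iff.2 ⟨hA, hF⟩) (Real.sqrt_le_iff.2 ⟨hB, hG⟩) (Real.sqrt_nonneg _) hA

/-- the measure on pairs `(y, d)` -/
def nuu : Measure (ℝ × ℝ) := (volume : Measure ℝ).prod (volume.restrict (Ioi (0 : ℝ)))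
instance : SFinite nuu := by unfold nuu; infer_instance

lemma qq_int {q : ℝ → ℝ} (hc : Continuous q) (h0 : ∀ x, 0 ≤ q x) (hi : Integrable q) :
    Integrable (fun z : ℝ × ℝ => q (z.1 - z.2) * q z.1) nuu ∧ ∫ z, q (z.1 - z.2) * q z.1 ∂nuu ≤ (∫ x, q x) ^ 2 := by
  have cc : Continuous (fun z : ℝ × ℝ => q (z.1 - z.2) * q z.1) := by fun_prop
  have h1 : ∀ y, Integrable (fun d => q (y - d)) := fun y => hi.comp_sub_left y
  have h2 : ∀ y, ∫ d in Ioi (0 : ℝ), q (y - d) * q y ≤ (∫ x, q x) * q y := by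
    intro y
    rw [integral_mul_const]
    refine mul_le_mul_of_nonneg_right ?_ (h0 y)
    rw [← integral_sub_left_eq_self q volume y]
    exact setIntegral_le_integral (h1 y) (Eventually.of_forall fun d => h0 _)
  have i : Integrable (fun z : ℝ × ℝ => q (z.1 - z.2) * q z.1) nuu := by
    unfold nuu
    rw [integrable_prod_iff cc.aestronglyMeasurable]
    refine ⟨Eventually.of_forall fun y => ((h1 y).mul_const (q y)).integrableOn, ?_⟩
    refine (hi.const_mul (∫ x, q x)).mono' (cc.norm.aestronglyMeasurable.integral_prod_right') (Eventually.of_forall fun y => ?_)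
    rw [Real.norm_of_nonneg (integral_nonneg fun s => norm_nonneg _)]
    simp_rw [norm_mul, Real.norm_of_nonneg (h0 _)]
    exact h2 y
  refine ⟨i, ?_⟩
  unfold nuu at i ⊢
  rw [integral_prod _ i]
  refine (integral_mono i.integral_prod_left (hi.const_mul (∫ x, q x)) h2).trans (le_of_eq ?_)
  rw [integral_const_mul, pow_two]

structure PB (P : ℝ → ℝ → ℝ → ℝ) (c : ℝ) (q : ℝ → ℝ) : Prop where
  c0 : 0 ≤ c
  cq : Continuous q
  q0 : ∀ x, 0 ≤ q x
  iq : Integrable q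
  cP : Continuous fun z : ℝ × ℝ × ℝ => P z.1 z.2.1 z.2.2
  hi : ∀ x y, Integrable (fun s => P s x y) ∧ ∫ s, |P s x y| ≤ c * (q x * q y)

lemma PB.int {P : ℝ → ℝ → ℝ → ℝ} {c : ℝ} {q : ℝ → ℝ} (h : PB P c q) :
    Integrable (fun z : ℝ × ℝ × ℝ => P z.1 (z.2.1 - z.2.2) z.2.1) (volume.prod nuu) := by
  have cc : Continuous (fun z : ℝ × ℝ × ℝ => P z.1 (z.2.1 - z.2.2) z.2.1) :=
    Continuous.comp (g := fun z : ℝ × ℝ × ℝ => P z.1 z.2.1 z.2.2) h.cP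
      (by fun_prop : Continuous fun z : ℝ × ℝ × ℝ => (z.1, z.2.1 - z.2.2, z.2.1))
  rw [integrable_prod_iff' cc.aestronglyMeasurable]
  refine ⟨Eventually.of_forall fun z => (h.hi (z.1 - z.2) z.1).1, ?_⟩
  refine ((qq_int h.cq h.q0 h.iq).1.const_mul c).mono' (cc.norm.aestronglyMeasurable.prod_swap.integral_prod_right') (Eventually.of_forall fun z => ?_)
  rw [Real.norm_of_nonneg (integral_nonneg fun s => norm_nonneg _)]
  exact (h.hi (z.1 - z.2) z.1).2

lemma PB.bd {P : ℝ → ℝ → ℝ → ℝ} {c : ℝ} {q : ℝ → ℝ} (h : PB P c q) :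
    |∫ s, ∫ z, P s (z.1 - z.2) z.1 ∂nuu| ≤ c * (∫ x, q x) ^ 2 := by
  have i := h.int
  rw [integral_integral_swap (f := fun s (z : ℝ × ℝ) => P s (z.1 - z.2) z.1) i]
  obtain ⟨j1, j2⟩ := qq_int h.cq h.q0 h.iq
  rw [← Real.norm_eq_abs]
  refine (norm_integral_le_of_norm_le (j1.const_mul c) (Eventually.of_forall fun z => ?_)).trans ?_
  · exact (abs_integral_le_integral_abs).trans (h.hi _ _).2
  · rw [integral_const_mul]
    exact mul_le_mul_of_nonneg_left j2 h.c0

def PP (u : ℝ → ℝ → ℂ) (κ t s x y : ℝ) : ℝ := (conj (u t x) * ww u κ s t x * conj (conj (u t y) * ww u κ s t y)).im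
def P11 (u : ℝ → ℝ → ℂ) (κ t s x y : ℝ) : ℝ := (conj (u t x) * w1 u κ s t x * conj (conj (u t y) * w1 u κ s t y)).im
def qu (u : ℝ → ℝ → ℂ) (κ t x : ℝ) : ℝ := ‖u t x‖ * √(E0 u κ t x)
def gd (u : ℝ → ℝ → ℂ) (t d y : ℝ) : ℂ := conj (u t (y - d)) * u t y

lemma cxy {G : ℝ → ℝ → ℝ → ℂ} (hG : Continuous fun z : ℝ × ℝ × ℝ => G z.1 z.2.1 z.2.2) (t : ℝ) :
    Continuous (fun z : ℝ × ℝ × ℝ => G z.1 t z.2.1) ∧ Continuous (fun z : ℝ × ℝ × ℝ => G z.1 t z.2.2) :=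
  ⟨Continuous.comp (g := fun z : ℝ × ℝ × ℝ => G z.1 z.2.1 z.2.2) hG (by fun_prop : Continuous fun z : ℝ × ℝ × ℝ => (z.1, t, z.2.1)),
   Continuous.comp (g := fun z : ℝ × ℝ × ℝ => G z.1 z.2.1 z.2.2) hG (by fun_prop : Continuous fun z : ℝ × ℝ × ℝ => (z.1, t, z.2.2))⟩

section
variable {u ux uxx ut : ℝ → ℝ → ℂ} {κ M : ℝ} (H : St u ux uxx ut κ M)

lemma St.q_c (H : St u ux uxx ut κ M) (t : ℝ) : Continuous (qu u κ t) := (H.g.du.cx t).norm.mul (H.dE.cx t).sqrt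

lemma St.q_nn (H : St u ux uxx ut κ M) (t x : ℝ) : 0 ≤ qu u κ t x := mul_nonneg (norm_nonneg _) (Real.sqrt_nonneg _)

lemma St.q_le (H : St u ux uxx ut κ M) {c : ℝ} (hc : 0 < c) (t x : ℝ) : qu u κ t x ≤ 1 / 2 * (c * ff u t x + c⁻¹ * E0 u κ t x) := by
  have h1 := Real.sq_sqrt (H.E_nonneg t x)
  rw [← h1, H.ff_eq_norm]
  unfold qu
  have : 0 ≤ c⁻¹ * (c * ‖u t x‖ - √(E0 u κ t x)) ^ 2 := by positivity
  have e : c⁻¹ * (c * ‖u t x‖ - √(E0 u κ t x)) ^ 2 = c * ‖u t x‖ ^ 2 + c⁻¹ * √(E0 u κ t x) ^ 2 - 2 * (‖u t x‖ * √(E0 u κ t x)) := by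
    field_simp; ring
  linarith

lemma St.q_i (H : St u ux uxx ut κ M) (t : ℝ) : Integrable (qu u κ t) := by
  have d := Dec.cmul (1 / 2) ((Dec.cmul 1 H.g.df).add (Dec.cmul (1⁻¹) H.dE))
  refine (d.integrable t).mono' (H.q_c t).aestronglyMeasurable (Eventually.of_forall fun x => ?_)
  rw [Real.norm_of_nonneg (H.q_nn t x)]
  exact H.q_le one_pos t x

lemma St.q_intg (H : St u ux uxx ut κ M) (t : ℝ) : (∫ x, qu u κ t x) ^ 2 ≤ 2 * M ^ 2 / κ := by
  have hκ := H.pos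
  have hM := H.M0
  set c := √(2 / κ) with hc
  have c0 : 0 < c := Real.sqrt_pos.2 (by positivity)
  have c2 : c ^ 2 = 2 / κ := Real.sq_sqrt (by positivity)
  have d1 := Dec.cmul c H.g.df
  have d2 := Dec.cmul c⁻¹ H.dE
  have h := integral_mono (H.q_i t) ((Dec.cmul (1 / 2) (d1.add d2)).integrable t) (fun x => H.q_le c0 t x)
  rw [integral_const_mul, integral_add (d1.integrable t) (d2.integrable t), integral_const_mul, integral_const_mul, H.hM, H.E_intg] at h
  have e : 1 / 2 * (c * M + c⁻¹ * (2 * M / κ)) = c * M := by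
    have : 2 * M / κ = c ^ 2 * M := by rw [c2]; ring
    rw [this]; field_simp; ring
  rw [e] at h
  have h2 := pow_le_pow_left₀ (integral_nonneg fun x => H.q_nn t x) h 2
  refine h2.trans (le_of_eq ?_)
  rw [mul_pow, c2]; ring

lemma St.sq_w (H : St u ux uxx ut κ M) (t x : ℝ) : Integrable (fun s => ‖ww u κ s t x‖ ^ 2) ∧
    ∫ s, ‖ww u κ s t x‖ ^ 2 ≤ (2 * √Real.pi * √(E0 u κ t x)) ^ 2 := by
  obtain ⟨i, h⟩ := H.sb_p.2 t x
  simp_rw [abs_of_nonneg (H.p_nn _ t x)] at h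
  simp only [pp, normSq_eq_norm_sq] at i h
  refine ⟨i, h.trans (le_of_eq ?_)⟩
  rw [mul_pow, mul_pow, Real.sq_sqrt Real.pi_pos.le, Real.sq_sqrt (H.E_nonneg t x)]; ring

lemma St.sq_w1 (H : St u ux uxx ut κ M) (t x : ℝ) : Integrable (fun s => ‖w1 u κ s t x‖ ^ 2) ∧
    ∫ s, ‖w1 u κ s t x‖ ^ 2 ≤ (√Real.pi * √(E0 u κ t x)) ^ 2 := by
  obtain ⟨i, h⟩ := H.sb_p1.2 t x
  have e : ∀ s, |p1 u κ s t x| = p1 u κ s t x := fun s => abs_of_nonneg (normSq_nonneg _)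
  simp_rw [e] at h
  simp only [p1, normSq_eq_norm_sq] at i h
  refine ⟨i, h.trans (le_of_eq ?_)⟩
  rw [mul_pow, Real.sq_sqrt Real.pi_pos.le, Real.sq_sqrt (H.E_nonneg t x)]

lemma St.sq_D (H : St u ux uxx ut κ M) (t x : ℝ) : Integrable (fun s => DD u κ s t x ^ 2) ∧
    ∫ s, DD u κ s t x ^ 2 ≤ (2 * √Real.pi * (M / κ) * √(E0 u κ t x)) ^ 2 := by
  have hκ := H.pos
  have hM := H.M0
  have e0 := H.E_nonneg t x
  have pi0 := Real.pi_pos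
  obtain ⟨i, h⟩ := H.sb_D2.2 t x
  have e : ∀ s, |DD u κ s t x ^ 2| = DD u κ s t x ^ 2 := fun s => abs_of_nonneg (sq_nonneg _)
  simp_rw [e] at h
  refine ⟨i, h.trans ?_⟩
  rw [mul_pow, mul_pow, mul_pow, Real.sq_sqrt Real.pi_pos.le, Real.sq_sqrt (H.E_nonneg t x)]
  have h1 : E0 u κ t x ^ 2 ≤ M ^ 2 := pow_le_pow_left₀ e0 (H.E_le t x) 2
  calc 2 * Real.pi * E0 u κ t x ^ 3 / κ ^ 2 = 2 * Real.pi / κ ^ 2 * E0 u κ t x * E0 u κ t x ^ 2 := by ring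
    _ ≤ 2 * Real.pi / κ ^ 2 * E0 u κ t x * M ^ 2 := by gcongr
    _ ≤ 4 * Real.pi / κ ^ 2 * E0 u κ t x * M ^ 2 := by gcongr; norm_num
    _ = _ := by ring

lemma St.ws_c (H : St u ux uxx ut κ M) (t x : ℝ) : Continuous (fun s => ww u κ s t x) := C3.cs H.h.w_c3 t x
lemma St.w1s_c (H : St u ux uxx ut κ M) (t x : ℝ) : Continuous (fun s => w1 u κ s t x) := w1_cs H.h t x
lemma St.Ds_c (H : St u ux uxx ut κ M) (t x : ℝ) : Continuous (fun s => DD u κ s t x) := ((H.ws_c t x).sub (H.w1s_c t x)).norm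

lemma St.cPP (H : St u ux uxx ut κ M) (t : ℝ) : Continuous fun z : ℝ × ℝ × ℝ => PP u κ t z.1 z.2.1 z.2.2 := by
  have a := cxy (G := fun s t x => conj (u t x) * ww u κ s t x) (H.c_u.star.mul H.c_ww) t
  exact continuous_im.comp (a.1.mul a.2.star)

lemma St.cP11 (H : St u ux uxx ut κ M) (t : ℝ) : Continuous fun z : ℝ × ℝ × ℝ => P11 u κ t z.1 z.2.1 z.2.2 := by
  have a := cxy (G := fun s t x => conj (u t x) * w1 u κ s t x) (H.c_u.star.mul H.c_w1) t
  exact continuous_im.comp (a.1.mul a.2.star)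

lemma St.pb_dom (H : St u ux uxx ut κ M) (t : ℝ) {P : ℝ → ℝ → ℝ → ℝ} {c : ℝ} (c0 : 0 ≤ c) (hP : Continuous fun z : ℝ × ℝ × ℝ => P z.1 z.2.1 z.2.2)
    {F : ℝ → ℝ → ℝ → ℝ} (hF : ∀ x y, Integrable (fun s => F s x y) ∧ ∫ s, F s x y ≤ c * (√(E0 u κ t x) * √(E0 u κ t y)))
    (hle : ∀ s x y, |P s x y| ≤ ‖u t x‖ * ‖u t y‖ * F s x y) : PB P c (qu u κ t) := by
  refine ⟨c0, H.q_c t, H.q_nn t, H.q_i t, hP, fun x y => ?_⟩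
  obtain ⟨i, h⟩ := hF x y
  have i' := i.const_mul (‖u t x‖ * ‖u t y‖)
  have i2 : Integrable (fun s => P s x y) :=
    i'.mono' (c3s hP x y).aestronglyMeasurable (Eventually.of_forall fun s => hle s x y)
  refine ⟨i2, ?_⟩
  calc ∫ s, |P s x y| ≤ ∫ s, ‖u t x‖ * ‖u t y‖ * F s x y := integral_mono i2.norm i' fun s => hle s x y
    _ = ‖u t x‖ * ‖u t y‖ * ∫ s, F s x y := integral_const_mul _ _
    _ ≤ ‖u t x‖ * ‖u t y‖ * (c * (√(E0 u κ t x) * √(E0 u κ t y))) := by gcongr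
    _ = _ := by unfold qu; ring

lemma St.pbP (H : St u ux uxx ut κ M) (t : ℝ) : PB (PP u κ t) (4 * Real.pi) (qu u κ t) := by
  have pi0 := Real.pi_pos
  refine H.pb_dom t (by positivity) (H.cPP t) (F := fun s x y => ‖ww u κ s t x‖ * ‖ww u κ s t y‖) (fun x y => ?_) (fun s x y => ?_)
  · obtain ⟨i1, h1⟩ := H.sq_w t x
    obtain ⟨i2, h2⟩ := H.sq_w t y
    obtain ⟨i, h⟩ := cs_s (H.ws_c t x).norm (H.ws_c t y).norm (fun s => norm_nonneg _) (fun s => norm_nonneg _) i1 i2 (by positivity) (by positivity) h1 h2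
    refine ⟨i, h.trans (le_of_eq ?_)⟩
    have := Real.sq_sqrt Real.pi_pos.le
    linear_combination 4 * √(E0 u κ t x) * √(E0 u κ t y) * this
  · refine (abs_im_le_norm _).trans (le_of_eq ?_)
    simp only [norm_mul, RCLike.norm_conj]; ring

lemma St.pbP11 (H : St u ux uxx ut κ M) (t : ℝ) : PB (P11 u κ t) Real.pi (qu u κ t) := by
  have pi0 := Real.pi_pos
  refine H.pb_dom t (by positivity) (H.cP11 t) (F := fun s x y => ‖w1 u κ s t x‖ * ‖w1 u κ s t y‖) (fun x y => ?_) (fun s x y => ?_)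
  · obtain ⟨i1, h1⟩ := H.sq_w1 t x
    obtain ⟨i2, h2⟩ := H.sq_w1 t y
    obtain ⟨i, h⟩ := cs_s (H.w1s_c t x).norm (H.w1s_c t y).norm (fun s => norm_nonneg _) (fun s => norm_nonneg _) i1 i2 (by positivity) (by positivity) h1 h2
    refine ⟨i, h.trans (le_of_eq ?_)⟩
    have := Real.sq_sqrt Real.pi_pos.le
    linear_combination √(E0 u κ t x) * √(E0 u κ t y) * this
  · refine (abs_im_le_norm _).trans (le_of_eq ?_)
    simp only [norm_mul, RCLike.norm_conj]; ring

lemma St.pbD (H : St u ux uxx ut κ M) (t : ℝ) : PB (fun s x y => PP u κ t s x y - P11 u κ t s x y) (6 * Real.pi * (M / κ)) (qu u κ t) := by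
  have pi0 := Real.pi_pos
  have hκ := H.pos
  have hM := H.M0
  refine H.pb_dom t (by positivity) ((H.cPP t).sub (H.cP11 t))
    (F := fun s x y => DD u κ s t x * ‖ww u κ s t y‖ + ‖w1 u κ s t x‖ * DD u κ s t y) (fun x y => ?_) (fun s x y => ?_)
  · obtain ⟨i1, h1⟩ := H.sq_D t x
    obtain ⟨i2, h2⟩ := H.sq_w t y
    obtain ⟨i3, h3⟩ := H.sq_w1 t x
    obtain ⟨i4, h4⟩ := H.sq_D t y
    obtain ⟨i, h⟩ := cs_s (H.Ds_c t x) (H.ws_c t y).norm (fun s => norm_nonneg _) (fun s => norm_nonneg _) i1 i2 (by positivity) (by positivity) h1 h2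
    obtain ⟨j, k⟩ := cs_s (H.w1s_c t x).norm (H.Ds_c t y) (fun s => norm_nonneg _) (fun s => norm_nonneg _) i3 i4 (by positivity) (by positivity) h3 h4
    refine ⟨i.add j, ?_⟩
    rw [integral_add i j]
    refine (add_le_add h k).trans (le_of_eq ?_)
    have := Real.sq_sqrt Real.pi_pos.le
    linear_combination 6 * (M / κ) * √(E0 u κ t x) * √(E0 u κ t y) * this
  · unfold PP P11 DD
    have e : conj (u t x) * ww u κ s t x * conj (conj (u t y) * ww u κ s t y) - conj (u t x) * w1 u κ s t x * conj (conj (u t y) * w1 u κ s t y) =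
      conj (u t x) * u t y * ((ww u κ s t x - w1 u κ s t x) * conj (ww u κ s t y) + w1 u κ s t x * conj (ww u κ s t y - w1 u κ s t y)) := by
      simp only [map_mul, map_sub, conj_conj]; ring
    rw [← sub_im, e]
    refine (abs_im_le_norm _).trans ?_
    rw [norm_mul, norm_mul, RCLike.norm_conj]
    refine mul_le_mul_of_nonneg_left ((norm_add_le _ _).trans (le_of_eq ?_)) (by positivity)
    simp only [norm_mul, RCLike.norm_conj]

end

end PartBk

noncomputable section PartBl
set_option linter.unusedSectionVars false
open scoped ComplexConjugate
open Filter Topology Set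

lemma Iic_shift (F : ℝ → ℝ) (y : ℝ) : ∫ x in Iic y, F x = ∫ d in Ioi (0 : ℝ), F (y - d) := by
  rw [integral_Iic_eq_integral_Iio]
  have h := integral_sub_left_eq_self (fun x => (Iio y).indicator F x) volume y
  rw [integral_indicator measurableSet_Iio] at h
  rw [← h, ← integral_indicator measurableSet_Ioi]
  congr 1; ext d
  by_cases hd : 0 < d
  · rw [indicator_of_mem (by simpa using hd), indicator_of_mem (by simpa using hd)]
  · rw [indicator_of_notMem (by simpa using hd), indicator_of_notMem (by simpa using hd)]

section
variable {u ux uxx ut : ℝ → ℝ → ℂ} {κ M : ℝ} (H : St u ux uxx ut κ M)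

lemma St.NN_eq (H : St u ux uxx ut κ M) (t : ℝ) : (fun s => NN u κ s t) =ᵐ[volume] fun s => ∫ z, PP u κ t s (z.1 - z.2) z.1 ∂nuu := by
  filter_upwards [(H.pbP t).int.prod_right_ae] with s hs
  have da := da H.g H.h s
  have db := db H.g H.h s
  unfold nuu at hs ⊢
  rw [integral_prod _ hs]
  have j : ∀ {F : ℝ → ℝ} (_ : Integrable F) (y : ℝ), IntegrableOn (fun d => F (y - d)) (Ioi 0) := fun hF y =>
    (hF.comp_sub_left y).integrableOn
  have bdd : ∀ {F G : ℝ → ℝ → ℝ}, Dec F → Dec G → Integrable (fun y => G t y * ∫ x in Iic y, F t x) := by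
    intro F G hF hG
    obtain ⟨C, hC, hb⟩ := Cons.prim_bd hF |t|
    have cc : Continuous (fun y => ∫ x in Iic y, F t x) := continuous_iff_continuousAt.2 fun y => (Cons.prim_x hF t y).continuousAt
    refine ((hG.integrable t).norm.mul_const C).mono' ((hG.cx t).mul cc).aestronglyMeasurable (Eventually.of_forall fun y => ?_)
    rw [norm_mul]
    exact mul_le_mul_of_nonneg_left (hb t y le_rfl) (norm_nonneg _)
  unfold NN Inta
  rw [← integral_sub (bdd db da) (bdd da db)]
  congr 1; ext y
  rw [Iic_shift, Iic_shift, ← integral_const_mul, ← integral_const_mul, ← integral_sub ((j (db.integrable t) y).const_mul _) ((j (da.integrable t) y).const_mul _)]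
  congr 1; ext d
  unfold PP aa bb
  simp only [mul_im, conj_re, conj_im]
  ring

lemma St.NN_i (H : St u ux uxx ut κ M) (t : ℝ) : Integrable (fun s => NN u κ s t) :=
  ((H.pbP t).int.integral_prod_left).congr (H.NN_eq t).symm

lemma St.gd_c (H : St u ux uxx ut κ M) (t d : ℝ) : Continuous (gd u t d) := by
  have := H.g.du.cx t
  unfold gd; fun_prop

lemma St.gd_bd (H : St u ux uxx ut κ M) (t : ℝ) : ∃ K, ∀ d y, ‖gd u t d y‖ ≤ K := by
  obtain ⟨K, hK⟩ := H.g.du.bd1 t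
  refine ⟨K * K, fun d y => ?_⟩
  unfold gd
  rw [norm_mul, RCLike.norm_conj]
  exact mul_le_mul (hK _) (hK _) (norm_nonneg _) ((norm_nonneg _).trans (hK 0))

lemma St.gd_i (H : St u ux uxx ut κ M) (t d : ℝ) : Integrable (gd u t d) := by
  obtain ⟨K, hK⟩ := H.g.du.bd1 t
  refine ((H.g.du.integrable t).norm.const_mul K).mono' (H.gd_c t d).aestronglyMeasurable (Eventually.of_forall fun y => ?_)
  unfold gd
  rw [norm_mul, RCLike.norm_conj]
  exact mul_le_mul_of_nonneg_right (hK _) (norm_nonneg _)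

lemma St.P11_s (H : St u ux uxx ut κ M) (t d y : ℝ) : ∫ s, P11 u κ t s (y - d) y = Real.pi * (gd u t d y * conj (CE (-(4 * κ) : ℝ) (gd u t d) y)).im := by
  have hw := w1_inner H.h t (y - d) y
  have i : Integrable (fun s => gd u t d y * (w1 u κ s t (y - d) * conj (w1 u κ s t y))) := by
    have h1 := (memLp_two_iff_integrable_sq_norm (H.w1s_c t (y - d)).aestronglyMeasurable).2 (H.sq_w1 t (y - d)).1
    have h2 := (memLp_two_iff_integrable_sq_norm (H.w1s_c t y).aestronglyMeasurable).2 (H.sq_w1 t y).1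
    exact (h1.integrable_mul h2.star).const_mul _
  have e : ∀ s, P11 u κ t s (y - d) y = (gd u t d y * (w1 u κ s t (y - d) * conj (w1 u κ s t y))).im := by
    intro s
    unfold P11 gd
    congr 1
    simp only [map_mul, conj_conj]; ring
  simp_rw [e]
  have e2 := integral_im (𝕜 := ℂ) i
  simp only [RCLike.im_to_complex] at e2
  rw [e2, integral_const_mul, hw]
  have e3 : conj (CE (-(4 * κ) : ℝ) (gd u t d) y) = ∫ r in Ioi (0 : ℝ), cexp ((-(4 * κ) : ℝ) * r) * (u t (y - d - r) * conj (u t (y - r))) := by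
    unfold CE gd
    rw [← integral_conj]
    congr 1; ext r
    rw [map_mul, map_mul, conj_conj, ← Complex.exp_conj, map_mul, conj_ofReal, conj_ofReal]
    congr 2
    ring_nf
  rw [e3, ← im_ofReal_mul]
  congr 1; ring

lemma St.N11_eq (H : St u ux uxx ut κ M) (t : ℝ) : IntegrableOn (fun d => (∫ y, gd u t d y * conj (CE (-(4 * κ) : ℝ) (gd u t d) y)).im) (Ioi 0) ∧
    ∫ s, ∫ z, P11 u κ t s (z.1 - z.2) z.1 ∂nuu = Real.pi * ∫ d in Ioi (0 : ℝ), (∫ y, gd u t d y * conj (CE (-(4 * κ) : ℝ) (gd u t d) y)).im := by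
  have hκ := H.pos
  have pi0 := Real.pi_pos
  have i := (H.pbP11 t).int
  rw [integral_integral_swap (f := fun s (z : ℝ × ℝ) => P11 u κ t s (z.1 - z.2) z.1) i]
  have i2 : Integrable (fun z : ℝ × ℝ => ∫ s, P11 u κ t s (z.1 - z.2) z.1) nuu := i.integral_prod_right
  simp_rw [H.P11_s] at i2 ⊢
  have i3 : Integrable (fun z : ℝ × ℝ => (gd u t z.2 z.1 * conj (CE (-(4 * κ) : ℝ) (gd u t z.2) z.1)).im) nuu := by
    refine (i2.const_mul Real.pi⁻¹).congr (Eventually.of_forall fun z => ?_)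
    simp only
    rw [← mul_assoc, inv_mul_cancel₀ pi0.ne', one_mul]
  rw [integral_const_mul]
  obtain ⟨K, hK⟩ := H.gd_bd t
  have e : ∀ d, ∫ y, (gd u t d y * conj (CE (-(4 * κ) : ℝ) (gd u t d) y)).im = (∫ y, gd u t d y * conj (CE (-(4 * κ) : ℝ) (gd u t d) y)).im := by
    intro d
    have h1 := mem2_of_bdd (H.gd_i t d) (hK d)
    have h2 := CE_L2 (by linarith : 0 < 4 * κ) (H.gd_c t d) (H.gd_i t d) (hK d)
    have e2 := integral_im (𝕜 := ℂ) (h1.integrable_mul h2.star)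
    exact e2
  unfold nuu at i3 ⊢
  have i4 := i3.integral_prod_right
  simp only [e] at i4
  refine ⟨i4, ?_⟩
  rw [integral_prod_symm _ i3]
  simp only [e]

lemma St.N_diff (H : St u ux uxx ut κ M) (t : ℝ) : |(∫ s, NN u κ s t) - Real.pi * ∫ d in Ioi (0 : ℝ), (∫ y, gd u t d y * conj (CE (-(4 * κ) : ℝ) (gd u t d) y)).im| ≤
    12 * Real.pi * M ^ 3 / κ ^ 2 := by
  have hκ := H.pos
  have hM := H.M0
  have pi0 := Real.pi_pos
  have i1 := (H.pbP t).int
  have i2 := (H.pbP11 t).int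
  rw [← (H.N11_eq t).2, integral_congr_ae (H.NN_eq t), ← integral_sub i1.integral_prod_left i2.integral_prod_left]
  have e : ∫ s, ((∫ z, PP u κ t s (z.1 - z.2) z.1 ∂nuu) - ∫ z, P11 u κ t s (z.1 - z.2) z.1 ∂nuu) =
      ∫ s, ∫ z, (PP u κ t s (z.1 - z.2) z.1 - P11 u κ t s (z.1 - z.2) z.1) ∂nuu := by
    refine integral_congr_ae ?_
    filter_upwards [i1.prod_right_ae, i2.prod_right_ae] with s h1 h2
    rw [integral_sub h1 h2]
  rw [e]
  refine ((H.pbD t).bd).trans ?_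
  calc 6 * Real.pi * (M / κ) * (∫ x, qu u κ t x) ^ 2 ≤ 6 * Real.pi * (M / κ) * (2 * M ^ 2 / κ) := by
        have := H.q_intg t
        gcongr
    _ = _ := by field_simp; ring
end

lemma NN_sum {u ux uxx ut : ℝ → ℝ → ℂ} {k0 M : ℝ} (H : ∀ j : ℕ, St u ux uxx ut (2 ^ j * k0) M) (J : ℕ) (t : ℝ) :
    |∑ j ∈ Finset.range J, (2 ^ j * k0) * ∫ s, NN u (2 ^ j * k0) s t| ≤ 5 / 4 * Real.pi * M ^ 2 + 24 * Real.pi * M ^ 3 / k0 := by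
  have H0 := H 0
  have hκ : 0 < k0 := by have := H0.pos; simpa using this
  have hM := H0.M0
  have pi0 := Real.pi_pos
  set n : ℕ → ℝ := fun j => Real.pi * ∫ d in Ioi (0 : ℝ), (∫ y, gd u t d y * conj (CE (-(4 * (2 ^ j * k0)) : ℝ) (gd u t d) y)).im with hn
  have e : ∑ j ∈ Finset.range J, (2 ^ j * k0) * ∫ s, NN u (2 ^ j * k0) s t =
      ∑ j ∈ Finset.range J, (2 ^ j * k0) * n j + ∑ j ∈ Finset.range J, (2 ^ j * k0) * ((∫ s, NN u (2 ^ j * k0) s t) - n j) := by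
    rw [← Finset.sum_add_distrib]; refine Finset.sum_congr rfl fun j _ => by ring
  rw [e]
  refine (abs_add_le _ _).trans (add_le_add ?_ ?_)
  · have e2 : ∑ j ∈ Finset.range J, (2 ^ j * k0) * n j = Real.pi * ∫ d in Ioi (0 : ℝ), ∑ j ∈ Finset.range J, (2 ^ j * k0) *
        (∫ y, gd u t d y * conj (CE (-(4 * (2 ^ j * k0)) : ℝ) (gd u t d) y)).im := by
      rw [integral_finsetSum _ (fun j _ => ((H j).N11_eq t).1.const_mul _), Finset.mul_sum]
      refine Finset.sum_congr rfl fun j _ => ?_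
      rw [integral_const_mul, hn]; ring
    obtain ⟨K, hK⟩ := H0.gd_bd t
    obtain ⟨q1, q2⟩ := qq_int (H0.g.df.cx t) (ff_nonneg u t) (H0.g.df.integrable t)
    rw [H0.hM t] at q2
    unfold nuu at q1 q2
    rw [integral_prod_symm _ q1] at q2
    have q3 := q1.integral_prod_right
    have h3 : |∫ d in Ioi (0 : ℝ), ∑ j ∈ Finset.range J, (2 ^ j * k0) *
        (∫ y, gd u t d y * conj (CE (-(4 * (2 ^ j * k0)) : ℝ) (gd u t d) y)).im| ≤ ∫ d in Ioi (0 : ℝ), 5 / 4 * ∫ y, ff u t (y - d) * ff u t y := by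
      rw [← Real.norm_eq_abs]
      refine norm_integral_le_of_norm_le (q3.const_mul _) (Eventually.of_forall fun d => ?_)
      refine (hil hκ (H0.gd_c t d) (H0.gd_i t d) (hK d) J).trans (le_of_eq ?_)
      congr 2; ext y
      unfold gd
      rw [norm_mul, RCLike.norm_conj, mul_pow, H0.ff_eq_norm, H0.ff_eq_norm]
    rw [integral_const_mul] at h3
    rw [e2, abs_mul, abs_of_pos pi0]
    have h4 := mul_le_mul_of_nonneg_left (h3.trans (mul_le_mul_of_nonneg_left q2 (by norm_num))) pi0.le
    refine h4.trans (le_of_eq (by ring))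
  · refine (Finset.abs_sum_le_sum_abs _ _).trans ?_
    have h1 : ∀ j ∈ Finset.range J, |(2 ^ j * k0) * ((∫ s, NN u (2 ^ j * k0) s t) - n j)| ≤ 12 * Real.pi * M ^ 3 / k0 * (1 / 2) ^ j := by
      intro j _
      have hj : (0:ℝ) < 2 ^ j * k0 := by positivity
      rw [abs_mul, abs_of_pos hj]
      have := mul_le_mul_of_nonneg_left ((H j).N_diff t) hj.le
      refine this.trans (le_of_eq ?_)
      rw [one_div, inv_pow]; field_simp
    refine (Finset.sum_le_sum h1).trans ?_
    rw [← Finset.mul_sum]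
    have h2 : ∑ j ∈ Finset.range J, (1 / 2 : ℝ) ^ j ≤ 2 := sum_geometric_two_le J
    have : 12 * Real.pi * M ^ 3 / k0 * ∑ j ∈ Finset.range J, (1 / 2 : ℝ) ^ j ≤ 12 * Real.pi * M ^ 3 / k0 * 2 := by gcongr
    refine this.trans (le_of_eq (by ring))

end PartBl

noncomputable section PartBm
set_option linter.unusedSectionVars false
open scoped ComplexConjugate
open Filter Topology Set

section
variable {u ux uxx ut : ℝ → ℝ → ℂ} {κ M : ℝ} (H : St u ux uxx ut κ M)

lemma St.mm_nn (H : St u ux uxx ut κ M) (t x : ℝ) : 0 ≤ mm u κ t x := by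
  have hκ := H.pos
  exact mul_nonneg (by linarith) (EE_nonneg (fun y => ff_nonneg u t y) x)

lemma St.mm_le (H : St u ux uxx ut κ M) (t x : ℝ) : mm u κ t x ≤ 4 * κ * M := by
  have hκ := H.pos
  have := EE_le_int (by linarith : 0 < 4 * κ) (ff_nonneg u t) (H.g.df.integrable t) x
  rw [H.hM t] at this
  unfold mm
  gcongr

lemma St.mm_eb (H : St u ux uxx ut κ M) (t x : ℝ) : mm u κ t x ≤ 8 * eb u κ t x := by
  have hκ := H.pos
  have := mul_le_mul_of_nonneg_left (H.E_anti t x) (by linarith : 0 ≤ 4 * κ)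
  unfold mm eb
  linarith

lemma St.a1_pt (H : St u ux uxx ut κ M) (s t x : ℝ) : mm u κ t x * a1 u κ s t x ^ 2 ≤ 30 * κ ^ 2 * RC u κ s t x +
    30 * κ ^ 2 * |mm u κ t x - ff u t x| * (E0 u κ t x / κ) * pp u κ s t x +
    2 * mm u κ t x * ff u t x * DD u κ s t x ^ 2 := by
  have hκ := H.pos
  have hM := H.M0
  have hk := H.hk
  have m0 := H.mm_nn t x
  have m1 := H.mm_le t x
  have f0 := ff_nonneg u t x
  have p0 := H.p_nn s t x
  have r := H.RC_lower s t x
  have d0 := H.D_nn s t x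
  have h1 : (aa u κ s t x - a1 u κ s t x) ^ 2 ≤ ff u t x * DD u κ s t x ^ 2 := by
    have := pow_le_pow_left₀ (abs_nonneg _) (H.aa1 s t x) 2
    rw [sq_abs, mul_pow, ← H.ff_eq_norm] at this
    exact this
  have hL : aa u κ s t x = (LL u κ s t x + 4 * κ * TT u κ s t x) / 2 := by unfold LL; ring
  have hT2 : TT u κ s t x ^ 2 ≤ 16 / 9 * pp u κ s t x ^ 2 := by
    have := pow_le_pow_left₀ (H.T_nn s t x) (H.T_le s t x) 2
    nlinarith
  have h2 : aa u κ s t x ^ 2 ≤ LL u κ s t x ^ 2 / 2 + 15 * κ ^ 2 * pp u κ s t x ^ 2 := by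
    have h3 : κ ^ 2 * TT u κ s t x ^ 2 ≤ κ ^ 2 * (16 / 9 * pp u κ s t x ^ 2) := by gcongr
    have h4 : 0 ≤ κ ^ 2 * pp u κ s t x ^ 2 := by positivity
    rw [hL]
    nlinarith [sq_nonneg (LL u κ s t x - 4 * κ * TT u κ s t x)]
  have h5 : a1 u κ s t x ^ 2 ≤ LL u κ s t x ^ 2 + 30 * κ ^ 2 * pp u κ s t x ^ 2 + 2 * (ff u t x * DD u κ s t x ^ 2) := by
    nlinarith [sq_nonneg (aa u κ s t x + (aa u κ s t x - a1 u κ s t x))]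
  have h6 := mul_le_mul_of_nonneg_left h5 m0
  have h7 : mm u κ t x * LL u κ s t x ^ 2 ≤ 30 * κ ^ 2 * LL u κ s t x ^ 2 := by
    refine mul_le_mul_of_nonneg_right ?_ (sq_nonneg _)
    nlinarith
  have h8 : mm u κ t x ≤ ff u t x + |mm u κ t x - ff u t x| := by linarith [le_abs_self (mm u κ t x - ff u t x)]
  have h9 : pp u κ s t x ^ 2 ≤ E0 u κ t x / κ * pp u κ s t x := by
    rw [sq]; exact mul_le_mul_of_nonneg_right (H.p_le s t x) p0
  have h10 : mm u κ t x * (30 * κ ^ 2 * pp u κ s t x ^ 2) ≤ 30 * κ ^ 2 * (ff u t x * pp u κ s t x ^ 2) +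
      30 * κ ^ 2 * |mm u κ t x - ff u t x| * (E0 u κ t x / κ * pp u κ s t x) := by
    have a : mm u κ t x * (30 * κ ^ 2 * pp u κ s t x ^ 2) ≤ (ff u t x + |mm u κ t x - ff u t x|) * (30 * κ ^ 2 * pp u κ s t x ^ 2) := by gcongr
    have b : 30 * κ ^ 2 * |mm u κ t x - ff u t x| * pp u κ s t x ^ 2 ≤ 30 * κ ^ 2 * |mm u κ t x - ff u t x| * (E0 u κ t x / κ * pp u κ s t x) := by gcongr
    linarith
  have h11 := mul_le_mul_of_nonneg_left r (by positivity : 0 ≤ 30 * κ ^ 2)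
  linarith

set_option maxHeartbeats 1000000 in
lemma St.fm2_pt (H : St u ux uxx ut κ M) (t x : ℝ) : ff u t x * mm u κ t x ^ 2 ≤ 240 * κ ^ 3 / Real.pi * (∫ s, RC u κ s t x) +
    512 * (M / κ) ^ 2 * (ff u t x ^ 3 + eb u κ t x ^ 3) + (3840 ^ 2 * κ * M * hh u κ t x + eb u κ t x ^ 3 / 8) := by
  have hκ := H.pos
  have hM := H.M0
  have pi0 := Real.pi_pos
  have m0 := H.mm_nn t x
  have f0 := ff_nonneg u t x
  have e0 := H.E_nonneg t x
  have e1 := H.E_le t x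
  have b0 := H.eb_nn t x
  obtain ⟨ia, ea⟩ := a1_sq_int H.h t x
  obtain ⟨ip, bp⟩ := H.sb_p.2 t x
  obtain ⟨iD, bD⟩ := H.sb_D2.2 t x
  simp only at iD bD bp
  obtain ⟨iR, -⟩ := H.sb_RC.2 t x
  have bp' := (le_abs_self _).trans ((abs_integral_le_integral_abs (f := fun s => pp u κ s t x)).trans bp)
  have bD' := (le_abs_self _).trans ((abs_integral_le_integral_abs (f := fun s => DD u κ s t x ^ 2)).trans bD)
  have i1 := iR.const_mul (30 * κ ^ 2)
  have i2 := ip.const_mul (30 * κ ^ 2 * |mm u κ t x - ff u t x| * (E0 u κ t x / κ))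
  have i3 := iD.const_mul (2 * mm u κ t x * ff u t x)
  have k := integral_mono (ia.const_mul (mm u κ t x)) ((i1.add i2).add i3) (fun s => H.a1_pt s t x)
  rw [integral_add' (i1.add i2) i3, integral_add' i1 i2, integral_const_mul, integral_const_mul, integral_const_mul, integral_const_mul] at k
  have k2 : 30 * κ ^ 2 * |mm u κ t x - ff u t x| * (E0 u κ t x / κ) * (∫ s, pp u κ s t x) ≤
    30 * κ ^ 2 * |mm u κ t x - ff u t x| * (E0 u κ t x / κ) * (4 * Real.pi * E0 u κ t x) := by gcongr
  have k3 : 2 * mm u κ t x * ff u t x * (∫ s, DD u κ s t x ^ 2) ≤ 2 * mm u κ t x * ff u t x * (2 * Real.pi * E0 u κ t x ^ 3 / κ ^ 2) := by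
    gcongr
  set R := ∫ s, RC u κ s t x
  have k4 : mm u κ t x * (∫ s, a1 u κ s t x ^ 2) ≤ 30 * κ ^ 2 * R + 30 * κ ^ 2 * |mm u κ t x - ff u t x| * (E0 u κ t x / κ) * (4 * Real.pi * E0 u κ t x)
    + 2 * mm u κ t x * ff u t x * (2 * Real.pi * E0 u κ t x ^ 3 / κ ^ 2) := by linarith
  have k5 := mul_le_mul_of_nonneg_left k4 (by positivity : 0 ≤ 8 * κ / Real.pi)
  have l : 8 * κ / Real.pi * (mm u κ t x * (∫ s, a1 u κ s t x ^ 2)) = ff u t x * mm u κ t x ^ 2 := by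
    have : (∫ s, a1 u κ s t x ^ 2) = ff u t x * (Real.pi * EE (4 * κ) (ff u t) x) / 2 := by linarith
    rw [this, show EE (4 * κ) (ff u t) x = mm u κ t x / (4 * κ) by unfold mm; field_simp]
    field_simp; ring
  have hE : E0 u κ t x = 2 * eb u κ t x / κ := by unfold eb; field_simp
  have r : 8 * κ / Real.pi * (30 * κ ^ 2 * R + 30 * κ ^ 2 * |mm u κ t x - ff u t x| * (E0 u κ t x / κ) * (4 * Real.pi * E0 u κ t x)
    + 2 * mm u κ t x * ff u t x * (2 * Real.pi * E0 u κ t x ^ 3 / κ ^ 2)) = 240 * κ ^ 3 / Real.pi * R +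
      3840 * |mm u κ t x - ff u t x| * eb u κ t x ^ 2 + 32 * mm u κ t x * ff u t x * E0 u κ t x ^ 2 * (2 * eb u κ t x / κ) / κ := by
    rw [← hE, show eb u κ t x = κ / 2 * E0 u κ t x from rfl]; field_simp; ring
  rw [l, r] at k5
  have t3 : 32 * mm u κ t x * ff u t x * E0 u κ t x ^ 2 * (2 * eb u κ t x / κ) / κ ≤ 512 * (M / κ) ^ 2 * (ff u t x ^ 3 + eb u κ t x ^ 3) := by
    have m1 := H.mm_eb t x
    calc 32 * mm u κ t x * ff u t x * E0 u κ t x ^ 2 * (2 * eb u κ t x / κ) / κ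
        ≤ 32 * (8 * eb u κ t x) * ff u t x * M ^ 2 * (2 * eb u κ t x / κ) / κ := by gcongr
      _ = 512 * (M / κ) ^ 2 * (eb u κ t x ^ 2 * ff u t x) := by field_simp; ring
      _ ≤ _ := by
        gcongr
        rcases le_total (eb u κ t x) (ff u t x) with q | q
        · have : eb u κ t x ^ 2 * ff u t x ≤ ff u t x ^ 2 * ff u t x := by gcongr
          nlinarith [pow_nonneg b0 3]
        · have : eb u κ t x ^ 2 * ff u t x ≤ eb u κ t x ^ 2 * eb u κ t x := by gcongr
          nlinarith [pow_nonneg f0 3]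
  have t2 : 3840 * |mm u κ t x - ff u t x| * eb u κ t x ^ 2 ≤ 3840 ^ 2 * κ * M * hh u κ t x + eb u κ t x ^ 3 / 8 := by
    have b1 : eb u κ t x ≤ κ * M / 2 := by unfold eb; nlinarith
    have g := H.hh_ge t x
    have y : 3840 ^ 2 * κ * M * |mm u κ t x - ff u t x| ^ 2 ≤ 3840 ^ 2 * κ * M * hh u κ t x := by
      have : |mm u κ t x - ff u t x| ^ 2 ≤ hh u κ t x := by rw [sq_abs]; linarith [g, (by ring : (mm u κ t x - ff u t x) ^ 2 = (ff u t x - mm u κ t x) ^ 2)]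
      gcongr
    refine le_trans ?_ (add_le_add_left y _)
    set d := |mm u κ t x - ff u t x|
    set b := eb u κ t x
    have y2 : b ^ 3 * b ≤ b ^ 3 * (κ * M / 2) := by gcongr
    have P : 0 < κ * M := by positivity
    have z : 3840 * d * b ^ 2 ≤ 3840 ^ 2 * κ * M * d ^ 2 + b ^ 4 / (4 * (κ * M)) := by
      have : 0 ≤ (2 * 3840 * (κ * M) * d - b ^ 2) ^ 2 / (4 * (κ * M)) := by positivity
      have e : (2 * 3840 * (κ * M) * d - b ^ 2) ^ 2 / (4 * (κ * M)) = 3840 ^ 2 * κ * M * d ^ 2 + b ^ 4 / (4 * (κ * M)) - 3840 * d * b ^ 2 := by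
        field_simp; ring
      linarith
    have w : b ^ 4 / (4 * (κ * M)) ≤ b ^ 3 / 8 := by
      rw [div_le_div_iff₀ (by positivity) (by norm_num)]; linarith [y2, (by ring : b ^ 4 = b ^ 3 * b)]
    linarith
  linarith
end

section
variable {u ux uxx ut : ℝ → ℝ → ℂ} {k0 M : ℝ} (H : ∀ j : ℕ, St u ux uxx ut (2 ^ j * k0) M)

lemma XX_nn (H : ∀ j : ℕ, St u ux uxx ut (2 ^ j * k0) M) (T : ℝ) (hT : 0 ≤ T) : 0 ≤ XX u T :=
  intervalIntegral.integral_nonneg (by linarith) fun t _ => integral_nonneg fun x => pow_nonneg (ff_nonneg u t x) 3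

lemma H_sum (H : ∀ j : ℕ, St u ux uxx ut (2 ^ j * k0) M) (J : ℕ) (T : ℝ) (hT : 0 ≤ T) : ∑ j ∈ Finset.range J, (2 ^ j * k0) * HH u (2 ^ j * k0) T ≤
    7 * M ^ 2 + 19200 * M / k0 ^ 2 * XX u T := by
  have hκ : 0 < k0 := by have := (H 0).pos; simpa using this
  have hk : 64 * M ≤ k0 := by have := (H 0).hk; simpa using this
  have hM := (H 0).M0
  have pi0 := Real.pi_pos
  have X0 := XX_nn H T hT
  have h1 : ∀ j ∈ Finset.range J, (2 ^ j * k0) * HH u (2 ^ j * k0) T ≤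
      2 / Real.pi * ((2 ^ j * k0) * (∫ s, NN u (2 ^ j * k0) s T)) - 2 / Real.pi * ((2 ^ j * k0) * (∫ s, NN u (2 ^ j * k0) s (-T))) +
        9600 * M / k0 ^ 2 * XX u T * (1 / 2) ^ j := by
    intro j _
    have hj : (0:ℝ) < 2 ^ j * k0 := by positivity
    have := (H j).B_est T hT
    rw [integral_sub ((H j).NN_i T) ((H j).NN_i (-T))] at this
    have h2 := mul_le_mul_of_nonneg_left this (by positivity : 0 ≤ 2 / Real.pi * (2 ^ j * k0))
    have e1 : 2 / Real.pi * (2 ^ j * k0) * (Real.pi / 2 * HH u (2 ^ j * k0) T) = (2 ^ j * k0) * HH u (2 ^ j * k0) T := by field_simp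
    have e2 : 2 / Real.pi * (2 ^ j * k0) * (4800 * Real.pi * M / (2 ^ j * k0) ^ 3 * XX u T) = 9600 * M / k0 ^ 2 * XX u T * ((1 / 2) ^ j * (1 / 2) ^ j) := by
      rw [one_div, inv_pow]; field_simp; ring
    have e3 : ((1 / 2 : ℝ) ^ j * (1 / 2) ^ j) ≤ (1 / 2) ^ j := by
      have a : (0:ℝ) ≤ (1 / 2) ^ j := by positivity
      have b : (1 / 2 : ℝ) ^ j ≤ 1 := pow_le_one₀ (by norm_num) (by norm_num)
      nlinarith
    have e4 : 9600 * M / k0 ^ 2 * XX u T * ((1 / 2) ^ j * (1 / 2) ^ j) ≤ 9600 * M / k0 ^ 2 * XX u T * (1 / 2) ^ j := by gcongr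
    rw [mul_add, e1, e2] at h2
    linarith
  refine (Finset.sum_le_sum h1).trans ?_
  rw [Finset.sum_add_distrib, Finset.sum_sub_distrib, ← Finset.mul_sum, ← Finset.mul_sum, ← Finset.mul_sum]
  have n1 := (le_abs_self _).trans (NN_sum H J T)
  have n2 := neg_le_of_abs_le (NN_sum H J (-T))
  have n3 : 2 / Real.pi * (∑ j ∈ Finset.range J, (2 ^ j * k0) * ∫ s, NN u (2 ^ j * k0) s T) -
      2 / Real.pi * (∑ j ∈ Finset.range J, (2 ^ j * k0) * ∫ s, NN u (2 ^ j * k0) s (-T)) ≤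
      2 / Real.pi * (2 * (5 / 4 * Real.pi * M ^ 2 + 24 * Real.pi * M ^ 3 / k0)) := by
    rw [← mul_sub]
    gcongr
    linarith
  have n4 : 2 / Real.pi * (2 * (5 / 4 * Real.pi * M ^ 2 + 24 * Real.pi * M ^ 3 / k0)) = 5 * M ^ 2 + 96 * M ^ 3 / k0 := by field_simp; ring
  have n5 : 96 * M ^ 3 / k0 ≤ 2 * M ^ 2 := by
    rw [div_le_iff₀ hκ]
    nlinarith [sq_nonneg M]
  have h2 : ∑ j ∈ Finset.range J, (1 / 2 : ℝ) ^ j ≤ 2 := sum_geometric_two_le J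
  have n6 : 9600 * M / k0 ^ 2 * XX u T * ∑ j ∈ Finset.range J, (1 / 2 : ℝ) ^ j ≤ 9600 * M / k0 ^ 2 * XX u T * 2 := by gcongr
  linarith [(by ring : 9600 * M / k0 ^ 2 * XX u T * 2 = 19200 * M / k0 ^ 2 * XX u T)]

lemma f3_pt (H : ∀ j : ℕ, St u ux uxx ut (2 ^ j * k0) M) (J : ℕ) (t x : ℝ) (hJ : ff u t x ≤ 16 * M * (2 ^ J * k0)) (J0 : 0 < J) :
    ff u t x ^ 3 ≤ 64 * M * (∑ j ∈ Finset.range J, (2 ^ j * k0) * hh u (2 ^ j * k0) t x) + 2 * (ff u t x * mm u k0 t x ^ 2) := by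
  have hκ : 0 < k0 := by have := (H 0).pos; simpa using this
  have hM := (H 0).M0
  have f0 := ff_nonneg u t x
  have nn : ∀ j ∈ Finset.range J, 0 ≤ (2 ^ j * k0) * hh u (2 ^ j * k0) t x := fun j _ =>
    mul_nonneg (by positivity) ((H j).hh_nn t x)
  have single : ∀ j, j < J → (2 ^ j * k0) * hh u (2 ^ j * k0) t x ≤ ∑ j ∈ Finset.range J, (2 ^ j * k0) * hh u (2 ^ j * k0) t x :=
    fun j hj => Finset.single_le_sum nn (Finset.mem_range.2 hj)
  by_cases hf : ff u t x ≤ 16 * M * k0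
  · have g := (H 0).hh_ge t x
    have s0 := single 0 J0
    simp only [pow_zero, one_mul] at g s0
    have s1 := mul_le_mul_of_nonneg_left s0 hM.le
    have h0 : 0 ≤ hh u k0 t x := (sq_nonneg _).trans g
    have a : ff u t x ^ 2 ≤ 2 * hh u k0 t x + 2 * mm u k0 t x ^ 2 := by
      nlinarith [sq_nonneg (ff u t x - 2 * mm u k0 t x)]
    have b := mul_le_mul_of_nonneg_left a f0
    have c : ff u t x * hh u k0 t x ≤ 16 * M * k0 * hh u k0 t x := by gcongr
    have d : 0 ≤ M * (k0 * hh u k0 t x) := by positivity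
    nlinarith
  · push Not at hf
    have ex : ∃ n : ℕ, ff u t x ≤ 16 * M * (2 ^ n * k0) := ⟨J, hJ⟩
    classical
    have h1 := Nat.find_spec ex
    have h2 : Nat.find ex ≤ J := Nat.find_min' ex hJ
    rcases hn : Nat.find ex with _ | j
    · rw [hn] at h1; simp at h1; linarith
    · rw [hn] at h1 h2
      have h3 := Nat.find_min ex (m := j) (by omega)
      push Not at h3
      set κ := 2 ^ j * k0 with hk
      have κ0 : 0 < κ := by positivity
      have e : 16 * M * (2 ^ (j + 1) * k0) = 32 * M * κ := by rw [hk, pow_succ]; ring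
      rw [e] at h1
      have m1 := (H j).mm_le t x
      have g := (H j).hh_ge t x
      rw [← hk] at m1 g
      have a : 3 / 4 * ff u t x ≤ ff u t x - mm u κ t x := by linarith
      have b := pow_le_pow_left₀ (by positivity) a 2
      have c : ff u t x ^ 2 ≤ 2 * hh u κ t x := by nlinarith [sq_nonneg (ff u t x)]
      have h0 : 0 ≤ hh u κ t x := (sq_nonneg _).trans g
      have d : ff u t x * ff u t x ^ 2 ≤ 32 * M * κ * (2 * hh u κ t x) := by gcongr
      have s1 := mul_le_mul_of_nonneg_left (single j (by omega)) hM.le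
      have w : 0 ≤ ff u t x * mm u k0 t x ^ 2 := by positivity
      nlinarith
end

end PartBm

noncomputable section PartBn
set_option linter.unusedSectionVars false
open scoped ComplexConjugate
open Filter Topology Set

section
variable {u ux uxx ut : ℝ → ℝ → ℂ} {k0 M : ℝ} (H : ∀ j : ℕ, St u ux uxx ut (2 ^ j * k0) M)

lemma f3_t (H : ∀ j : ℕ, St u ux uxx ut (2 ^ j * k0) M) (J : ℕ) (J0 : 0 < J) (t : ℝ) (hJ : ∀ x, ff u t x ≤ 16 * M * (2 ^ J * k0)) :
    ∫ x, ff u t x ^ 3 ≤ 64 * M * (∑ j ∈ Finset.range J, (2 ^ j * k0) * ∫ x, hh u (2 ^ j * k0) t x) +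
      480 * k0 ^ 3 / Real.pi * (∫ x, ∫ s, RC u k0 s t x) + (2048 * (M / k0) ^ 2 + 1 / 4) * (∫ x, ff u t x ^ 3) +
      2 * 3840 ^ 2 * k0 * M * ∫ x, hh u k0 t x := by
  have H0 : St u ux uxx ut k0 M := by simpa using H 0
  have hκ := H0.pos
  have hM := H0.M0
  have iS : Integrable (fun x => ∑ j ∈ Finset.range J, (2 ^ j * k0) * hh u (2 ^ j * k0) t x) :=
    integrable_finsetSum _ fun j _ => ((H j).dhh.integrable t).const_mul _
  have iR := (H0.sb_RC.fub1 H0.dBC t).2.1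
  have i1 := iS.const_mul (64 * M)
  have i2 := iR.const_mul (480 * k0 ^ 3 / Real.pi)
  have i3 := (H0.g.df.cube.integrable t).const_mul (1024 * (M / k0) ^ 2)
  have i4 := (H0.deb.cube.integrable t).const_mul (1024 * (M / k0) ^ 2 + 1 / 4)
  have i5 := (H0.dhh.integrable t).const_mul (2 * 3840 ^ 2 * k0 * M)
  have h := integral_mono (H0.g.df.cube.integrable t) ((((i1.add i2).add i3).add i4).add i5) (fun x => by
    have h1 := f3_pt H J t x (hJ x) J0
    have h2 := H0.fm2_pt t x
    simp only [Pi.add_apply]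
    linarith [(by ring : 480 * k0 ^ 3 / Real.pi * (∫ s, RC u k0 s t x) = 2 * (240 * k0 ^ 3 / Real.pi * (∫ s, RC u k0 s t x)))])
  rw [integral_add' (((i1.add i2).add i3).add i4) i5, integral_add' ((i1.add i2).add i3) i4, integral_add' (i1.add i2) i3,
    integral_add' i1 i2] at h
  simp only [integral_const_mul] at h
  rw [integral_finsetSum _ fun j _ => ((H j).dhh.integrable t).const_mul _] at h
  simp only [integral_const_mul] at h
  have e := mul_le_mul_of_nonneg_left (H0.eb_intg t) (by positivity : 0 ≤ 1024 * (M / k0) ^ 2 + 1 / 4)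
  linarith

lemma X_le (H : ∀ j : ℕ, St u ux uxx ut (2 ^ j * k0) M) (hk : k0 = 2000000 * M) (T : ℝ) (hT : 0 ≤ T) : XX u T ≤ 10 ^ 11 * M ^ 3 := by
  have H0 : St u ux uxx ut k0 M := by simpa using H 0
  have hκ := H0.pos
  have hM := H0.M0
  have pi0 := Real.pi_pos
  obtain ⟨C, C0, hC⟩ := H0.g.df.2 T
  obtain ⟨J, hJ⟩ : ∃ J : ℕ, C / (16 * M * k0) < 2 ^ J := pow_unbounded_of_one_lt _ (by norm_num)
  have hJ2 : C ≤ 16 * M * (2 ^ (J + 1) * k0) := by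
    rw [div_lt_iff₀ (by positivity)] at hJ
    have : (0:ℝ) ≤ 2 ^ J * (16 * M * k0) := by positivity
    rw [pow_succ]; linarith
  have fb : ∀ t ∈ Icc (-T) T, ∀ x, ff u t x ≤ 16 * M * (2 ^ (J + 1) * k0) := by
    intro t ht x
    have := hC t x (abs_le.2 ht)
    have h1 : (1 + x ^ 2)⁻¹ ≤ 1 := inv_le_one_of_one_le₀ (by nlinarith [sq_nonneg x])
    have h2 := le_abs_self (ff u t x)
    rw [Real.norm_eq_abs] at this
    nlinarith
  set n := J + 1
  obtain ⟨-, iR, -⟩ := H0.sb_RC.fub2 H0.dBC (a := -T) (b := T) (by linarith)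
  have jS : ∀ j ∈ Finset.range n, IntervalIntegrable (fun t => (2 ^ j * k0) * ∫ x, hh u (2 ^ j * k0) t x) volume (-T) T :=
    fun j _ => ((H j).dhh.ii (-T) T).const_mul _
  have iS : IntervalIntegrable (fun t => ∑ j ∈ Finset.range n, (2 ^ j * k0) * ∫ x, hh u (2 ^ j * k0) t x) volume (-T) T := by
    refine Continuous.intervalIntegrable ?_ _ _
    exact continuous_finsetSum _ fun j _ => continuous_const.mul (H j).dhh.continuous_integral
  have i1 := iS.const_mul (64 * M)
  have i2 := iR.const_mul (480 * k0 ^ 3 / Real.pi)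
  have i3 := (H0.g.df.cube.ii (-T) T).const_mul (2048 * (M / k0) ^ 2 + 1 / 4)
  have i4 := (H0.dhh.ii (-T) T).const_mul (2 * 3840 ^ 2 * k0 * M)
  have h := intervalIntegral.integral_mono_on (by linarith : -T ≤ T) (H0.g.df.cube.ii (-T) T) (((i1.add i2).add i3).add i4)
    (fun t ht => f3_t H n (Nat.succ_pos J) t (fb t ht))
  have e := intervalIntegral.integral_add ((i1.add i2).add i3) i4
  have e2 := intervalIntegral.integral_add (i1.add i2) i3
  have e3 := intervalIntegral.integral_add i1 i2
  have e4 := intervalIntegral.integral_finsetSum jS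
  simp only [intervalIntegral.integral_const_mul, Pi.add_apply] at h e e2 e3 e4
  rw [e, e2, e3, e4] at h
  have hS := H_sum H n T hT
  have hR := H0.C_est T hT
  have X0 := XX_nn H T hT
  have hs : k0 * HH u k0 T ≤ ∑ j ∈ Finset.range n, (2 ^ j * k0) * HH u (2 ^ j * k0) T := by
    have : ∀ j ∈ Finset.range n, 0 ≤ (2 ^ j * k0) * HH u (2 ^ j * k0) T := fun j _ => by
      have : 0 ≤ HH u (2 ^ j * k0) T :=
        intervalIntegral.integral_nonneg (by linarith) fun t _ => integral_nonneg fun x => (H j).hh_nn t x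
      positivity
    have := Finset.single_le_sum this (Finset.mem_range.2 (Nat.succ_pos J))
    simpa using this
  unfold HH at hS hs
  unfold XX at hS X0 ⊢
  set S := ∑ j ∈ Finset.range n, (2 ^ j * k0) * ∫ t in (-T)..T, ∫ x, hh u (2 ^ j * k0) t x
  set X := ∫ t in (-T)..T, ∫ x, ff u t x ^ 3
  set h0 := ∫ t in (-T)..T, ∫ x, hh u k0 t x
  set R := ∫ t in (-T)..T, ∫ x, ∫ s, RC u k0 s t x
  have r1 := mul_le_mul_of_nonneg_left hR (by positivity : 0 ≤ 480 * k0 ^ 3 / Real.pi)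
  have r2 : 480 * k0 ^ 3 / Real.pi * (22 * Real.pi * M ^ 2 / k0 ^ 2) = 10560 * (2000000 * M) * M ^ 2 := by
    rw [← hk]; field_simp; ring
  have r3 := mul_le_mul_of_nonneg_left hs (by positivity : 0 ≤ 2 * 3840 ^ 2 * M)
  have r4 := mul_le_mul_of_nonneg_left hS (by positivity : 0 ≤ 2 * 3840 ^ 2 * M + 64 * M)
  have r5 : (2 * 3840 ^ 2 * M + 64 * M) * (7 * M ^ 2 + 19200 * M / k0 ^ 2 * X) =
    (2 * 3840 ^ 2 + 64) * (7 * M ^ 3 + 19200 / 2000000 ^ 2 * X) := by rw [hk]; field_simp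
  have r6 : (M / k0) ^ 2 = 1 / 2000000 ^ 2 := by rw [hk]; field_simp
  rw [r6] at h
  rw [r2] at r1
  rw [r5] at r4
  have M3 : 0 < M ^ 3 := by positivity
  nlinarith
end

lemma smal_of {u ux uxx ut : ℝ → ℝ → ℂ} {κ M : ℝ} (g : Good u ux uxx ut) (M0 : 0 < M) (hM : ∀ t, ∫ x, ff u t x = M)
    (hk : 64 * M ≤ κ) : St u ux uxx ut κ M := by
  have κ0 : 0 < κ := by linarith
  have bd : ∀ R : ℝ, ∃ C : ℝ, ∀ t x, |t| ≤ R → ‖u t x‖ ≤ C := by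
    intro R
    obtain ⟨C, C0, hC⟩ := g.du.2 R
    refine ⟨C, fun t x ht => (hC t x ht).trans ?_⟩
    have h1 : (1 + x ^ 2)⁻¹ ≤ 1 := inv_le_one_of_one_le₀ (by nlinarith [sq_nonneg x])
    nlinarith
  refine ⟨g, ⟨κ0, g.cu, bd, fun t x => ?_⟩, M0, hM, hk⟩
  obtain ⟨C, hC⟩ := bd |t|
  have c : Continuous (fun y => ‖u t y‖) := (g.du.cx t).norm
  have h1 := EE_cs (l := 2 * κ) (a := 2 * κ) (b := 2 * κ) (by linarith) (by linarith) (by ring)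
    c (h := fun _ => 1) continuous_const (K := C) (L := 1) (fun y => by rw [abs_norm]; exact hC t y le_rfl) (by simp) x
  simp only [mul_one, one_pow] at h1
  rw [EE_const (by linarith)] at h1
  have e : (fun y => ‖u t y‖ ^ 2) = ff u t := by ext y; unfold ff; rw [normSq_eq_norm_sq]
  rw [e] at h1
  have h2 := EE_le_int (by linarith : 0 < 2 * κ) (ff_nonneg u t) (g.df.integrable t) x
  rw [hM t] at h2
  have h3 : EE (2 * κ) (ff u t) x * (1 / (2 * κ)) ≤ M * (1 / (2 * κ)) := by gcongr
  have h4 : M * (1 / (2 * κ)) ≤ 1 / 16 := by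
    rw [mul_one_div, div_le_div_iff₀ (by linarith) (by norm_num)]; linarith
  nlinarith

lemma main_bd {u ux uxx ut : ℝ → ℝ → ℂ} (g : Good u ux uxx ut) (T : ℝ) (hT : 0 ≤ T) :
    XX u T ≤ 10 ^ 11 * (∫ x, ff u 0 x) ^ 3 := by
  have hM : ∀ t, ∫ x, ff u t x = ∫ x, ff u 0 x := fun t => g.mass.mass t
  have h0 : 0 ≤ ∫ x, ff u 0 x := integral_nonneg fun x => ff_nonneg u 0 x
  rcases h0.eq_or_lt with hz | hz
  · have z : ∀ t x, ff u t x = 0 := by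
      intro t x
      have h1 := (integral_eq_zero_iff_of_nonneg (ff_nonneg u t) (g.df.integrable t)).1 ((hM t).trans hz.symm)
      have := Continuous.ae_eq_iff_eq volume (g.df.cx t) continuous_zero |>.1 h1
      exact congrFun this x
    unfold XX
    simp [z]
  · refine X_le (k0 := 2000000 * ∫ x, ff u 0 x) (fun j => smal_of g hz hM ?_) rfl T hT
    have : (1:ℝ) ≤ 2 ^ j := one_le_pow₀ (by norm_num)
    nlinarith

theorem final : ∃ C : ℝ, 0 < C ∧
      ∀ u : ℝ × ℝ → ℂ, IsClassicalSolution 2 u →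
        (∫ t : ℝ, ∫ x : ℝ, ‖u (t, x)‖ ^ 6) ^ ((1 : ℝ) / 3)
          ≤ C * ∫ x : ℝ, ‖u (0, x)‖ ^ 2 := by
  refine ⟨10000, by norm_num, fun u hu => ?_⟩
  have g := good_of_sol hu
  set v : ℝ → ℝ → ℂ := fun t x => u (t, x) with hv
  have e6 : ∀ t x, ‖u (t, x)‖ ^ 6 = ff v t x ^ 3 := fun t x => by
    unfold ff; rw [normSq_eq_norm_sq, ← pow_mul]
  have e2 : ∀ x, ‖u (0, x)‖ ^ 2 = ff v 0 x := fun x => by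
    unfold ff; rw [normSq_eq_norm_sq]
  simp only [e6, e2]
  have h0 : 0 ≤ ∫ x, ff v 0 x := integral_nonneg fun x => ff_nonneg v 0 x
  set M := ∫ x, ff v 0 x
  have key : ∫ t, ∫ x, ff v t x ^ 3 ≤ 10 ^ 11 * M ^ 3 := by
    by_cases hi : Integrable (fun t => ∫ x, ff v t x ^ 3)
    · have lim := intervalIntegral_tendsto_integral (μ := volume) hi
        (tendsto_neg_atTop_atBot) (tendsto_id (α := ℝ) (x := atTop))
      refine le_of_tendsto lim ?_
      filter_upwards [eventually_ge_atTop (0:ℝ)] with T hT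
      exact main_bd g T hT
    · rw [integral_undef hi]; positivity
  have n0 : 0 ≤ ∫ t, ∫ x, ff v t x ^ 3 := integral_nonneg fun t => integral_nonneg fun x => pow_nonneg (ff_nonneg v t x) 3
  calc (∫ t, ∫ x, ff v t x ^ 3) ^ ((1 : ℝ) / 3) ≤ ((10000 * M) ^ 3) ^ ((1 : ℝ) / 3) := by
        refine Real.rpow_le_rpow n0 (key.trans ?_) (by norm_num)
        have : 0 ≤ M ^ 3 := by positivity
        rw [mul_pow]; nlinarith
    _ = 10000 * M := by
        rw [← Real.rpow_natCast, ← Real.rpow_mul (by positivity)]; norm_num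

end PartBn

/-- Global `L⁶` Strichartz bound for the defocusing cubic NLS:
`‖u‖_{L⁶(ℝ×ℝ)}² ≤ C ‖u₀‖_{L²(ℝ)}²`. -/
theorem global_strichartz_defocusing_NLS :
    ∃ C : ℝ, 0 < C ∧
      ∀ u : ℝ × ℝ → ℂ, IsClassicalSolution 2 u →
        (∫ t : ℝ, ∫ x : ℝ, ‖u (t, x)‖ ^ 6) ^ ((1 : ℝ) / 3)
          ≤ C * ∫ x : ℝ, ‖u (0, x)‖ ^ 2 := by
  exact final
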